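/- Let G be a (P2+P3, gem)-free graph with ω(G) ≥ 4. Then either G belongs to the class 𝒞, or χ(G) ≤ ω(G) + 1. -/

import Mathlib

open SimpleGraph

/-- The graph `P2 + P3` (disjoint union of a path on 2 and a path on 3 vertices). -/
def graphP2P3 : SimpleGraph (Fin 5) :=
  SimpleGraph.fromRel (fun x y => (x, y) ∈ ([(0,1),(2,3),(3,4)] : List (Fin 5 × Fin 5)))

/-- The gem: a path `P4` (0-1-2-3) plus a vertex 4 adjacent to all of it. -/
def graphGem : SimpleGraph (Fin 5) :=
  SimpleGraph.fromRel (fun x y =>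
    (x, y) ∈ ([(0,1),(1,2),(2,3),(4,0),(4,1),(4,2),(4,3)] : List (Fin 5 × Fin 5)))

/-- The path on three vertices. -/
def graphP3 : SimpleGraph (Fin 3) :=
  SimpleGraph.fromRel (fun x y => (x, y) ∈ ([(0,1),(1,2)] : List (Fin 3 × Fin 3)))

/-- The cycle on five vertices. -/
def graphC5 : SimpleGraph (Fin 5) :=
  SimpleGraph.fromRel (fun x y => y = x + 1)

/-- `F1`: a 5-cycle `v1 v2 v3 v4 v5` (vertices 0..4) plus a vertex 5 adjacent
exactly to `v5, v1, v2` (i.e. 4, 0, 1). -/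
def graphF1 : SimpleGraph (Fin 6) :=
  SimpleGraph.fromRel (fun x y =>
    (x, y) ∈ ([(0,1),(1,2),(2,3),(3,4),(4,0),(5,4),(5,0),(5,1)] : List (Fin 6 × Fin 6)))

/-- `F1'`: a 5-cycle (0..4) plus adjacent vertices 5, 6, where 5 is adjacent to 4,0,1
and 6 is adjacent to 0,1,2. -/
def graphF1' : SimpleGraph (Fin 7) :=
  SimpleGraph.fromRel (fun x y =>
    (x, y) ∈ ([(0,1),(1,2),(2,3),(3,4),(4,0),(5,4),(5,0),(5,1),(6,0),(6,1),(6,2),(5,6)] :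
      List (Fin 7 × Fin 7)))

/-- `F1''`: a 5-cycle (0..4) plus nonadjacent vertices 5, 6, where 5 is adjacent to 4,0,1
and 6 is adjacent to 1,2,3. -/
def graphF1'' : SimpleGraph (Fin 7) :=
  SimpleGraph.fromRel (fun x y =>
    (x, y) ∈ ([(0,1),(1,2),(2,3),(3,4),(4,0),(5,4),(5,0),(5,1),(6,1),(6,2),(6,3)] :
      List (Fin 7 × Fin 7)))

/-- `F2`: a 5-cycle (0..4) plus adjacent vertices 5, 6, each adjacent to `v1,v3,v4`
(i.e. 0, 2, 3). -/
def graphF2 : SimpleGraph (Fin 7) :=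
  SimpleGraph.fromRel (fun x y =>
    (x, y) ∈ ([(0,1),(1,2),(2,3),(3,4),(4,0),(5,6),(5,0),(5,2),(5,3),(6,0),(6,2),(6,3)] :
      List (Fin 7 × Fin 7)))

/-- `F3`: a 5-cycle (0..4) plus adjacent vertices 5 (adjacent to 0,2,3) and
6 (adjacent to 2,3). -/
def graphF3 : SimpleGraph (Fin 7) :=
  SimpleGraph.fromRel (fun x y =>
    (x, y) ∈ ([(0,1),(1,2),(2,3),(3,4),(4,0),(5,6),(5,0),(5,2),(5,3),(6,2),(6,3)] :
      List (Fin 7 × Fin 7)))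

/-- `G` contains no induced copy of `H`. -/
def IsFreeOf {W V : Type*} (G : SimpleGraph V) (H : SimpleGraph W) : Prop :=
  IsEmpty (H ↪g G)

/-- The disjoint union of a clique blowup `C5⟨K_{t 0},…,K_{t 4}⟩` of the 5-cycle and
`ℓ` isolated vertices. -/
def blowupC5 (t : Fin 5 → ℕ) (ℓ : ℕ) :
    SimpleGraph ((Σ i : Fin 5, Fin (t i)) ⊕ Fin ℓ) :=
  SimpleGraph.fromRel (fun x y => ∃ a b, x = Sum.inl a ∧ y = Sum.inl b ∧
    (a.1 = b.1 ∨ b.1 = a.1 + 1))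

/-- Membership in the class `𝒞`: `G` is isomorphic to the disjoint union of a clique
blowup of `C5` and some number of isolated vertices. -/
def InClassC {V : Type*} (G : SimpleGraph V) : Prop :=
  ∃ (t : Fin 5 → ℕ) (ℓ : ℕ), (∀ i, 0 < t i) ∧ Nonempty (G ≃g blowupC5 t ℓ)

/-- The function φ from the paper. -/
noncomputable def phi (x : ℕ) : ℕ :=
  if x = 1 then 1 else if x = 2 then 4 else if x = 3 then 6
  else ⌈(5 * (x : ℚ) - 1) / 4⌉₊

section Stmt
variable {V : Type*} (G : SimpleGraph V)

/-- `S` is complete to `S'`. -/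
def CompleteTo (S S' : Set V) : Prop := ∀ x ∈ S, ∀ y ∈ S', G.Adj x y

/-- `S` is anticomplete to `S'`. -/
def AnticompleteTo (S S' : Set V) : Prop := ∀ x ∈ S, ∀ y ∈ S', ¬ G.Adj x y

/-- `S` is a stable (independent) set. -/
def IsStableSet (S : Set V) : Prop := S.Pairwise (fun x y => ¬ G.Adj x y)

/-- A graph is perfect if every induced subgraph has chromatic number equal to
its clique number. -/
def IsPerfect : Prop :=
  ∀ S : Set V, (G.induce S).chromaticNumber = ((G.induce S).cliqueNum : ℕ∞)

variable (v : Fin 5 → V)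

/-- `v` induces a `C5` in `G`: two cycle vertices are adjacent iff consecutive. -/
def IsInducedC5 : Prop :=
  Function.Injective v ∧ ∀ i j : Fin 5, G.Adj (v i) (v j) ↔ (j = i + 1 ∨ i = j + 1)

def setA (i : Fin 5) : Set V :=
  {u | u ∉ Set.range v ∧ ∀ j, G.Adj u (v j) ↔ j = i}

def setB (i : Fin 5) : Set V :=
  {u | u ∉ Set.range v ∧ ∀ j, G.Adj u (v j) ↔ (j = i ∨ j = i + 1)}

def setX (i : Fin 5) : Set V :=
  {u | u ∉ Set.range v ∧ ∀ j, G.Adj u (v j) ↔ (j = i - 1 ∨ j = i + 1)}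

def setY (i : Fin 5) : Set V :=
  {u | u ∉ Set.range v ∧ ∀ j, G.Adj u (v j) ↔ (j = i - 1 ∨ j = i ∨ j = i + 1)}

def setZ (i : Fin 5) : Set V :=
  {u | u ∉ Set.range v ∧ ∀ j, G.Adj u (v j) ↔ (j = i - 2 ∨ j = i ∨ j = i + 2)}

def setT : Set V :=
  {u | u ∉ Set.range v ∧ ∀ j, ¬ G.Adj u (v j)}

end Stmt

namespace GemFree

open scoped Classical

section Setup

variable {V : Type*} {G : SimpleGraph V} {K : Finset V}

/-- The neighbours of `v` in the clique `K`. -/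
noncomputable def trace (G : SimpleGraph V) (K : Finset V) (v : V) : Finset V :=
  {x ∈ K | G.Adj v x}

/-- `K` is a maximum clique, of size at least four, in a graph without induced `P2 + P3` or gem. -/
structure Setup (G : SimpleGraph V) (K : Finset V) : Prop where
  p2p3 : ∀ a b c d e, G.Adj a b → G.Adj c d → G.Adj d e → c ≠ e → ¬ G.Adj c e →
    ¬ G.Adj a c → ¬ G.Adj a d → ¬ G.Adj a e → ¬ G.Adj b c → ¬ G.Adj b d → ¬ G.Adj b e → False
  gem : ∀ z a b c d, G.Adj a b → G.Adj b c → G.Adj c d → ¬ G.Adj a c → ¬ G.Adj a d →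
    ¬ G.Adj b d → G.Adj z a → G.Adj z b → G.Adj z c → G.Adj z d → False
  clique : ∀ x ∈ K, ∀ y ∈ K, x ≠ y → G.Adj x y
  max : ∀ Q : Finset V, (∀ x ∈ Q, ∀ y ∈ Q, x ≠ y → G.Adj x y) → Q.card ≤ K.card
  four : 4 ≤ K.card

@[simp, grind =] lemma mem_trace {v x : V} : x ∈ trace G K v ↔ x ∈ K ∧ G.Adj v x := by
  simp [trace]

lemma trace_subset (v : V) : trace G K v ⊆ K := Finset.filter_subset _ _

namespace Setup

variable (h : Setup G K)
include h

lemma exists_not_mem_trace {v : V} (hv : v ∉ K) : ∃ d ∈ K, d ∉ trace G K v := by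
  by_contra! hc
  have := h.max (insert v K) (by
    have := h.clique
    intro x hx y hy hxy
    have h1 : ∀ d ∈ K, G.Adj v d := fun d hd => (mem_trace.1 (hc d hd)).2
    rcases Finset.mem_insert.1 hx with hx | hx <;> rcases Finset.mem_insert.1 hy with hy | hy
    · exact absurd (hx.trans hy.symm) hxy
    · exact hx ▸ h1 _ hy
    · exact hy ▸ (h1 _ hx).symm
    · exact this _ hx _ hy hxy)
  rw [Finset.card_insert_of_notMem hv] at this
  omega

lemma trace_ne {v : V} (hv : v ∉ K) : trace G K v ≠ K := by
  obtain ⟨d, hd, hd'⟩ := h.exists_not_mem_trace hv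
  intro he
  exact hd' (by rw [he]; exact hd)

lemma card_trace_lt {v : V} (hv : v ∉ K) : (trace G K v).card < K.card :=
  Finset.card_lt_card ((trace_subset v).ssubset_of_ne (h.trace_ne hv))

/-- Adjacent vertices whose distinct traces meet have traces covering `K`. -/
lemma cover_of_adj {u w c s : V} (a : G.Adj u w)
    (hcu : c ∈ trace G K u) (hcw : c ∈ trace G K w) (hs : s ∈ trace G K u)
    (hsw : s ∉ trace G K w) : trace G K u ∪ trace G K w = K := by
  ext d
  simp only [Finset.mem_union, mem_trace]
  refine ⟨by tauto, fun hd => ?_⟩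
  by_contra hc
  simp only [mem_trace] at *
  have := h.gem c d s u w (h.clique d hd s hs.1 (by grind)) hs.2.symm a (by grind [G.adj_comm])
    (by grind [G.adj_comm]) (by grind [G.adj_comm]) (h.clique _ hcu.1 _ hd (by grind))
    (h.clique _ hcu.1 _ hs.1 (by grind)) hcu.2.symm hcw.2.symm
  exact this

/-- Nonadjacent vertices whose traces meet have nested traces. -/
lemma nested_of_not_adj {u w c : V} (a : ¬ G.Adj u w)
    (hcu : c ∈ trace G K u) (hcw : c ∈ trace G K w) :
    trace G K u ⊆ trace G K w ∨ trace G K w ⊆ trace G K u := by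
  by_contra! hc
  obtain ⟨h1, h2⟩ := hc
  obtain ⟨s, hs, hs'⟩ := Finset.not_subset.1 h1
  obtain ⟨r, hr, hr'⟩ := Finset.not_subset.1 h2
  simp only [mem_trace] at *
  exact h.gem c u s r w hs.2 (h.clique _ hs.1 _ hr.1 (by grind)) hr.2.symm (by grind) a
    (by grind [G.adj_comm]) hcu.2.symm (h.clique _ hcu.1 _ hs.1 (by grind))
    (h.clique _ hcu.1 _ hr.1 (by grind)) hcw.2.symm

lemma not_adj_of_ssubset {u w : V} (hw : w ∉ K)
    (hne : (trace G K u).Nonempty) (hs : trace G K u ⊂ trace G K w) : ¬ G.Adj u w := by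
  intro a
  obtain ⟨c, hc⟩ := hne
  obtain ⟨s, hs1, hs2⟩ := Finset.exists_of_ssubset hs
  have := h.cover_of_adj a.symm (hs.1 hc) hc hs1 hs2
  rw [Finset.union_eq_left.2 hs.1] at this
  exact h.trace_ne hw this

/-- The traces form a cross-free family, and crossing traces belong to adjacent vertices. -/
lemma cross_free (u w : V) :
    Disjoint (trace G K u) (trace G K w) ∨ trace G K u ⊆ trace G K w ∨
      trace G K w ⊆ trace G K u ∨ (trace G K u ∪ trace G K w = K ∧ G.Adj u w) := by
  by_cases hd : Disjoint (trace G K u) (trace G K w)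
  · exact Or.inl hd
  obtain ⟨c, hcu, hcw⟩ := Finset.not_disjoint_iff.1 hd
  by_cases a : G.Adj u w
  · by_cases h1 : trace G K u ⊆ trace G K w
    · exact Or.inr (Or.inl h1)
    obtain ⟨s, hs, hs'⟩ := Finset.not_subset.1 h1
    exact Or.inr (Or.inr (Or.inr ⟨h.cover_of_adj a hcu hcw hs hs', a⟩))
  · have := h.nested_of_not_adj a hcu hcw
    tauto

/-- The traces of an induced `P3` miss at most one vertex of `K`. -/
lemma p3_cover {x y z a b : V} (h1 : G.Adj x y) (h2 : G.Adj y z) (h3 : ¬ G.Adj x z) (hne : x ≠ z)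
    (ha : a ∈ K) (hb : b ∈ K) (hab : a ≠ b)
    (ha' : a ∉ trace G K x ∧ a ∉ trace G K y ∧ a ∉ trace G K z)
    (hb' : b ∉ trace G K x ∧ b ∉ trace G K y ∧ b ∉ trace G K z) : False := by
  simp only [mem_trace] at *
  exact h.p2p3 a b x y z (h.clique a ha b hb hab) h1 h2 hne h3 (by grind [G.adj_comm])
    (by grind [G.adj_comm]) (by grind [G.adj_comm]) (by grind [G.adj_comm]) (by grind [G.adj_comm])
    (by grind [G.adj_comm])

/-- An induced `P3` whose traces lie in `S` forces `S` to miss at most one vertex of `K`. -/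
lemma card_le_of_p3 {x y z : V} {S : Finset V} (hS : S ⊆ K)
    (h1 : G.Adj x y) (h2 : G.Adj y z) (h3 : ¬ G.Adj x z) (hne : x ≠ z)
    (hx : trace G K x ⊆ S) (hy : trace G K y ⊆ S) (hz : trace G K z ⊆ S) :
    K.card ≤ S.card + 1 := by
  by_contra! hc
  have : 1 < (K \ S).card := by
    rw [Finset.card_sdiff_of_subset hS]; omega
  obtain ⟨a, ha, b, hb, hab⟩ := Finset.one_lt_card.1 this
  simp only [Finset.mem_sdiff] at ha hb
  exact h.p3_cover h1 h2 h3 hne ha.1 hb.1 hab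
    ⟨fun q => ha.2 (hx q), fun q => ha.2 (hy q), fun q => ha.2 (hz q)⟩
    ⟨fun q => hb.2 (hx q), fun q => hb.2 (hy q), fun q => hb.2 (hz q)⟩

/-- A vertex anticomplete to an edge has its trace covered by, or covering `K` with, the traces of
the ends of that edge. -/
lemma anticomplete_edge {u q r : V} (hu : u ∉ K) (a : G.Adj q r) (h1 : ¬ G.Adj u q) (h2 : ¬ G.Adj u r) :
    trace G K u ⊆ trace G K q ∪ trace G K r ∨
      K ⊆ trace G K u ∪ (trace G K q ∪ trace G K r) := by
  by_contra! hc
  obtain ⟨c1, c2⟩ := hc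
  obtain ⟨s, hs, hs'⟩ := Finset.not_subset.1 c1
  obtain ⟨d, hd, hd'⟩ := Finset.not_subset.1 c2
  simp only [mem_trace, Finset.mem_union, not_or, not_and] at *
  exact h.p2p3 q r d s u a (h.clique d hd s hs.1 (by grind)) hs.2.symm (by grind)
    (by grind [G.adj_comm]) (by grind [G.adj_comm]) (by grind [G.adj_comm]) (by grind [G.adj_comm])
    (by grind [G.adj_comm]) (by grind [G.adj_comm]) (by grind [G.adj_comm])

/-- Adjacent vertices with crossing traces have no common neighbour anticomplete to `K`. -/
lemma no_common_of_cross {t u w c x : V} (ht : trace G K t = ∅) (a : G.Adj u w)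
    (hcu : c ∈ trace G K u) (hcw : c ∈ trace G K w) (hx : x ∈ trace G K w)
    (hxu : x ∉ trace G K u) (htu : G.Adj t u) (htw : G.Adj t w) : False := by
  have ht' : ∀ y ∈ K, ¬ G.Adj t y := fun y hy q => by
    have : y ∈ trace G K t := mem_trace.2 ⟨hy, q⟩
    simp [ht] at this
  simp only [mem_trace] at *
  exact h.gem w x c u t (h.clique _ hx.1 _ hcu.1 (by grind)) hcu.2.symm htu.symm
    (by grind [G.adj_comm]) (by grind [G.adj_comm]) (by grind [G.adj_comm]) hx.2 hcw.2 a.symm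
    htw.symm

/-- A class of equal nonempty traces that is not maximal is stable; more generally an edge between
two traces lying below a third one splits it. -/
lemma eq_union_of_adj_below {u r w : V} (hw : w ∉ K)
    (hu0 : (trace G K u).Nonempty) (hr0 : (trace G K r).Nonempty)
    (hus : trace G K u ⊂ trace G K w) (hrs : trace G K r ⊂ trace G K w) (a : G.Adj u r) :
    trace G K w = trace G K u ∪ trace G K r ∧ Disjoint (trace G K u) (trace G K r) := by
  have h1 := h.not_adj_of_ssubset hw hu0 hus
  have h2 := h.not_adj_of_ssubset hw hr0 hrs
  have h3 := h.anticomplete_edge hw a (fun q => h1 q.symm) (fun q => h2 q.symm)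
  have h4 : trace G K w = trace G K u ∪ trace G K r := by
    refine subset_antisymm ?_ (Finset.union_subset hus.1 hrs.1)
    rcases h3 with h3 | h3
    · exact h3
    · rw [Finset.union_eq_left.2 (Finset.union_subset hus.1 hrs.1)] at h3
      exact absurd (subset_antisymm (trace_subset w) h3) (h.trace_ne hw)
  refine ⟨h4, ?_⟩
  by_contra hd
  rcases h.cross_free u r with q | q | q | q
  · exact hd q
  · exact hrs.2 (by rw [h4, Finset.union_eq_right.2 q])
  · exact hus.2 (by rw [h4, Finset.union_eq_left.2 q])
  · exact h.trace_ne hw (h4.trans q.1)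

/-- Adjacency to a vertex below a maximal trace propagates upwards. -/
lemma adj_of_adj_below {u w r : V} (hw : w ∉ K)
    (hu0 : (trace G K u).Nonempty) (hus : trace G K u ⊂ trace G K w)
    (hd : Disjoint (trace G K w) (trace G K r)) (hne : trace G K w ∪ trace G K r ≠ K)
    (a : G.Adj u r) : G.Adj w r := by
  by_contra hc
  have h1 := h.not_adj_of_ssubset hw hu0 hus
  rcases h.anticomplete_edge hw a (fun q => h1 q.symm) hc with q | q
  · obtain ⟨x, hx, hx'⟩ := Finset.exists_of_ssubset hus
    rcases Finset.mem_union.1 (q hx) with p | p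
    · exact hx' p
    · exact Finset.disjoint_left.1 hd hx p
  · refine hne (subset_antisymm (Finset.union_subset (trace_subset _) (trace_subset _)) ?_)
    rwa [← Finset.union_assoc, Finset.union_eq_left.2 hus.1] at q

end Setup
end Setup

section Coloring

variable {V : Type*} {G : SimpleGraph V} {K : Finset V}

/-- The vertices of `Q` are pairwise adjacent. -/
abbrev PairwiseAdj (G : SimpleGraph V) (Q : Finset V) : Prop :=
  ∀ x ∈ Q, ∀ y ∈ Q, x ≠ y → G.Adj x y

lemma pairwiseAdj_empty : PairwiseAdj G ∅ := fun x hx => absurd hx (Finset.notMem_empty x)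

lemma pairwiseAdj_singleton (v : V) : PairwiseAdj G {v} := fun _ hx _ hy hxy =>
  absurd ((Finset.mem_singleton.1 hx).trans (Finset.mem_singleton.1 hy).symm) hxy

/-- The subgraph induced by `s` is a disjoint union of cliques. -/
def IsCluster (G : SimpleGraph V) (s : Finset V) : Prop :=
  ∀ x ∈ s, ∀ y ∈ s, ∀ z ∈ s, G.Adj x y → G.Adj y z → x ≠ z → G.Adj x z

/-- The clique number of the subgraph induced by `s`. -/
noncomputable def nu (G : SimpleGraph V) (s : Finset V) : ℕ :=
  (s.powerset.filter (PairwiseAdj G)).sup Finset.card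

lemma card_le_nu {s Q : Finset V} (hQ : Q ⊆ s) (hc : PairwiseAdj G Q) : Q.card ≤ nu G s :=
  Finset.le_sup (f := Finset.card)
    (Finset.mem_filter.2 ⟨Finset.mem_powerset.2 hQ, hc⟩)

lemma exists_card_eq_nu (G : SimpleGraph V) (s : Finset V) :
    ∃ Q ⊆ s, PairwiseAdj G Q ∧ Q.card = nu G s := by
  obtain ⟨Q, hQ, he⟩ := Finset.exists_mem_eq_sup (s.powerset.filter (PairwiseAdj G))
    ⟨∅, Finset.mem_filter.2 ⟨Finset.empty_mem_powerset s, pairwiseAdj_empty⟩⟩ Finset.card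
  rw [Finset.mem_filter, Finset.mem_powerset] at hQ
  exact ⟨Q, hQ.1, hQ.2, he.symm⟩

lemma one_le_nu {s : Finset V} {v : V} (hv : v ∈ s) : 1 ≤ nu G s := by
  have := card_le_nu (G := G) (Q := {v}) (by simpa using hv) (pairwiseAdj_singleton v)
  simpa using this

lemma two_le_nu {s : Finset V} {u v : V} (hu : u ∈ s) (hv : v ∈ s) (a : G.Adj u v) :
    2 ≤ nu G s := by
  have := card_le_nu (G := G) (s := s) (Q := {u, v}) (by grind) (by
    intro x hx y hy hxy
    simp only [Finset.mem_insert, Finset.mem_singleton] at hx hy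
    rcases hx with rfl | rfl <;> rcases hy with rfl | rfl <;> first | exact absurd rfl hxy | exact a | exact a.symm)
  rwa [Finset.card_pair a.ne] at this

lemma nu_le_one {s : Finset V} (hs : ∀ u ∈ s, ∀ v ∈ s, ¬ G.Adj u v) : nu G s ≤ 1 := by
  obtain ⟨Q, hQ, hc, he⟩ := exists_card_eq_nu G s
  rw [← he]
  by_contra! hlt
  obtain ⟨a, ha, b, hb, hab⟩ := Finset.one_lt_card.1 hlt
  exact hs a (hQ ha) b (hQ hb) (hc a ha b hb hab)

/-- A disjoint union of cliques is properly coloured by any large enough palette. -/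
lemma IsCluster.exists_coloring {s : Finset V} (hs : IsCluster G s) {C : Finset V}
    (hC : nu G s ≤ C.card) :
    ∃ f : V → V, (∀ v ∈ s, f v ∈ C) ∧ ∀ u ∈ s, ∀ v ∈ s, G.Adj u v → f u ≠ f v := by
  induction s using Finset.induction_on with
  | empty => exact ⟨id, by simp, by simp⟩
  | insert a s ha ih =>
    obtain ⟨f, hf1, hf2⟩ := ih (fun x hx y hy z hz => hs x (by simp [hx]) y (by simp [hy]) z
        (by simp [hz])) ((Finset.sup_mono (by
          apply Finset.filter_subset_filter
          exact Finset.powerset_mono.2 (Finset.subset_insert _ _))).trans hC)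
    set N := s.filter (G.Adj a)
    have hN : PairwiseAdj G (insert a N) := by
      intro x hx y hy hxy
      simp only [N, Finset.mem_insert, Finset.mem_filter] at hx hy
      rcases hx with hx | hx <;> rcases hy with hy | hy
      · exact absurd (hx.trans hy.symm) hxy
      · exact hx ▸ hy.2
      · exact hy ▸ hx.2.symm
      · exact hs x (by simp [hx.1]) a (by simp) y (by simp [hy.1]) hx.2.symm hy.2 hxy
    have h1 := (card_le_nu (G := G) (s := insert a s)
      (Finset.insert_subset_insert a (Finset.filter_subset _ s)) hN).trans hC
    rw [Finset.card_insert_of_notMem (by simp)] at h1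
    obtain ⟨c, hc, hc'⟩ := Finset.exists_mem_notMem_of_card_lt_card
      (lt_of_le_of_lt (Finset.card_image_le (s := N) (f := f)) h1)
    have hn : ∀ v ∈ s, G.Adj a v → c ≠ f v := fun v hv av e =>
      hc' (Finset.mem_image.2 ⟨v, by simp [N, hv, av], e.symm⟩)
    refine ⟨Function.update f a c, ?_, ?_⟩
    · intro v hv
      rcases eq_or_ne v a with rfl | hva
      · simpa using hc
      · rw [Function.update_of_ne hva]
        exact hf1 v (by simpa [hva] using hv)
    · intro u hu v hv auv
      rcases eq_or_ne u a with hua | hua <;> rcases eq_or_ne v a with hva | hva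
      · exact absurd (hua.trans hva.symm) auv.ne
      · rw [hua, Function.update_self, Function.update_of_ne hva]
        exact hn v (by simpa [hva] using hv) (hua ▸ auv)
      · rw [hva, Function.update_self, Function.update_of_ne hua]
        exact (hn u (by simpa [hua] using hu) (hva ▸ auv.symm)).symm
      · rw [Function.update_of_ne hua, Function.update_of_ne hva]
        exact hf2 u (by simpa [hua] using hu) v (by simpa [hva] using hv) auv

/-- Disjoint palettes of prescribed sizes avoiding pairwise disjoint sets. -/
lemma exists_palettes {ι : Type*} (I : Finset ι) (M : ι → Finset V) (n : ι → ℕ)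
    (hM : ∀ i ∈ I, M i ⊆ K) (hd : ∀ i ∈ I, ∀ j ∈ I, i ≠ j → Disjoint (M i) (M j))
    (hn : ∀ i ∈ I, n i + (M i).card ≤ K.card) (hs : ∑ i ∈ I, n i ≤ K.card) :
    ∃ C : ι → Finset V, (∀ i ∈ I, C i ⊆ K \ M i ∧ (C i).card = n i) ∧
      ∀ i ∈ I, ∀ j ∈ I, i ≠ j → Disjoint (C i) (C j) := by
  let t : (Σ i : I, Fin (n i)) → Finset V := fun p => K \ M p.1
  obtain ⟨f, hf, hft⟩ := (Finset.all_card_le_biUnion_card_iff_exists_injective t).1 (by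
    intro A
    by_cases hA : ∃ i, ∀ p ∈ A, p.1 = i
    · obtain ⟨i, hi⟩ := hA
      rcases A.eq_empty_or_nonempty with rfl | ⟨p, hp⟩
      · simp
      · have h1 : A.card ≤ n i := by
          have : A ⊆ Finset.univ.map ⟨fun j : Fin (n i) => (⟨i, j⟩ : Σ i : I, Fin (n i)),
              fun a b hab => by simpa using hab⟩ := by
            rintro ⟨j, x⟩ hq
            have := hi _ hq
            simp only at this
            subst this
            exact Finset.mem_map.2 ⟨x, Finset.mem_univ _, rfl⟩
          simpa using Finset.card_le_card this
        have h2 : K \ M i ⊆ A.biUnion t := by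
          have := Finset.subset_biUnion_of_mem t hp
          simpa [t, hi p hp] using this
        have h3 := Finset.card_le_card h2
        rw [Finset.card_sdiff_of_subset (hM i i.2)] at h3
        have := hn i i.2
        omega
    · push Not at hA
      rcases A.eq_empty_or_nonempty with rfl | ⟨p, hp⟩
      · simp
      · obtain ⟨q, hq, hqp⟩ := hA p.1
        have h1 : A.card ≤ K.card := by
          refine (Finset.card_le_univ A).trans ?_
          simp only [Fintype.card_sigma, Fintype.card_fin]
          rwa [Finset.sum_coe_sort I n]
        have h2 : K ⊆ A.biUnion t := by
          intro x hx
          have hdd := hd p.1 p.1.2 q.1 q.1.2 (fun e => hqp (Subtype.ext e.symm))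
          rw [Finset.disjoint_left] at hdd
          simp only [Finset.mem_biUnion, t, Finset.mem_sdiff]
          by_cases hxp : x ∈ M p.1
          · exact ⟨q, hq, hx, hdd hxp⟩
          · exact ⟨p, hp, hx, hxp⟩
        exact h1.trans (Finset.card_le_card h2))
  refine ⟨fun i => if hi : i ∈ I then Finset.univ.image (fun j : Fin (n i) => f ⟨⟨i, hi⟩, j⟩)
    else ∅, ?_, ?_⟩
  · intro i hi
    simp only [hi, dif_pos]
    refine ⟨?_, ?_⟩
    · intro x hx
      obtain ⟨j, -, rfl⟩ := Finset.mem_image.1 hx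
      exact hft ⟨⟨i, hi⟩, j⟩
    · rw [Finset.card_image_of_injective _ (fun a b hab => by simpa using hf hab)]
      simp
  · intro i hi j hj hij
    simp only [hi, hj, dif_pos]
    rw [Finset.disjoint_left]
    intro x hx hx'
    obtain ⟨a, -, rfl⟩ := Finset.mem_image.1 hx
    obtain ⟨b, -, hb⟩ := Finset.mem_image.1 hx'
    have := hf hb
    simp only [Sigma.mk.injEq, Subtype.mk.injEq] at this
    exact hij this.1.symm

/-- Extending the identity colouring of `K`, with one more colour for the stable set `E`. -/
lemma colorable_of_coloring (E : V → Prop) (f : V → V) (hE : ∀ u v, E u → E v → ¬ G.Adj u v)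
    (hf : ∀ v, v ∉ K → ¬ E v → f v ∈ K \ trace G K v)
    (hp : ∀ u v, u ∉ K → v ∉ K → ¬ E u → ¬ E v → G.Adj u v → f u ≠ f v) :
    G.Colorable (K.card + 1) := by
  have key : ∀ u v, u ∈ K → v ∉ K → ¬ E v → G.Adj v u → u ≠ f v := by
    intro u v hu hv hEv a e
    have := hf v hv hEv
    rw [Finset.mem_sdiff, mem_trace, ← e] at this
    exact this.2 ⟨hu, a⟩
  let c : V → Option K := fun v => if hv : v ∈ K then some ⟨v, hv⟩ else
    if hE : E v then none else some ⟨f v, (Finset.mem_sdiff.1 (hf v hv hE)).1⟩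
  have hc : ∀ {u v}, G.Adj u v → c u ≠ c v := by
    intro u v a
    by_cases hu : u ∈ K <;> by_cases hv : v ∈ K
    · simp [c, hu, hv, a.ne]
    · by_cases hEv : E v
      · simp [c, hu, hv, hEv]
      · simpa [c, hu, hv, hEv] using key u v hu hv hEv a.symm
    · by_cases hEu : E u
      · simp [c, hu, hv, hEu]
      · simpa [c, hu, hv, hEu] using (key v u hv hu hEu a).symm
    · by_cases hEu : E u <;> by_cases hEv : E v
      · exact absurd a (hE u v hEu hEv)
      · simp [c, hu, hv, hEu, hEv]
      · simp [c, hu, hv, hEu, hEv]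
      · simpa [c, hu, hv, hEu, hEv] using hp u v hu hv hEu hEv a
  have := (SimpleGraph.Coloring.mk c hc).colorable
  simpa using this

/-- The union of two mutually complete cliques is a clique. -/
lemma PairwiseAdj.union {P Q : Finset V} (hP : PairwiseAdj G P) (hQ : PairwiseAdj G Q)
    (hPQ : ∀ x ∈ P, ∀ y ∈ Q, G.Adj x y) : PairwiseAdj G (P ∪ Q) := by
  intro x hx y hy hxy
  rcases Finset.mem_union.1 hx with hx | hx <;> rcases Finset.mem_union.1 hy with hy | hy
  · exact hP x hx y hy hxy
  · exact hPQ x hx y hy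
  · exact (hPQ y hy x hx).symm
  · exact hQ x hx y hy hxy

lemma PairwiseAdj.insert {Q : Finset V} (hQ : PairwiseAdj G Q) {x : V}
    (hx : ∀ y ∈ Q, G.Adj x y) : PairwiseAdj G (insert x Q) := by
  rw [Finset.insert_eq]
  exact PairwiseAdj.union (pairwiseAdj_singleton x) hQ (by simpa using hx)

lemma PairwiseAdj.mono {P Q : Finset V} (hQ : PairwiseAdj G Q) (hP : P ⊆ Q) : PairwiseAdj G P :=
  fun x hx y hy => hQ x (hP hx) y (hP hy)

/-- Mutually complete disjoint cliques have total size at most `K.card`. -/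
lemma sum_card_le {ι : Type*} (hmax : ∀ Q : Finset V, PairwiseAdj G Q → Q.card ≤ K.card)
    (I : Finset ι) (Q : ι → Finset V) (hQ : ∀ i ∈ I, PairwiseAdj G (Q i))
    (hc : ∀ i ∈ I, ∀ j ∈ I, i ≠ j → ∀ x ∈ Q i, ∀ y ∈ Q j, G.Adj x y) :
    ∑ i ∈ I, (Q i).card ≤ K.card := by
  rw [← Finset.card_biUnion]
  · apply hmax
    intro x hx y hy hxy
    obtain ⟨i, hi, hxi⟩ := Finset.mem_biUnion.1 hx
    obtain ⟨j, hj, hyj⟩ := Finset.mem_biUnion.1 hy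
    rcases eq_or_ne i j with rfl | hij
    · exact hQ i hi x hxi y hyj hxy
    · exact hc i hi j hj hij x hxi y hyj
  · intro i hi j hj hij
    refine Finset.disjoint_left.2 ?_
    intro x hx hx'
    exact (hc i hi j hj hij x hx x hx').ne rfl

end Coloring

section Apart

variable {V : Type*} {G : SimpleGraph V} {K : Finset V}

/-- Disjoint sets that do not cover `K`. -/
def Apart (K S R : Finset V) : Prop := Disjoint S R ∧ S ∪ R ≠ K

lemma Apart.symm {S R : Finset V} (a : Apart K S R) : Apart K R S :=
  ⟨a.1.symm, by rw [Finset.union_comm]; exact a.2⟩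

lemma Apart.mono {S R S' R' : Finset V} (a : Apart K S' R') (hS : S ⊆ S') (hR : R ⊆ R')
    (hS' : S' ⊆ K) (hR' : R' ⊆ K) : Apart K S R :=
  ⟨a.1.mono hS hR, fun e => a.2 (subset_antisymm (Finset.union_subset hS' hR')
    (e ▸ Finset.union_subset_union hS hR))⟩

namespace Setup

variable (h : Setup G K)
include h

lemma card_pos : 0 < K.card := by have := h.four; omega

lemma isCluster_of_card_le {A W : Finset V} (hW : W ⊆ K) (hc : W.card + 2 ≤ K.card)
    (hA : ∀ v ∈ A, trace G K v ⊆ W) : IsCluster G A := by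
  intro x hx y hy z hz a b hne
  by_contra c
  have := h.card_le_of_p3 hW a b c hne (hA x hx) (hA y hy) (hA z hz)
  omega

/-- A vertex is adjacent to an end of every edge of a class apart from its trace. -/
lemma adj_or_adj {u q r : V} {R : Finset V} (hu : u ∉ K) (hne : (trace G K u).Nonempty)
    (hq : trace G K q ⊆ R) (hr : trace G K r ⊆ R) (ha : Apart K (trace G K u) R)
    (hR : R ⊆ K) (a : G.Adj q r) : G.Adj u q ∨ G.Adj u r := by
  by_contra! hc
  have hs := Finset.union_subset hq hr
  rcases h.anticomplete_edge hu a hc.1 hc.2 with p | p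
  · obtain ⟨x, hx⟩ := hne
    exact Finset.disjoint_left.1 ha.1 hx (hs (p hx))
  · exact ha.2 (subset_antisymm (Finset.union_subset (trace_subset u) hR)
      (p.trans (Finset.union_subset_union_right hs)))

/-- Completing a cycle of length four between two cliques, one of which has a private neighbour. -/
lemma adj_of_three {s p p' q q' : V} (hp : G.Adj s p) (hp' : G.Adj s p') (hq : ¬ G.Adj s q)
    (hq' : ¬ G.Adj s q') (a : G.Adj p p') (b : G.Adj q q') (h1 : G.Adj p q) (h2 : G.Adj p q')
    (h3 : G.Adj p' q) : G.Adj p' q' := by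
  by_contra hc
  exact h.gem p s p' q q' hp' h3 b hq hq' hc hp.symm a h1 h2

end Setup
end Apart

section Classes

variable {V : Type*} [Fintype V] {G : SimpleGraph V} {K : Finset V}

/-- The vertices outside `K` with trace `M`. -/
noncomputable def cl (G : SimpleGraph V) (K M : Finset V) : Finset V :=
  {v | v ∉ K ∧ trace G K v = M}

@[simp, grind =] lemma mem_cl {M : Finset V} {v : V} :
    v ∈ cl G K M ↔ v ∉ K ∧ trace G K v = M := by simp [cl]

/-- `M` is a nonempty inclusionwise maximal trace. -/
structure IsTop (G : SimpleGraph V) (K M : Finset V) : Prop where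
  nonempty : M.Nonempty
  inhabited : (cl G K M).Nonempty
  maximal : ∀ w ∉ K, M ⊆ trace G K w → trace G K w = M

/-- An edge between two vertices whose nonempty traces lie strictly below `M`. -/
def Split (G : SimpleGraph V) (K M : Finset V) : Prop :=
  ∃ u ∉ K, ∃ r ∉ K, (trace G K u).Nonempty ∧ (trace G K r).Nonempty ∧
    trace G K u ⊂ M ∧ trace G K r ⊂ M ∧ G.Adj u r

lemma IsTop.subset {M : Finset V} (hM : IsTop G K M) : M ⊆ K := by
  obtain ⟨w, hw⟩ := hM.inhabited
  rw [mem_cl] at hw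
  rw [← hw.2]
  exact trace_subset w

lemma exists_isTop {v : V} (hv : v ∉ K) (hne : (trace G K v).Nonempty) :
    ∃ M, IsTop G K M ∧ trace G K v ⊆ M := by
  obtain ⟨w, hw, hmax⟩ := Finset.exists_max_image
    (Finset.univ.filter fun w => w ∉ K ∧ trace G K v ⊆ trace G K w)
    (fun w => (trace G K w).card) ⟨v, by simp [hv]⟩
  simp only [Finset.mem_filter, Finset.mem_univ, true_and] at hw hmax
  refine ⟨trace G K w, ⟨hne.mono hw.2, ⟨w, by simp [hw.1]⟩, fun x hx hwx => ?_⟩, hw.2⟩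
  exact (Finset.eq_of_subset_of_card_le hwx (hmax x ⟨hx, hw.2.trans hwx⟩)).symm

namespace Setup

variable (h : Setup G K)
include h

lemma nu_add_card_le {M : Finset V} (hM : M ⊆ K) : nu G (cl G K M) + M.card ≤ K.card := by
  obtain ⟨Q, hQ, hc, he⟩ := exists_card_eq_nu G (cl G K M)
  rw [← he, ← Finset.card_union_of_disjoint]
  · refine h.max _ (hc.union (PairwiseAdj.mono h.clique hM) fun x hx y hy => ?_)
    have := mem_cl.1 (hQ hx)
    rw [← this.2] at hy
    exact (mem_trace.1 hy).2
  · exact Finset.disjoint_left.2 fun x hx hx' => (mem_cl.1 (hQ hx)).1 (hM hx')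

lemma isCluster_cl (M : Finset V) : IsCluster G (cl G K M) := by
  intro x hx y hy z hz a b hne
  have hM : M ⊆ K := by
    rw [← (mem_cl.1 hx).2]
    exact trace_subset x
  have h1 := h.nu_add_card_le hM
  have h2 := two_le_nu hx hy a
  exact h.isCluster_of_card_le hM (by omega) (fun v hv => (mem_cl.1 hv).2.le) x hx y hy z hz a b hne

lemma complete_of_three_le {S R P Q : Finset V} (hS : S.Nonempty) (hR : R.Nonempty)
    (ha : Apart K S R) (hP : P ⊆ cl G K S) (hQ : Q ⊆ cl G K R) (cP : PairwiseAdj G P)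
    (cQ : PairwiseAdj G Q) (kP : 3 ≤ P.card) (kQ : 2 ≤ Q.card) :
    ∀ p ∈ P, ∀ q ∈ Q, G.Adj p q := by
  intro p hp q hq
  by_contra hc
  have key1 : ∀ p ∈ P, ∀ x ∈ Q, ∀ y ∈ Q, x ≠ y → G.Adj p x ∨ G.Adj p y := by
    intro p hp x hx y hy hxy
    have e := mem_cl.1 (hP hp)
    have ex := mem_cl.1 (hQ hx)
    have ey := mem_cl.1 (hQ hy)
    exact h.adj_or_adj e.1 (e.2 ▸ hS) ex.2.le ey.2.le (e.2 ▸ ha) (ex.2 ▸ trace_subset x)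
      (cQ x hx y hy hxy)
  have key2 : ∀ p ∈ Q, ∀ x ∈ P, ∀ y ∈ P, x ≠ y → G.Adj p x ∨ G.Adj p y := by
    intro p hp x hx y hy hxy
    have e := mem_cl.1 (hQ hp)
    have ex := mem_cl.1 (hP hx)
    have ey := mem_cl.1 (hP hy)
    exact h.adj_or_adj e.1 (e.2 ▸ hR) ex.2.le ey.2.le (e.2 ▸ ha.symm) (ex.2 ▸ trace_subset x)
      (cP x hx y hy hxy)
  obtain ⟨q', hq', hqq⟩ := Finset.exists_mem_ne (show 1 < Q.card by omega) q
  obtain ⟨x, hx, y, hy, hxy⟩ := Finset.one_lt_card.1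
    (show 1 < (P.erase p).card by rw [Finset.card_erase_of_mem hp]; omega)
  rw [Finset.mem_erase] at hx hy
  obtain ⟨p', hp', hpp, a⟩ : ∃ p' ∈ P, p' ≠ p ∧ G.Adj p' q' := by
    rcases key2 q' hq' x hx.2 y hy.2 hxy with a | a
    · exact ⟨x, hx.2, hx.1, a.symm⟩
    · exact ⟨y, hy.2, hy.1, a.symm⟩
  have b : G.Adj p q' := (key1 p hp q hq q' hq' hqq.symm).resolve_left hc
  have c : G.Adj p' q :=
    ((key2 q hq p hp p' hp' hpp.symm).resolve_left (fun a => hc a.symm)).symm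
  obtain ⟨s, hs⟩ := hS
  have hs' : ∀ p ∈ P, G.Adj s p := fun p hp => by
    have e := mem_cl.1 (hP hp)
    rw [← e.2] at hs
    exact (mem_trace.1 hs).2.symm
  have hsR : ∀ q ∈ Q, ¬ G.Adj s q := fun q hq b => by
    have e := mem_cl.1 (hQ hq)
    have e' := mem_cl.1 (hP hp)
    refine Finset.disjoint_left.1 ha.1 hs ?_
    rw [← e.2]
    rw [← e'.2] at hs
    exact mem_trace.2 ⟨(mem_trace.1 hs).1, b.symm⟩
  exact hc (h.adj_of_three (hs' _ hp') (hs' _ hp) (hsR _ hq') (hsR _ hq) (cP _ hp' _ hp hpp)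
    (cQ _ hq' _ hq hqq) a c b)

/-- Apart classes with small union: an edge of the first makes the second a clique
complete to it. -/
lemma complete_of_small {S R Q : Finset V} (hR : R.Nonempty) (hSK : S ⊆ K) (hRK : R ⊆ K)
    (ha : Apart K S R) (hc : (S ∪ R).card + 2 ≤ K.card) (hQ : Q ⊆ cl G K S)
    (cQ : PairwiseAdj G Q) (kQ : 2 ≤ Q.card) :
    (∀ v ∈ cl G K R, ∀ q ∈ Q, G.Adj v q) ∧ PairwiseAdj G (cl G K R) := by
  have hcl : IsCluster G (cl G K S ∪ cl G K R) := by
    refine h.isCluster_of_card_le (Finset.union_subset hSK hRK) hc fun v hv => ?_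
    rcases Finset.mem_union.1 hv with hv | hv
    · exact (mem_cl.1 hv).2 ▸ Finset.subset_union_left
    · exact (mem_cl.1 hv).2 ▸ Finset.subset_union_right
  have h1 : ∀ v ∈ cl G K R, ∀ q ∈ Q, G.Adj v q := by
    intro v hv q hq
    obtain ⟨q', hq', hqq⟩ := Finset.exists_mem_ne (show 1 < Q.card by omega) q
    have e := mem_cl.1 hv
    rcases h.adj_or_adj e.1 (e.2 ▸ hR) (mem_cl.1 (hQ hq)).2.le (mem_cl.1 (hQ hq')).2.le
      (e.2 ▸ ha.symm) hSK (cQ q hq q' hq' hqq.symm) with a | a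
    · exact a
    · exact hcl v (by simp [e]) q' (Finset.mem_union_left _ (hQ hq')) q
        (Finset.mem_union_left _ (hQ hq)) a (cQ _ hq' _ hq hqq)
        (fun e' => by
          have := mem_cl.1 (hQ hq)
          obtain ⟨x, hx⟩ := hR
          refine Finset.disjoint_left.1 ha.1 ?_ hx
          rw [← this.2, ← e', e.2]
          exact hx)
  refine ⟨h1, fun x hx y hy hxy => ?_⟩
  obtain ⟨q, hq⟩ := Finset.card_pos.1 (show 0 < Q.card by omega)
  exact hcl x (Finset.mem_union_right _ hx) q (Finset.mem_union_left _ (hQ hq)) y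
    (Finset.mem_union_right _ hy) (h1 x hx q hq) (h1 y hy q hq).symm hxy

/-- A split maximal trace and any trace apart from it miss at most one vertex of `K`. -/
lemma card_le_of_split {M N : Finset V} (hM : IsTop G K M) (hN : N.Nonempty)
    (hN' : (cl G K N).Nonempty) (ha : Apart K M N) (hs : Split G K M) :
    K.card ≤ (M ∪ N).card + 1 := by
  obtain ⟨w, hw⟩ := hM.inhabited
  obtain ⟨v, hv⟩ := hN'
  rw [mem_cl] at hw hv
  have key : ∀ u, (trace G K u).Nonempty → trace G K u ⊂ M → G.Adj v u →
      K.card ≤ (M ∪ N).card + 1 := by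
    intro u hu hus a
    have b : G.Adj w v := h.adj_of_adj_below hw.1 hu (hw.2 ▸ hus) (by rw [hw.2, hv.2]; exact ha.1)
      (by rw [hw.2, hv.2]; exact ha.2) a.symm
    have c : ¬ G.Adj u w := h.not_adj_of_ssubset hw.1 hu (hw.2 ▸ hus)
    refine h.card_le_of_p3 (Finset.union_subset hM.subset (hv.2 ▸ trace_subset v)) a.symm b.symm c
      ?_ (hus.1.trans Finset.subset_union_left) (hv.2 ▸ Finset.subset_union_right)
      (hw.2 ▸ Finset.subset_union_left)
    rintro rfl
    exact hus.2 hw.2.ge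
  obtain ⟨u, hu, r, hr, hu0, hr0, hus, hrs, a⟩ := hs
  rcases h.adj_or_adj (R := M) hv.1 (hv.2 ▸ hN) hus.1 hrs.1 (hv.2 ▸ ha.symm) hM.subset a with b | b
  · exact key u hu0 hus b
  · exact key r hr0 hrs b

/-- Colouring `G` by palettes assigned to groups of maximal traces. -/
lemma colorable_of_groups
    (h0 : ∀ u ∉ K, ∀ v ∉ K, trace G K u = ∅ → trace G K v = ∅ → ¬ G.Adj u v)
    (hap : ∀ M N, IsTop G K M → IsTop G K N → M ≠ N → Apart K M N)
    {ι : Type*} (I : Finset ι) (W : ι → Finset V) (n : ι → ℕ) (g : Finset V → ι)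
    (hgI : ∀ M, IsTop G K M → g M ∈ I) (hgW : ∀ M, IsTop G K M → M ⊆ W (g M))
    (hW : ∀ i ∈ I, W i ⊆ K) (hd : ∀ i ∈ I, ∀ j ∈ I, i ≠ j → Disjoint (W i) (W j))
    (hn : ∀ i ∈ I, n i + (W i).card ≤ K.card) (hs : ∑ i ∈ I, n i ≤ K.card)
    (hnu : ∀ M, IsTop G K M → nu G (cl G K M) ≤ n (g M))
    (hsp : ∀ M, IsTop G K M → Split G K M → 2 ≤ n (g M))
    (han : ∀ M N, IsTop G K M → IsTop G K N → M ≠ N → g M = g N →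
      ∀ u ∈ cl G K M, ∀ v ∈ cl G K N, ¬ G.Adj u v) : G.Colorable (K.card + 1) := by
  obtain ⟨C, hC1, hC2⟩ := exists_palettes I W n hW hd hn hs
  have hf : ∀ M, ∃ f : V → V, IsTop G K M → (∀ v ∈ cl G K M, f v ∈ C (g M)) ∧
      ∀ u ∈ cl G K M, ∀ v ∈ cl G K M, G.Adj u v → f u ≠ f v := by
    intro M
    by_cases hM : IsTop G K M
    · obtain ⟨f, hf⟩ := (h.isCluster_cl M).exists_coloring (C := C (g M))
        (by rw [(hC1 _ (hgI M hM)).2]; exact hnu M hM)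
      exact ⟨f, fun _ => hf⟩
    · exact ⟨id, fun q => absurd q hM⟩
  choose f hf using hf
  have hab : ∀ M, ∃ s a b : V, IsTop G K M → s ∈ M ∧ a ∈ C (g M) ∧ b ∈ C (g M) ∧
      (Split G K M → a ≠ b) := by
    intro M
    by_cases hM : IsTop G K M
    · obtain ⟨s, hs⟩ := hM.nonempty
      obtain ⟨w, hw⟩ := hM.inhabited
      have hc := (hC1 _ (hgI M hM)).2
      by_cases q : Split G K M
      · obtain ⟨a, ha, b, hb, hne⟩ := Finset.one_lt_card.1
          (show 1 < (C (g M)).card by rw [hc]; exact hsp M hM q)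
        exact ⟨s, a, b, fun _ => ⟨hs, ha, hb, fun _ => hne⟩⟩
      · obtain ⟨a, ha⟩ := Finset.card_pos.1
          (show 0 < (C (g M)).card by rw [hc]; exact (one_le_nu hw).trans (hnu M hM))
        exact ⟨s, a, a, fun _ => ⟨hs, ha, ha, fun q' => absurd q' q⟩⟩
    · obtain ⟨s, -⟩ := Finset.card_pos.1 h.card_pos
      exact ⟨s, s, s, fun q => absurd q hM⟩
  choose s a b hab using hab
  have htop : ∀ v, ∃ M, v ∉ K → trace G K v ≠ ∅ → IsTop G K M ∧ trace G K v ⊆ M := by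
    intro v
    by_cases q : v ∉ K ∧ trace G K v ≠ ∅
    · obtain ⟨M, hM⟩ := exists_isTop q.1 (Finset.nonempty_iff_ne_empty.2 q.2)
      exact ⟨M, fun _ _ => hM⟩
    · exact ⟨∅, fun q1 q2 => absurd ⟨q1, q2⟩ q⟩
  choose top htop using htop
  let F : V → V := fun v => if trace G K v = top v then f (top v) v else
    if s (top v) ∈ trace G K v then a (top v) else b (top v)
  have hF : ∀ v, v ∉ K → trace G K v ≠ ∅ → F v ∈ C (g (top v)) := by
    intro v hv hne
    obtain ⟨hM, hs⟩ := htop v hv hne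
    simp only [F]
    split_ifs with q1 q2
    · exact (hf _ hM).1 v (mem_cl.2 ⟨hv, q1⟩)
    · exact (hab _ hM).2.1
    · exact (hab _ hM).2.2.1
  refine colorable_of_coloring (fun v => v ∉ K ∧ trace G K v = ∅) F ?_ ?_ ?_
  · intro u v hu hv
    exact h0 u hu.1 v hv.1 hu.2 hv.2
  · intro v hv hE
    have hne : trace G K v ≠ ∅ := fun q => hE ⟨hv, q⟩
    obtain ⟨hM, hs⟩ := htop v hv hne
    have h1 := (hC1 _ (hgI _ hM)).1 (hF v hv hne)
    rw [Finset.mem_sdiff] at h1 ⊢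
    exact ⟨h1.1, fun q => h1.2 (hgW _ hM (hs q))⟩
  · intro u v hu hv hEu hEv adj
    have hu0 : trace G K u ≠ ∅ := fun q => hEu ⟨hu, q⟩
    have hv0 : trace G K v ≠ ∅ := fun q => hEv ⟨hv, q⟩
    have hu1 := Finset.nonempty_iff_ne_empty.2 hu0
    have hv1 := Finset.nonempty_iff_ne_empty.2 hv0
    obtain ⟨hM, hsM⟩ := htop u hu hu0
    obtain ⟨hN, hsN⟩ := htop v hv hv0
    rcases eq_or_ne (top u) (top v) with e | e
    · by_cases q1 : trace G K u = top u <;> by_cases q2 : trace G K v = top v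
      · simp only [F, q1, q2, if_true]
        rw [← e]
        exact (hf _ hM).2 u (mem_cl.2 ⟨hu, q1⟩) v (mem_cl.2 ⟨hv, q2.trans e.symm⟩) adj
      · exact absurd adj.symm (h.not_adj_of_ssubset hu hv1
          (by rw [q1, e]; exact hsN.ssubset_of_ne q2))
      · exact absurd adj (h.not_adj_of_ssubset hv hu1
          (by rw [q2, ← e]; exact hsM.ssubset_of_ne q1))
      · have c1 := hsM.ssubset_of_ne q1
        have c2 := hsN.ssubset_of_ne q2
        rw [← e] at c2
        obtain ⟨w, hw⟩ := hM.inhabited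
        rw [mem_cl] at hw
        have h1 := h.eq_union_of_adj_below hw.1 hu1 hv1 (hw.2 ▸ c1) (hw.2 ▸ c2) adj
        have h2 := hab _ hM
        have h3 := h2.2.2.2 ⟨u, hu, v, hv, hu1, hv1, c1, c2, adj⟩
        have h4 := (Finset.ext_iff.1 (hw.2.symm.trans h1.1) (s (top u))).1 h2.1
        rw [Finset.mem_union] at h4
        rw [← e] at q2
        simp only [F, q1, if_false, ← e, q2]
        rw [Finset.disjoint_left] at h1
        rcases h4 with h4 | h4
        · rw [if_pos h4, if_neg (h1.2 h4)]
          exact h3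
        · rw [if_pos h4, if_neg (fun q => h1.2 q h4)]
          exact h3.symm
    · rcases eq_or_ne (g (top u)) (g (top v)) with eg | eg
      · exfalso
        have ap := hap _ _ hM hN e
        have up : ∀ {u v M}, IsTop G K M → u ∉ K → (trace G K u).Nonempty → trace G K u ⊆ M →
            Apart K M (trace G K v) → G.Adj u v → ∃ w ∈ cl G K M, G.Adj w v := by
          intro u v M hM hu hu0 hus ha adj
          rcases eq_or_ne (trace G K u) M with q | q
          · exact ⟨u, mem_cl.2 ⟨hu, q⟩, adj⟩
          · obtain ⟨w, hw⟩ := hM.inhabited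
            have hw' := mem_cl.1 hw
            exact ⟨w, hw, h.adj_of_adj_below hw'.1 hu0 (hw'.2 ▸ hus.ssubset_of_ne q)
              (hw'.2 ▸ ha.1) (hw'.2 ▸ ha.2) adj⟩
        obtain ⟨w, hw, aw⟩ := up hM hu hu1 hsM (ap.mono subset_rfl hsN hM.subset hN.subset) adj
        obtain ⟨x, hx, ax⟩ := up hN hv hv1 hsN
          (ap.symm.mono subset_rfl (mem_cl.1 hw).2.le hN.subset hM.subset) aw.symm
        exact han _ _ hM hN e eg w hw x hx ax.symm
      · intro q
        exact Finset.disjoint_left.1 (hC2 _ (hgI _ hM) _ (hgI _ hN) eg) (hF u hu hu0)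
          (q ▸ hF v hv hv0)

end Setup
end Classes

section Adjacency

variable {V : Type*} [Fintype V] {G : SimpleGraph V} {K : Finset V}

/-- The inclusionwise maximal nonempty traces. -/
noncomputable def tops (G : SimpleGraph V) (K : Finset V) : Finset (Finset V) :=
  K.powerset.filter (IsTop G K)

@[simp] lemma mem_tops {M : Finset V} : M ∈ tops G K ↔ IsTop G K M := by
  simp only [tops, Finset.mem_filter, Finset.mem_powerset, and_iff_right_iff_imp]
  exact IsTop.subset

/-- The number of colours needed by the vertices with trace contained in `M`. -/
noncomputable def nuSplit (G : SimpleGraph V) (K M : Finset V) : ℕ :=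
  if Split G K M then max 2 (nu G (cl G K M)) else nu G (cl G K M)

lemma nuSplit_of_not {M : Finset V} (hM : ¬ Split G K M) :
    nuSplit G K M = nu G (cl G K M) := if_neg hM

lemma nu_le_nuSplit (M : Finset V) : nu G (cl G K M) ≤ nuSplit G K M := by
  unfold nuSplit
  split_ifs <;> omega

omit [Fintype V] in
lemma two_le_card_of_split {M : Finset V} (hM : Split G K M) : 2 ≤ M.card := by
  obtain ⟨u, -, -, -, hu, -, hs, -⟩ := hM
  have := Finset.card_lt_card hs
  have := Finset.card_pos.2 hu
  omega

lemma not_adj_of_mem_cl {S : Finset V} {s v : V} (hv : v ∈ cl G K S) (hsK : s ∈ K) (hs : s ∉ S) :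
    ¬ G.Adj s v := fun a => hs ((mem_cl.1 hv).2 ▸ mem_trace.2 ⟨hsK, a.symm⟩)

lemma adj_of_mem_cl {S : Finset V} {s v : V} (hv : v ∈ cl G K S) (hs : s ∈ S) : G.Adj s v := by
  rw [← (mem_cl.1 hv).2] at hs
  exact (mem_trace.1 hs).2.symm

omit [Fintype V] in
lemma Apart.card_add_lt {A B : Finset V} (h : Apart K A B) (hA : A ⊆ K) (hB : B ⊆ K) :
    A.card + B.card < K.card := by
  rw [← Finset.card_union_of_disjoint h.1]
  exact Finset.card_lt_card ((Finset.union_subset hA hB).ssubset_of_ne h.2)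

namespace Setup

variable (h : Setup G K)
include h

omit [Fintype V] in
lemma of_card {K' : Finset V} (hK' : PairwiseAdj G K') (hc : K.card = K'.card) : Setup G K' where
  p2p3 := h.p2p3
  gem := h.gem
  clique := hK'
  max Q hQ := hc ▸ h.max Q hQ
  four := hc ▸ h.four

lemma complete_of_union_card_le {u : V} {R Q : Finset V} (hu : u ∉ K)
    (hne : (trace G K u).Nonempty) (hR : R ⊆ K) (ha : Apart K (trace G K u) R)
    (hc : (trace G K u ∪ R).card + 2 ≤ K.card) (hQ : Q ⊆ cl G K R) (cQ : PairwiseAdj G Q)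
    (kQ : 2 ≤ Q.card) : ∀ q ∈ Q, G.Adj u q := by
  intro q hq
  obtain ⟨q', hq', hqq⟩ := Finset.exists_mem_ne (show 1 < Q.card by omega) q
  have e := mem_cl.1 (hQ hq)
  have e' := mem_cl.1 (hQ hq')
  rcases h.adj_or_adj hu hne e.2.le e'.2.le ha hR (cQ _ hq _ hq' hqq.symm) with a | a
  · exact a
  · have hcl : IsCluster G {u, q', q} := by
      refine h.isCluster_of_card_le (Finset.union_subset (trace_subset u) hR) hc fun v hv => ?_
      simp only [Finset.mem_insert, Finset.mem_singleton] at hv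
      rcases hv with rfl | rfl | rfl
      · exact Finset.subset_union_left
      · exact e'.2 ▸ Finset.subset_union_right
      · exact e.2 ▸ Finset.subset_union_right
    refine hcl u (by simp) q' (by simp) q (by simp) a (cQ _ hq' _ hq hqq) ?_
    rintro rfl
    obtain ⟨x, hx⟩ := hne
    exact Finset.disjoint_left.1 ha.1 hx (e.2 ▸ hx)

/-- A vertex with trace strictly below `A` is complete to large cliques of a class apart
from `A`. -/
lemma complete_below {u : V} {A B Q : Finset V} (hu : u ∉ K) (hne : (trace G K u).Nonempty)
    (hs : trace G K u ⊂ A) (hA : A ⊆ K) (hB : B ⊆ K) (ha : Apart K A B) (hQ : Q ⊆ cl G K B)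
    (cQ : PairwiseAdj G Q) (kQ : 2 ≤ Q.card) : ∀ q ∈ Q, G.Adj u q := by
  refine h.complete_of_union_card_le hu hne hB (ha.mono hs.1 subset_rfl hA hB) ?_ hQ cQ kQ
  have h1 := Finset.card_lt_card hs
  have h2 := Finset.card_union_le (trace G K u) B
  have h3 := ha.card_add_lt hA hB
  omega

/-- If `d` is complete to a large clique `Y` of a class and adjacent to `x` in a class apart from
it, then `x` is complete to `Y`. -/
lemma complete_via {A B Y : Finset V} {x d : V} (hA0 : A.Nonempty) (hB0 : B.Nonempty)
    (hB : B ⊆ K) (ha : Apart K A B) (hx : x ∈ cl G K A) (hY : Y ⊆ cl G K B)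
    (cY : PairwiseAdj G Y) (kY : 2 ≤ Y.card) (hdx : G.Adj d x) (hdY : ∀ y ∈ Y, G.Adj d y)
    (hd : Disjoint (trace G K d) B) : ∀ y ∈ Y, G.Adj x y := by
  have key : ∀ y ∈ Y, ∀ y' ∈ Y, y ≠ y' → G.Adj x y' → G.Adj x y := by
    intro y hy y' hy' hne a
    by_contra c
    obtain ⟨s, hs⟩ := hB0
    refine h.gem y' s y d x (adj_of_mem_cl (hY hy) hs) (hdY y hy).symm hdx ?_
      (not_adj_of_mem_cl hx (hB hs) (Finset.disjoint_right.1 ha.1 hs)) (fun q => c q.symm)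
      (adj_of_mem_cl (hY hy') hs).symm (cY _ hy' _ hy hne.symm) (hdY y' hy').symm a.symm
    exact fun q => Finset.disjoint_right.1 hd hs (mem_trace.2 ⟨hB hs, q.symm⟩)
  intro y hy
  obtain ⟨y', hy', hyy⟩ := Finset.exists_mem_ne (show 1 < Y.card by omega) y
  have e := mem_cl.1 hx
  rcases h.adj_or_adj e.1 (e.2 ▸ hA0) (mem_cl.1 (hY hy)).2.le (mem_cl.1 (hY hy')).2.le (e.2 ▸ ha)
    hB (cY _ hy _ hy' hyy.symm) with a | a
  · exact a
  · exact key y hy y' hy' hyy.symm a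

end Setup
end Adjacency

section Palettes

variable {V : Type*} [Fintype V] {G : SimpleGraph V} {K : Finset V}

/-- A maximum clique whose maximal traces are pairwise apart, in a graph where no maximum clique
has complementary nonempty traces. -/
structure ApartSetup (G : SimpleGraph V) (K : Finset V) : Prop extends Setup G K where
  stable : ∀ u ∉ K, ∀ v ∉ K, trace G K u = ∅ → trace G K v = ∅ → ¬ G.Adj u v
  apart : ∀ M N, IsTop G K M → IsTop G K N → M ≠ N → Apart K M N
  not_compl : ∀ K', Setup G K' → ∀ x ∉ K', ∀ y ∉ K', (∃ z ∈ K', G.Adj x z) →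
    (∃ z ∈ K', G.Adj y z) → (∀ z ∈ K', G.Adj x z ↔ ¬ G.Adj y z) → False

namespace ApartSetup

variable (h : ApartSetup G K)
include h

lemma nuSplit_add_card_le {M N : Finset V} (hM : IsTop G K M) (hN : IsTop G K N) (hne : M ≠ N) :
    nuSplit G K M + M.card ≤ K.card := by
  have h1 := h.nu_add_card_le hM.subset
  have h2 := (h.apart M N hM hN hne).card_add_lt hM.subset hN.subset
  have h3 := Finset.card_pos.2 hN.nonempty
  unfold nuSplit
  split_ifs <;> omega

lemma colorable_of_sum {A B : Finset V} (hA : IsTop G K A) (hB : IsTop G K B) (hne : A ≠ B)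
    (hs : ∑ M ∈ tops G K, nuSplit G K M ≤ K.card) : G.Colorable (K.card + 1) := by
  refine h.colorable_of_groups h.stable h.apart (tops G K) id (nuSplit G K) id
    (fun M hM => mem_tops.2 hM) (fun M _ => subset_rfl) (fun M hM => (mem_tops.1 hM).subset)
    (fun M hM N hN q => (h.apart M N (mem_tops.1 hM) (mem_tops.1 hN) q).1) (fun M hM => ?_) hs
    (fun M _ => nu_le_nuSplit M) (fun M _ hsM => ?_) (fun M N _ _ q q' => absurd q' q)
  · rcases eq_or_ne M A with rfl | q
    · exact h.nuSplit_add_card_le hA hB hne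
    · exact h.nuSplit_add_card_le (mem_tops.1 hM) hA q
  · simp only [nuSplit, id, if_pos hsM]
    omega

lemma colorable_of_pair {A B : Finset V} (hA : IsTop G K A) (hB : IsTop G K B) (hne : A ≠ B)
    (hT : ∀ M, IsTop G K M → M = A ∨ M = B) (hs : nuSplit G K A + nuSplit G K B ≤ K.card) :
    G.Colorable (K.card + 1) := by
  refine h.colorable_of_sum hA hB hne ?_
  have : tops G K ⊆ {A, B} := fun M hM => by simpa using hT M (mem_tops.1 hM)
  refine (Finset.sum_le_sum_of_subset this).trans ?_
  rwa [Finset.sum_pair hne]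

lemma colorable_of_triple {A B D : Finset V} (hA : IsTop G K A) (hB : IsTop G K B) (hAB : A ≠ B)
    (hAD : A ≠ D) (hBD : B ≠ D) (hT : ∀ M, IsTop G K M → M = A ∨ M = B ∨ M = D)
    (hs : nuSplit G K A + nuSplit G K B + nuSplit G K D ≤ K.card) :
    G.Colorable (K.card + 1) := by
  refine h.colorable_of_sum hA hB hAB ?_
  have : tops G K ⊆ {A, B, D} := fun M hM => by simpa using hT M (mem_tops.1 hM)
  refine (Finset.sum_le_sum_of_subset this).trans ?_
  rw [Finset.sum_insert (by simp [hAB, hAD]), Finset.sum_pair hBD]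
  omega

end ApartSetup
end Palettes

section TwoTops

variable {V : Type*} [Fintype V] {G : SimpleGraph V} {K : Finset V}

omit [Fintype V] in
lemma Setup.card_add_card_le (h : Setup G K) {P Q : Finset V} (cP : PairwiseAdj G P)
    (cQ : PairwiseAdj G Q) (hPQ : ∀ x ∈ P, ∀ y ∈ Q, G.Adj x y) : P.card + Q.card ≤ K.card := by
  rw [← Finset.card_union_of_disjoint]
  · exact h.max _ (cP.union cQ hPQ)
  · exact Finset.disjoint_left.2 fun x hx hx' => (hPQ x hx x hx').ne rfl

omit [Fintype V] in
lemma pairwiseAdj_pair {u v : V} (a : G.Adj u v) : PairwiseAdj G {u, v} :=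
  (pairwiseAdj_singleton v).insert (by simpa using a)

namespace ApartSetup

variable (h : ApartSetup G K)
include h

lemma two_add_nu_le_of_split {A B : Finset V} (hA : IsTop G K A) (hB : IsTop G K B) (hne : A ≠ B)
    (hs : Split G K A) : 2 + nu G (cl G K B) ≤ K.card := by
  obtain ⟨Q, hQ, cQ, eQ⟩ := exists_card_eq_nu G (cl G K B)
  have hk := h.four
  by_cases kQ : 2 ≤ Q.card
  · obtain ⟨u, hu, r, hr, hu0, hr0, hus, hrs, a⟩ := hs
    have hap := h.apart A B hA hB hne
    have h1 := h.complete_below hu hu0 hus hA.subset hB.subset hap hQ cQ kQ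
    have h2 := h.complete_below hr hr0 hrs hA.subset hB.subset hap hQ cQ kQ
    have := h.card_add_card_le (pairwiseAdj_pair a) cQ (by
      intro x hx
      simp only [Finset.mem_insert, Finset.mem_singleton] at hx
      rcases hx with rfl | rfl
      · exact h1
      · exact h2)
    rwa [Finset.card_pair a.ne, eQ] at this
  · omega

lemma nu_add_nu_le {A B : Finset V} (hA : IsTop G K A) (hB : IsTop G K B) (hne : A ≠ B)
    (hc : A.card + B.card + 1 = K.card) : nu G (cl G K A) + nu G (cl G K B) ≤ K.card := by
  obtain ⟨P, hP, cP, eP⟩ := exists_card_eq_nu G (cl G K A)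
  obtain ⟨Q, hQ, cQ, eQ⟩ := exists_card_eq_nu G (cl G K B)
  have h1 := h.nu_add_card_le hA.subset
  have h2 := h.nu_add_card_le hB.subset
  have h3 := Finset.card_pos.2 hA.nonempty
  have h4 := Finset.card_pos.2 hB.nonempty
  have hk := h.four
  have hap := h.apart A B hA hB hne
  by_contra! hlt
  have := h.card_add_card_le cP cQ (by
    by_cases q : 3 ≤ P.card
    · exact h.complete_of_three_le hA.nonempty hB.nonempty hap hP hQ cP cQ q (by omega)
    · intro x hx y hy
      exact (h.complete_of_three_le hB.nonempty hA.nonempty hap.symm hQ hP cQ cP (by omega)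
        (by omega) y hy x hx).symm)
  omega

lemma colorable_two {A B : Finset V} (hA : IsTop G K A) (hB : IsTop G K B) (hne : A ≠ B)
    (hT : ∀ M, IsTop G K M → M = A ∨ M = B) (hc : A.card + B.card + 1 = K.card) :
    G.Colorable (K.card + 1) := by
  refine h.colorable_of_pair hA hB hne hT ?_
  have h1 := h.nu_add_nu_le hA hB hne hc
  have hk := h.four
  unfold nuSplit
  split_ifs with q1 q2 q2
  · have h2 := h.two_add_nu_le_of_split hA hB hne q1
    have h3 := h.two_add_nu_le_of_split hB hA hne.symm q2
    omega
  · have h2 := h.two_add_nu_le_of_split hA hB hne q1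
    omega
  · have h3 := h.two_add_nu_le_of_split hB hA hne.symm q2
    omega
  · exact h1

/-- Colouring with one colour shared by a family `Γ` of pairwise anticomplete stable classes. -/
lemma colorable_of_family {A B : Finset V} (hA : IsTop G K A) (hB : IsTop G K B) (hne : A ≠ B)
    (Γ Δ : Finset (Finset V)) (hΓ : ∀ M ∈ Γ, IsTop G K M) (hΔ : ∀ M ∈ Δ, IsTop G K M)
    (hT : ∀ M, IsTop G K M → M ∉ Γ → M ∈ Δ) (hd : ∀ M ∈ Δ, M ∉ Γ)
    (hsp : ∀ M ∈ Γ, nuSplit G K M ≤ 1) (hc : (Γ.biUnion id).card + 1 ≤ K.card)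
    (hs : 1 + ∑ M ∈ Δ, nuSplit G K M ≤ K.card)
    (han : ∀ M ∈ Γ, ∀ N ∈ Γ, M ≠ N → ∀ u ∈ cl G K M, ∀ v ∈ cl G K N, ¬ G.Adj u v) :
    G.Colorable (K.card + 1) := by
  have hΔd : ∀ M ∈ Δ, Disjoint (Γ.biUnion id) M := by
    intro M hM
    rw [Finset.disjoint_biUnion_left]
    intro N hN
    exact (h.apart N M (hΓ N hN) (hΔ M hM) (fun e => hd M hM (e ▸ hN))).1
  refine h.colorable_of_groups h.stable h.apart Δ.insertNone
    (fun i => i.elim (Γ.biUnion id) id) (fun i => i.elim 1 (nuSplit G K))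
    (fun M => if M ∈ Γ then none else some M) ?_ ?_ ?_ ?_ ?_ ?_ ?_ ?_ ?_
  · intro M hM
    split_ifs with q
    · exact Finset.none_mem_insertNone
    · exact Finset.some_mem_insertNone.2 (hT M hM q)
  · intro M hM
    split_ifs with q
    · exact Finset.subset_biUnion_of_mem id q
    · exact subset_rfl
  · rintro (_ | M) hM
    · exact Finset.biUnion_subset.2 fun N hN => (hΓ N hN).subset
    · exact (hΔ M (Finset.some_mem_insertNone.1 hM)).subset
  · rintro (_ | M) hM (_ | N) hN q
    · exact absurd rfl q
    · exact hΔd N (Finset.some_mem_insertNone.1 hN)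
    · exact (hΔd M (Finset.some_mem_insertNone.1 hM)).symm
    · exact (h.apart M N (hΔ M (Finset.some_mem_insertNone.1 hM))
        (hΔ N (Finset.some_mem_insertNone.1 hN)) (fun e => q (congrArg _ e))).1
  · rintro (_ | M) hM
    · simp only [Option.elim]
      omega
    · have hM' := hΔ M (Finset.some_mem_insertNone.1 hM)
      rcases eq_or_ne M A with e | q
      · exact h.nuSplit_add_card_le hM' hB (e ▸ hne)
      · exact h.nuSplit_add_card_le hM' hA q
  · rw [Finset.sum_insertNone]
    exact hs
  · intro M hM
    split_ifs with q
    · exact (nu_le_nuSplit M).trans (hsp M q)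
    · exact nu_le_nuSplit M
  · intro M hM hs
    have h2 : 2 ≤ nuSplit G K M := by
      simp only [nuSplit, if_pos hs]
      omega
    split_ifs with q
    · exact h2.trans (hsp M q)
    · exact h2
  · intro M N hM hN hMN e
    split_ifs at e with q1 q2 q2
    · exact han M q1 N q2 hMN
    · exact absurd (Option.some.inj e) hMN

/-- Three maximal traces covering `K`, one of them a singleton and the others not. -/
lemma colorable_three_large {A B D : Finset V} (hA : IsTop G K A) (hB : IsTop G K B)
    (hD : IsTop G K D) (hAB : A ≠ B) (hAD : A ≠ D) (hBD : B ≠ D)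
    (hT : ∀ M, IsTop G K M → M = A ∨ M = B ∨ M = D) (hc : A.card + B.card + 1 = K.card)
    (kD : D.card = 1) (kA : 2 ≤ A.card) (kB : 2 ≤ B.card) : G.Colorable (K.card + 1) := by
  have aAB := h.apart A B hA hB hAB
  have aAD := h.apart A D hA hD hAD
  have aBD := h.apart B D hB hD hBD
  have sAD : (A ∪ D).card + 2 ≤ K.card := by
    have := Finset.card_union_le A D
    omega
  have sBD : (B ∪ D).card + 2 ≤ K.card := by
    have := Finset.card_union_le B D
    omega
  have nA : ¬ Split G K A := fun q => by
    have := h.card_le_of_split hA hD.nonempty hD.inhabited aAD q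
    omega
  have nB : ¬ Split G K B := fun q => by
    have := h.card_le_of_split hB hD.nonempty hD.inhabited aBD q
    omega
  have nD : ¬ Split G K D := fun q => by
    have := two_le_card_of_split q
    omega
  have tA := h.nu_add_card_le hA.subset
  have tB := h.nu_add_card_le hB.subset
  have tD := h.nu_add_card_le hD.subset
  obtain ⟨P, hP, cP, eP⟩ := exists_card_eq_nu G (cl G K A)
  obtain ⟨Q, hQ, cQ, eQ⟩ := exists_card_eq_nu G (cl G K B)
  obtain ⟨R, hR, cR, eR⟩ := exists_card_eq_nu G (cl G K D)
  have fin : nu G (cl G K A) + nu G (cl G K B) + nu G (cl G K D) ≤ K.card →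
      G.Colorable (K.card + 1) := fun q => by
    refine h.colorable_of_triple hA hB hAB hAD hBD hT ?_
    rwa [nuSplit_of_not nA, nuSplit_of_not nB, nuSplit_of_not nD]
  have compl : (∀ x ∈ P, ∀ y ∈ Q, G.Adj x y) → (∀ x ∈ P, ∀ y ∈ R, G.Adj x y) →
      (∀ x ∈ Q, ∀ y ∈ R, G.Adj x y) → G.Colorable (K.card + 1) := by
    intro h1 h2 h3
    apply fin
    have e1 : P.card + Q.card = (P ∪ Q).card := by
      rw [Finset.card_union_of_disjoint]
      exact Finset.disjoint_left.2 fun x hx hx' => (h1 x hx x hx').ne rfl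
    have := h.card_add_card_le (cP.union cQ h1) cR (by
      intro x hx
      rcases Finset.mem_union.1 hx with hx | hx
      · exact h2 x hx
      · exact h3 x hx)
    omega
  by_cases kR : 2 ≤ R.card
  · obtain ⟨cA, pA⟩ := h.complete_of_small hA.nonempty hD.subset hA.subset aAD.symm
      (by rwa [Finset.union_comm]) hR cR kR
    obtain ⟨cB, pB⟩ := h.complete_of_small hB.nonempty hD.subset hB.subset aBD.symm
      (by rwa [Finset.union_comm]) hR cR kR
    by_cases hall : ∀ x ∈ cl G K A, ∀ y ∈ cl G K B, G.Adj x y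
    · exact compl (fun x hx y hy => hall x (hP hx) y (hQ hy)) (fun x hx => cA x (hP hx))
        (fun x hx => cB x (hQ hx))
    push Not at hall
    obtain ⟨x, hx, y, hy, hxy⟩ := hall
    obtain ⟨d, hd⟩ := Finset.card_pos.1 (show 0 < R.card by omega)
    have ed := mem_cl.1 (hR hd)
    have oneB : (cl G K B).card ≤ 1 := by
      by_contra! q
      exact hxy (h.complete_via hA.nonempty hB.nonempty hB.subset aAB hx subset_rfl pB q
        (cA x hx d hd).symm (fun y hy => (cB y hy d hd).symm) (ed.2 ▸ aBD.symm.1) y hy)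
    have oneA : (cl G K A).card ≤ 1 := by
      by_contra! q
      exact hxy (h.complete_via hB.nonempty hA.nonempty hA.subset aAB.symm hy subset_rfl pA q
        (cB y hy d hd).symm (fun x hx => (cA x hx d hd).symm) (ed.2 ▸ aAD.symm.1) x hx).symm
    have uA := Finset.card_le_card hP
    have uB := Finset.card_le_card hQ
    rw [Finset.card_le_one] at oneA oneB
    have hna : ∀ u ∈ cl G K A, ∀ v ∈ cl G K B, ¬ G.Adj u v := fun u hu v hv => by
      rwa [oneA u hu x hx, oneB v hv y hy]
    have hk := h.four
    have hAB' : (A ∪ B).card + 1 ≤ K.card := by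
      have := Finset.card_union_le A B
      omega
    refine h.colorable_of_family hA hB hAB {A, B} {D} (by simp [hA, hB]) (by simp [hD])
      (fun M hM => by simpa using fun a b => ((hT M hM).resolve_left a).resolve_left b)
      (by simp [hAD.symm, hBD.symm]) ?_ ?_ ?_ ?_
    · simp only [Finset.mem_insert, Finset.mem_singleton, forall_eq_or_imp, forall_eq]
      rw [nuSplit_of_not nA, nuSplit_of_not nB]
      rw [← Finset.card_le_one] at oneA oneB
      omega
    · simpa [Finset.biUnion_insert] using hAB'
    · rw [Finset.sum_singleton, nuSplit_of_not nD]
      omega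
    · intro M hM N hN hMN
      simp only [Finset.mem_insert, Finset.mem_singleton] at hM hN
      rcases hM with rfl | rfl <;> rcases hN with rfl | rfl
      · exact absurd rfl hMN
      · exact hna
      · exact fun u hu v hv q => hna v hv u hu q.symm
      · exact absurd rfl hMN
  · by_cases kP : nu G (cl G K A) ≤ 1
    · exact fin (by omega)
    by_cases kQ : nu G (cl G K B) ≤ 1
    · exact fin (by omega)
    obtain ⟨cA, -⟩ := h.complete_of_small hD.nonempty hA.subset hD.subset aAD sAD hP cP (by omega)
    obtain ⟨cB, -⟩ := h.complete_of_small hD.nonempty hB.subset hD.subset aBD sBD hQ cQ (by omega)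
    obtain ⟨d, hd⟩ := hD.inhabited
    have ed := mem_cl.1 hd
    refine compl (fun x hx => ?_) (fun x hx y hy => (cA y (hR hy) x hx).symm)
      (fun x hx y hy => (cB y (hR hy) x hx).symm)
    exact h.complete_via hA.nonempty hB.nonempty hB.subset aAB (hP hx) hQ cQ (by omega)
      (cA d hd x hx) (cB d hd) (ed.2 ▸ aBD.symm.1)

end ApartSetup
end TwoTops

section ThreeTops

variable {V : Type*} [Fintype V] {G : SimpleGraph V} {K : Finset V}

omit [Fintype V] in
lemma nu_eq_card {s : Finset V} (hs : PairwiseAdj G s) : nu G s = s.card := by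
  obtain ⟨Q, hQ, -, e⟩ := exists_card_eq_nu G s
  exact le_antisymm (e ▸ Finset.card_le_card hQ) (card_le_nu subset_rfl hs)

namespace ApartSetup

variable (h : ApartSetup G K)
include h

lemma not_edge_of_three_small {A B D Q E : Finset V} (hA : IsTop G K A) (hB : IsTop G K B)
    (hD : IsTop G K D) (aAB : Apart K A B) (aAD : Apart K A D) (aBD : Apart K B D)
    (hQ : Q ⊆ cl G K B) (cQ : PairwiseAdj G Q) (kQ : 2 ≤ Q.card) (hE : E = Q ∪ cl G K D)
    (cE : PairwiseAdj G E) (kE : E.card + 1 = K.card) {v p p' : V} (hv : v ∈ cl G K D)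
    (hvQ : ∀ q ∈ Q, G.Adj v q) (hp : p ∈ cl G K A) (hp' : p' ∈ cl G K A) (a : G.Adj p p')
    (b : G.Adj v p) : False := by
  have e := mem_cl.1 hp
  have e' := mem_cl.1 hp'
  have ev := mem_cl.1 hv
  have h1 := h.complete_via hA.nonempty hB.nonempty hB.subset aAB hp hQ cQ kQ b hvQ
    (ev.2 ▸ aBD.symm.1)
  obtain ⟨y, hy, z, hz, hyz⟩ := Finset.one_lt_card.1 kQ
  obtain ⟨q, hq, a1, a2⟩ : ∃ q ∈ Q, G.Adj p q ∧ G.Adj p' q := by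
    rcases h.adj_or_adj e'.1 (e'.2 ▸ hA.nonempty) (mem_cl.1 (hQ hy)).2.le (mem_cl.1 (hQ hz)).2.le
      (e'.2 ▸ aAB) hB.subset (cQ _ hy _ hz hyz) with q | q
    · exact ⟨y, hy, h1 y hy, q⟩
    · exact ⟨z, hz, h1 z hz, q⟩
  have hqE : q ∈ E := hE ▸ Finset.mem_union_left _ hq
  obtain ⟨s, hs⟩ := hA.nonempty
  have hsE : ∀ x ∈ E, ¬ G.Adj s x := by
    intro x hx
    rw [hE] at hx
    rcases Finset.mem_union.1 hx with hx | hx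
    · exact not_adj_of_mem_cl (hQ hx) (hA.subset hs) (Finset.disjoint_left.1 aAB.1 hs)
    · exact not_adj_of_mem_cl hx (hA.subset hs) (Finset.disjoint_left.1 aAD.1 hs)
  have hor : ∀ x ∈ E, G.Adj x p ∨ G.Adj x p' := by
    intro x hx
    rw [hE] at hx
    rcases Finset.mem_union.1 hx with hx | hx
    · have ex := mem_cl.1 (hQ hx)
      exact h.adj_or_adj ex.1 (ex.2 ▸ hB.nonempty) e.2.le e'.2.le (ex.2 ▸ aAB.symm) hA.subset a
    · have ex := mem_cl.1 hx
      exact h.adj_or_adj ex.1 (ex.2 ▸ hD.nonempty) e.2.le e'.2.le (ex.2 ▸ aAD.symm) hA.subset a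
  have hall : ∀ x ∈ E, G.Adj p x ∧ G.Adj p' x := by
    intro x hx
    rcases eq_or_ne q x with rfl | hne
    · exact ⟨a1, a2⟩
    rcases hor x hx with q1 | q1
    · exact ⟨q1.symm, h.adj_of_three (adj_of_mem_cl hp hs) (adj_of_mem_cl hp' hs) (hsE _ hqE)
        (hsE _ hx) a (cE _ hqE _ hx hne) a1 q1.symm a2⟩
    · exact ⟨h.adj_of_three (adj_of_mem_cl hp' hs) (adj_of_mem_cl hp hs) (hsE _ hqE)
        (hsE _ hx) a.symm (cE _ hqE _ hx hne) a2 q1.symm a1, q1.symm⟩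
  have := h.card_add_card_le (pairwiseAdj_pair a) cE (by
    intro x hx
    simp only [Finset.mem_insert, Finset.mem_singleton] at hx
    rcases hx with rfl | rfl
    · exact fun y hy => (hall y hy).1
    · exact fun y hy => (hall y hy).2)
  rw [Finset.card_pair a.ne] at this
  omega

lemma not_split_of_three_small {A B D Q : Finset V} (hA : IsTop G K A)
    (aAB : Apart K A B) (aAD : Apart K A D)
    (hQ : Q ⊆ cl G K B) (cQ : PairwiseAdj G Q) (kQ : Q.card + 2 = K.card)
    {v u r : V} (hv : v ∈ cl G K D) (hvQ : ∀ q ∈ Q, G.Adj v q) (hu : u ∉ K) (hr : r ∉ K)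
    (hu0 : (trace G K u).Nonempty) (hr0 : (trace G K r).Nonempty) (hus : trace G K u ⊂ A)
    (hrs : trace G K r ⊂ A) (a : G.Adj u r) (huQ : ∀ q ∈ Q, G.Adj u q) (hrQ : ∀ q ∈ Q, G.Adj r q)
    (b : G.Adj v u) : False := by
  have c1 : PairwiseAdj G (insert r Q) := cQ.insert hrQ
  have hu1 : ∀ y ∈ insert r Q, G.Adj u y := by
    simp only [Finset.mem_insert, forall_eq_or_imp]
    exact ⟨a, huQ⟩
  have c2 : PairwiseAdj G (insert u (insert r Q)) := c1.insert hu1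
  have k1 : (insert u (insert r Q)).card = K.card := by
    rw [Finset.card_insert_of_notMem (fun q => (hu1 u q).ne rfl),
      Finset.card_insert_of_notMem (fun q => (hrQ r q).ne rfl)]
    omega
  have hvr : ¬ G.Adj v r := by
    intro b'
    have hv1 : ∀ y ∈ insert u (insert r Q), G.Adj v y := by
      simp only [Finset.mem_insert, forall_eq_or_imp]
      exact ⟨b, b', hvQ⟩
    have := h.max _ (c2.insert hv1)
    rw [Finset.card_insert_of_notMem (fun q => (hv1 v q).ne rfl)] at this
    omega
  obtain ⟨w, hw⟩ := hA.inhabited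
  rw [mem_cl] at hw
  have hdis := (h.eq_union_of_adj_below hw.1 hu0 hr0 (hw.2 ▸ hus) (hw.2 ▸ hrs) a).2
  obtain ⟨x, hx⟩ := hr0
  have hxA := hrs.1 hx
  have hxK := hA.subset hxA
  have hxu : ¬ G.Adj x u := fun q =>
    Finset.disjoint_right.1 hdis hx (mem_trace.2 ⟨hxK, q.symm⟩)
  have hxr : G.Adj x r := (mem_trace.1 hx).2.symm
  have hxQ : ∀ q ∈ Q, ¬ G.Adj x q := fun q hq =>
    not_adj_of_mem_cl (hQ hq) hxK (Finset.disjoint_left.1 aAB.1 hxA)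
  have hK' : ∀ y ∈ insert u (insert r Q), y ∉ K := by
    simp only [Finset.mem_insert, forall_eq_or_imp]
    exact ⟨hu, hr, fun y hy => (mem_cl.1 (hQ hy)).1⟩
  refine h.not_compl (insert u (insert r Q)) (h.of_card c2 k1.symm) v ?_ x
    (fun q => hK' x q hxK) ⟨u, by simp, b⟩ ⟨r, by simp, hxr⟩ ?_
  · simp only [Finset.mem_insert, not_or]
    refine ⟨b.ne, ?_, fun q => (hvQ v q).ne rfl⟩
    rintro rfl
    rw [(mem_cl.1 hv).2] at hx
    exact Finset.disjoint_left.1 aAD.1 hxA hx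
  · simp only [Finset.mem_insert, forall_eq_or_imp]
    exact ⟨by simp [b, hxu], by simp [hvr, hxr], fun q hq => by simp [hvQ q hq, hxQ q hq]⟩

lemma sum_le_of_three_small {A B D : Finset V} (hA : IsTop G K A) (hB : IsTop G K B)
    (hD : IsTop G K D) (hAB : A ≠ B) (hAD : A ≠ D) (hBD : B ≠ D) (kA : A.card + 2 = K.card)
    (kB : B.card = 1) (kD : D.card = 1) (nB : 2 ≤ nu G (cl G K B)) :
    nuSplit G K A + nu G (cl G K B) + nu G (cl G K D) ≤ K.card := by
  have hk := h.four
  have aAB := h.apart A B hA hB hAB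
  have aAD := h.apart A D hA hD hAD
  have aBD := h.apart B D hB hD hBD
  have tA := h.nu_add_card_le hA.subset
  have sA : nuSplit G K A ≤ 2 := by
    unfold nuSplit
    split_ifs <;> omega
  obtain ⟨Q, hQ, cQ, eQ⟩ := exists_card_eq_nu G (cl G K B)
  obtain ⟨cD, pD⟩ := h.complete_of_small hD.nonempty hB.subset hD.subset aBD (by
    have := Finset.card_union_le B D
    omega) hQ cQ (by omega)
  rw [nu_eq_card pD, ← eQ]
  have hQD : ∀ x ∈ Q, ∀ y ∈ cl G K D, G.Adj x y := fun x hx y hy => (cD y hy x hx).symm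
  have cE := cQ.union pD hQD
  have kE : (Q ∪ cl G K D).card = Q.card + (cl G K D).card :=
    Finset.card_union_of_disjoint (Finset.disjoint_left.2 fun x hx hx' => (hQD x hx x hx').ne rfl)
  have kE' := h.max _ cE
  obtain ⟨v, hv⟩ := hD.inhabited
  have ev := mem_cl.1 hv
  by_contra! hlt
  have hne : (Q ∪ cl G K D).card ≠ K.card := by
    intro he
    obtain ⟨b, hb⟩ := hB.nonempty
    obtain ⟨d, hd⟩ := hD.nonempty
    obtain ⟨q, hq⟩ := Finset.card_pos.1 (show 0 < Q.card by omega)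
    have hK' : ∀ y ∈ Q ∪ cl G K D, y ∉ K := by
      intro y hy
      rcases Finset.mem_union.1 hy with hy | hy
      · exact (mem_cl.1 (hQ hy)).1
      · exact (mem_cl.1 hy).1
    refine h.not_compl _ (h.of_card cE he.symm) b (fun q => hK' b q (hB.subset hb)) d
      (fun q => hK' d q (hD.subset hd)) ⟨q, Finset.mem_union_left _ hq, adj_of_mem_cl (hQ hq) hb⟩
      ⟨v, Finset.mem_union_right _ hv, adj_of_mem_cl hv hd⟩ fun z hz => ?_
    rcases Finset.mem_union.1 hz with hz | hz
    · simp [adj_of_mem_cl (hQ hz) hb, not_adj_of_mem_cl (hQ hz) (hD.subset hd)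
        (Finset.disjoint_right.1 aBD.1 hd)]
    · simp [adj_of_mem_cl hz hd, not_adj_of_mem_cl hz (hB.subset hb)
        (Finset.disjoint_left.1 aBD.1 hb)]
  by_cases nA : 2 ≤ nu G (cl G K A)
  · obtain ⟨P, hP, cP, eP⟩ := exists_card_eq_nu G (cl G K A)
    obtain ⟨p, hp, p', hp', hpp⟩ := Finset.one_lt_card.1 (show 1 < P.card by omega)
    have a := cP _ hp _ hp' hpp
    have key : ∀ {p p'}, p ∈ cl G K A → p' ∈ cl G K A → G.Adj p p' → G.Adj v p → False :=
      fun hp hp' a b => h.not_edge_of_three_small hA hB hD aAB aAD aBD hQ cQ (by omega) rfl cE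
        (by omega) hv (cD v hv) hp hp' a b
    rcases h.adj_or_adj ev.1 (ev.2 ▸ hD.nonempty) (mem_cl.1 (hP hp)).2.le (mem_cl.1 (hP hp')).2.le
      (ev.2 ▸ aAD.symm) hA.subset a with b | b
    · exact key (hP hp) (hP hp') a b
    · exact key (hP hp') (hP hp) a.symm b
  · have sp : Split G K A := by
      by_contra q
      rw [nuSplit_of_not q] at hlt
      omega
    obtain ⟨u, hu, r, hr, hu0, hr0, hus, hrs, a⟩ := sp
    have huQ := h.complete_below hu hu0 hus hA.subset hB.subset aAB hQ cQ (by omega)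
    have hrQ := h.complete_below hr hr0 hrs hA.subset hB.subset aAB hQ cQ (by omega)
    by_cases nD : 2 ≤ (cl G K D).card
    · have huD := h.complete_below hu hu0 hus hA.subset hD.subset aAD subset_rfl pD nD
      have hrD := h.complete_below hr hr0 hrs hA.subset hD.subset aAD subset_rfl pD nD
      have := h.card_add_card_le (pairwiseAdj_pair a) cE (by
        intro x hx y hy
        simp only [Finset.mem_insert, Finset.mem_singleton] at hx
        rcases Finset.mem_union.1 hy with hy | hy <;> rcases hx with rfl | rfl
        · exact huQ y hy
        · exact hrQ y hy
        · exact huD y hy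
        · exact hrD y hy)
      rw [Finset.card_pair a.ne] at this
      omega
    · have := Finset.card_pos.2 ⟨v, hv⟩
      rcases h.adj_or_adj ev.1 (ev.2 ▸ hD.nonempty) hus.1 hrs.1 (ev.2 ▸ aAD.symm) hA.subset a
        with b | b
      · exact h.not_split_of_three_small hA aAB aAD hQ cQ (by omega) hv (cD v hv) hu hr hu0 hr0
          hus hrs a huQ hrQ b
      · exact h.not_split_of_three_small hA aAB aAD hQ cQ (by omega) hv (cD v hv) hr hu hr0 hu0
          hrs hus a.symm hrQ huQ b

lemma colorable_three_small {A B D : Finset V} (hA : IsTop G K A) (hB : IsTop G K B)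
    (hD : IsTop G K D) (hAB : A ≠ B) (hAD : A ≠ D) (hBD : B ≠ D)
    (hT : ∀ M, IsTop G K M → M = A ∨ M = B ∨ M = D) (kA : A.card + 2 = K.card)
    (kB : B.card = 1) (kD : D.card = 1) : G.Colorable (K.card + 1) := by
  refine h.colorable_of_triple hA hB hAB hAD hBD hT ?_
  have hk := h.four
  have tA := h.nu_add_card_le hA.subset
  have sA : nuSplit G K A ≤ 2 := by
    unfold nuSplit
    split_ifs <;> omega
  rw [nuSplit_of_not (M := B) fun q => by have := two_le_card_of_split q; omega,
    nuSplit_of_not (M := D) fun q => by have := two_le_card_of_split q; omega]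
  by_cases nB : 2 ≤ nu G (cl G K B)
  · exact h.sum_le_of_three_small hA hB hD hAB hAD hBD kA kB kD nB
  · by_cases nD : 2 ≤ nu G (cl G K D)
    · have := h.sum_le_of_three_small hA hD hB hAD hAB hBD.symm kA kD kB nD
      omega
    · omega

/-- Two maximal traces that miss exactly one vertex of `K`. -/
lemma colorable_of_union_card {A B : Finset V} (hA : IsTop G K A) (hB : IsTop G K B)
    (hAB : A ≠ B) (hc : A.card + B.card + 1 = K.card) : G.Colorable (K.card + 1) := by
  have aAB := h.apart A B hA hB hAB
  by_cases hT : ∀ M, IsTop G K M → M = A ∨ M = B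
  · exact h.colorable_two hA hB hAB hT hc
  push Not at hT
  obtain ⟨D, hD, hDA, hDB⟩ := hT
  have key : ∀ M, IsTop G K M → M ≠ A → M ≠ B → M = K \ (A ∪ B) := by
    intro M hM hMA hMB
    apply Finset.eq_of_subset_of_card_le
    · intro x hx
      simp only [Finset.mem_sdiff, Finset.mem_union, not_or]
      exact ⟨hM.subset hx, Finset.disjoint_left.1 (h.apart M A hM hA hMA).1 hx,
        Finset.disjoint_left.1 (h.apart M B hM hB hMB).1 hx⟩
    · rw [Finset.card_sdiff_of_subset (Finset.union_subset hA.subset hB.subset),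
        Finset.card_union_of_disjoint aAB.1]
      have := Finset.card_pos.2 hM.nonempty
      omega
  have kD : D.card = 1 := by
    rw [key D hD hDA hDB, Finset.card_sdiff_of_subset (Finset.union_subset hA.subset hB.subset),
      Finset.card_union_of_disjoint aAB.1]
    omega
  have hT : ∀ M, IsTop G K M → M = A ∨ M = B ∨ M = D := by
    intro M hM
    by_cases q1 : M = A
    · exact Or.inl q1
    by_cases q2 : M = B
    · exact Or.inr (Or.inl q2)
    exact Or.inr (Or.inr ((key M hM q1 q2).trans (key D hD hDA hDB).symm))
  have h1 := Finset.card_pos.2 hA.nonempty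
  have h2 := Finset.card_pos.2 hB.nonempty
  have hT' : ∀ M, IsTop G K M → M = B ∨ M = A ∨ M = D := fun M hM => by
    have := hT M hM
    tauto
  by_cases kA : A.card = 1
  · exact h.colorable_three_small hB hA hD hAB.symm hDB.symm hDA.symm hT' (by omega) kA kD
  by_cases kB : B.card = 1
  · exact h.colorable_three_small hA hB hD hAB hDA.symm hDB.symm hT (by omega) kB kD
  exact h.colorable_three_large hA hB hD hAB hDA.symm hDB.symm hT hc kD (by omega) (by omega)

end ApartSetup
end ThreeTops

section ManyTops

variable {V : Type*} [Fintype V] {G : SimpleGraph V} {K : Finset V}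

namespace ApartSetup

variable (h : ApartSetup G K)
include h

lemma not_split_of_small {A B : Finset V}
    (hG : ∀ M N, IsTop G K M → IsTop G K N → M ≠ N → M.card + N.card + 2 ≤ K.card)
    (hA : IsTop G K A) (hB : IsTop G K B) (hne : A ≠ B) {M : Finset V} (hM : IsTop G K M) :
    ¬ Split G K M := by
  obtain ⟨N, hN, hMN⟩ : ∃ N, IsTop G K N ∧ M ≠ N := by
    rcases eq_or_ne M A with rfl | q
    · exact ⟨B, hB, hne⟩
    · exact ⟨A, hA, q⟩
  intro q
  have h1 := h.card_le_of_split hM hN.nonempty hN.inhabited (h.apart M N hM hN hMN) q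
  have h2 := hG M N hM hN hMN
  have h3 := Finset.card_union_le M N
  omega

/-- Two classes that are not mutually complete, next to a class with an edge. -/
lemma colorable_of_not_adj {A B C Q : Finset V} {v w : V}
    (hG : ∀ M N, IsTop G K M → IsTop G K N → M ≠ N → M.card + N.card + 2 ≤ K.card)
    (hA : IsTop G K A) (hB : IsTop G K B) (hC : IsTop G K C) (hBA : B ≠ A) (hCA : C ≠ A)
    (hBC : B ≠ C) (hQ : Q ⊆ cl G K A) (cQ : PairwiseAdj G Q) (kQ : 2 ≤ Q.card)
    (eQ : Q.card = nu G (cl G K A)) (hv : v ∈ cl G K B) (hw : w ∈ cl G K C)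
    (hvw : ¬ G.Adj v w) : G.Colorable (K.card + 1) := by
  have hG' : ∀ M N, IsTop G K M → IsTop G K N → M ≠ N → (M ∪ N).card + 2 ≤ K.card := by
    intro M N hM hN hMN
    have := hG M N hM hN hMN
    have := Finset.card_union_le M N
    omega
  have hsmall : ∀ M, IsTop G K M → M ≠ A →
      (∀ x ∈ cl G K M, ∀ q ∈ Q, G.Adj x q) ∧ PairwiseAdj G (cl G K M) := fun M hM hMA =>
    h.complete_of_small hM.nonempty hA.subset hM.subset (h.apart A M hA hM hMA.symm)
      (hG' A M hA hM hMA.symm) hQ cQ kQ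
  have hone : ∀ M N x y, IsTop G K M → IsTop G K N → M ≠ A → M ≠ N → x ∈ cl G K M →
      y ∈ cl G K N → ¬ G.Adj x y → (cl G K M).card ≤ 1 := by
    intro M N x y hM hN hMA hMN hx hy hxy
    by_contra! q
    exact hxy ((h.complete_of_small hN.nonempty hM.subset hN.subset (h.apart M N hM hN hMN)
      (hG' M N hM hN hMN) subset_rfl (hsmall M hM hMA).2 q).1 y hy x hx).symm
  have hanti : ∀ M N x y, IsTop G K M → IsTop G K N → M ≠ A → N ≠ A → M ≠ N → x ∈ cl G K M →
      y ∈ cl G K N → ¬ G.Adj x y → ∀ x' ∈ cl G K M, ∀ y' ∈ cl G K N, ¬ G.Adj x' y' := by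
    intro M N x y hM hN hMA hNA hMN hx hy hxy x' hx' y' hy'
    rw [Finset.card_le_one.1 (hone M N x y hM hN hMA hMN hx hy hxy) x' hx' x hx,
      Finset.card_le_one.1 (hone N M y x hN hM hNA hMN.symm hy hx (fun q => hxy q.symm)) y' hy' y hy]
    exact hxy
  have hns : ∀ M, IsTop G K M → ¬ Split G K M := fun M hM => h.not_split_of_small hG hA hB hBA.symm hM
  have hnu1 : ∀ M, (cl G K M).card ≤ 1 → nu G (cl G K M) ≤ 1 := by
    intro M hM
    obtain ⟨P, hP, -, eP⟩ := exists_card_eq_nu G (cl G K M)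
    rw [← eP]
    exact (Finset.card_le_card hP).trans hM
  have hBC' := hanti B C v w hB hC hBA hCA hBC hv hw hvw
  have hoB := hone B C v w hB hC hBA hBC hv hw hvw
  have hoC := hone C B w v hC hB hCA hBC.symm hw hv (fun q => hvw q.symm)
  have hU : ∀ Γ : Finset (Finset V), (∀ M ∈ Γ, IsTop G K M) → A ∉ Γ →
      (Γ.biUnion id).card + 1 ≤ K.card := by
    intro Γ hΓ hAΓ
    have h1 : Γ.biUnion id ⊆ K \ A := by
      rw [Finset.biUnion_subset]
      intro M hM x hx
      exact Finset.mem_sdiff.2 ⟨(hΓ M hM).subset hx, Finset.disjoint_left.1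
        (h.apart M A (hΓ M hM) hA (fun e => hAΓ (e ▸ hM))).1 hx⟩
    have h2 := Finset.card_le_card h1
    rw [Finset.card_sdiff_of_subset hA.subset] at h2
    have := Finset.card_pos.2 hA.nonempty
    have := Finset.card_le_card hA.subset
    omega
  have hnuA : 1 + nuSplit G K A ≤ K.card := by
    have := h.nuSplit_add_card_le hA hB hBA.symm
    have := Finset.card_pos.2 hA.nonempty
    omega
  have hpair : ∀ Δ : Finset (Finset V), (∀ M ∈ Δ, IsTop G K M) → B ∉ Δ → C ∉ Δ →
      (∀ M, IsTop G K M → M ≠ B → M ≠ C → M ∈ Δ) → 1 + ∑ M ∈ Δ, nuSplit G K M ≤ K.card →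
      G.Colorable (K.card + 1) := by
    intro Δ h1 h2 h3 h4 h5
    refine h.colorable_of_family hA hB hBA.symm {B, C} Δ (by simp [hB, hC]) h1
      (fun M hM q => by simp at q; exact h4 M hM q.1 q.2) (fun M hM q => ?_) ?_
      (hU _ (by simp [hB, hC]) (by simp [hBA.symm, hCA.symm])) h5 ?_
    · simp only [Finset.mem_insert, Finset.mem_singleton] at q
      rcases q with rfl | rfl
      · exact h2 hM
      · exact h3 hM
    · simp only [Finset.mem_insert, Finset.mem_singleton, forall_eq_or_imp, forall_eq]
      rw [nuSplit_of_not (hns B hB), nuSplit_of_not (hns C hC)]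
      exact ⟨hnu1 _ hoB, hnu1 _ hoC⟩
    · intro M hM N hN hMN
      simp only [Finset.mem_insert, Finset.mem_singleton] at hM hN
      rcases hM with rfl | rfl <;> rcases hN with rfl | rfl
      · exact absurd rfl hMN
      · exact hBC'
      · exact fun x hx y hy q => hBC' y hy x hx q.symm
      · exact absurd rfl hMN
  by_cases hT : ∀ M, IsTop G K M → M = A ∨ M = B ∨ M = C
  · refine hpair {A} (by simp [hA]) (by simp [hBA]) (by simp [hCA])
      (fun M hM q1 q2 => by simpa [q1, q2] using hT M hM) (by simpa using hnuA)
  push Not at hT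
  obtain ⟨D, hD, hDA, hDB, hDC⟩ := hT
  have hp3 : K.card ≤ (A ∪ (B ∪ C)).card + 1 := by
    obtain ⟨q, hq⟩ := Finset.card_pos.1 (show 0 < Q.card by omega)
    have e1 := mem_cl.1 hv
    have e2 := mem_cl.1 hw
    have e3 := mem_cl.1 (hQ hq)
    refine h.card_le_of_p3 (Finset.union_subset hA.subset (Finset.union_subset hB.subset hC.subset))
      ((hsmall B hB hBA).1 v hv q hq) ((hsmall C hC hCA).1 w hw q hq).symm hvw
      (fun e => hBC ?_) ?_ ?_ ?_
    · rw [← e1.2, e, e2.2]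
    · exact e1.2 ▸ Finset.subset_union_left.trans Finset.subset_union_right
    · exact e3.2 ▸ Finset.subset_union_left
    · exact e2.2 ▸ Finset.subset_union_right.trans Finset.subset_union_right
  have hUK : A ∪ (B ∪ C) ⊆ K :=
    Finset.union_subset hA.subset (Finset.union_subset hB.subset hC.subset)
  have key : ∀ M, IsTop G K M → M ≠ A → M ≠ B → M ≠ C → M = K \ (A ∪ (B ∪ C)) := by
    intro M hM hMA hMB hMC
    apply Finset.eq_of_subset_of_card_le
    · intro x hx
      simp only [Finset.mem_sdiff, Finset.mem_union, not_or]
      exact ⟨hM.subset hx, Finset.disjoint_left.1 (h.apart M A hM hA hMA).1 hx,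
        Finset.disjoint_left.1 (h.apart M B hM hB hMB).1 hx,
        Finset.disjoint_left.1 (h.apart M C hM hC hMC).1 hx⟩
    · rw [Finset.card_sdiff_of_subset hUK]
      have := Finset.card_pos.2 hM.nonempty
      omega
  have hT : ∀ M, IsTop G K M → M ≠ A → M ≠ B → M ≠ C → M = D := fun M hM q1 q2 q3 =>
    (key M hM q1 q2 q3).trans (key D hD hDA hDB hDC).symm
  obtain ⟨cD, pD⟩ := hsmall D hD hDA
  have hcompl : ∀ M x, IsTop G K M → M ≠ A → x ∈ cl G K M → (∀ y ∈ cl G K D, G.Adj x y) →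
      G.Colorable (K.card + 1) := by
    intro M x hM hMA hx hxD
    refine hpair {A, D} (by simp [hA, hD]) (by simp [hBA, hDB.symm]) (by simp [hCA, hDC.symm])
      (fun M hM q1 q2 => ?_) ?_
    · simp only [Finset.mem_insert, Finset.mem_singleton]
      by_cases q3 : M = A
      · exact Or.inl q3
      · exact Or.inr (hT M hM q3 q1 q2)
    · rw [Finset.sum_pair hDA.symm, nuSplit_of_not (hns A hA), nuSplit_of_not (hns D hD), ← eQ,
        nu_eq_card pD]
      have h1 := h.card_add_card_le (cQ.insert ((hsmall M hM hMA).1 x hx)) pD (by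
        intro y hy z hz
        rcases Finset.mem_insert.1 hy with rfl | hy
        · exact hxD z hz
        · exact (cD z hz y hy).symm)
      rw [Finset.card_insert_of_notMem (fun q => ((hsmall M hM hMA).1 x hx x q).ne rfl)] at h1
      omega
  by_cases q1 : ∀ y ∈ cl G K D, G.Adj v y
  · exact hcompl B v hB hBA hv q1
  by_cases q2 : ∀ y ∈ cl G K D, G.Adj w y
  · exact hcompl C w hC hCA hw q2
  push Not at q1 q2
  obtain ⟨d, hd, hvd⟩ := q1
  obtain ⟨d', hd', hwd⟩ := q2
  have hBD := hanti B D v d hB hD hBA hDA hDB.symm hv hd hvd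
  have hCD := hanti C D w d' hC hD hCA hDA hDC.symm hw hd' hwd
  have hoD := hone D B d v hD hB hDA hDB hd hv (fun q => hvd q.symm)
  refine h.colorable_of_family hA hB hBA.symm {B, C, D} {A} (by simp [hB, hC, hD]) (by simp [hA])
      (fun M hM q => ?_) (by simp [hBA.symm, hCA.symm, hDA.symm]) ?_
      (hU _ (by simp [hB, hC, hD]) (by simp [hBA.symm, hCA.symm, hDA.symm])) (by simpa using hnuA) ?_
  · simp only [Finset.mem_insert, Finset.mem_singleton, not_or] at q ⊢
    by_contra q'
    exact q.2.2 (hT M hM q' q.1 q.2.1)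
  · simp only [Finset.mem_insert, Finset.mem_singleton, forall_eq_or_imp, forall_eq]
    rw [nuSplit_of_not (hns B hB), nuSplit_of_not (hns C hC), nuSplit_of_not (hns D hD)]
    exact ⟨hnu1 _ hoB, hnu1 _ hoC, hnu1 _ hoD⟩
  · intro M hM N hN hMN
    simp only [Finset.mem_insert, Finset.mem_singleton] at hM hN
    rcases hM with rfl | rfl | rfl <;> rcases hN with rfl | rfl | rfl
    · exact absurd rfl hMN
    · exact hBC'
    · exact hBD
    · exact fun x hx y hy q => hBC' y hy x hx q.symm
    · exact absurd rfl hMN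
    · exact hCD
    · exact fun x hx y hy q => hBD y hy x hx q.symm
    · exact fun x hx y hy q => hCD y hy x hx q.symm
    · exact absurd rfl hMN

/-- Colouring when the maximal traces are pairwise apart. -/
lemma colorable {A B : Finset V} (hA : IsTop G K A) (hB : IsTop G K B) (hne : A ≠ B) :
    G.Colorable (K.card + 1) := by
  by_cases hN : ∃ M N, IsTop G K M ∧ IsTop G K N ∧ M ≠ N ∧ M.card + N.card + 1 = K.card
  · obtain ⟨M, N, hM, hN, hMN, hc⟩ := hN
    exact h.colorable_of_union_card hM hN hMN hc
  have hG : ∀ M N, IsTop G K M → IsTop G K N → M ≠ N → M.card + N.card + 2 ≤ K.card := by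
    intro M N hM hN' hMN
    have h1 := (h.apart M N hM hN' hMN).card_add_lt hM.subset hN'.subset
    by_contra q
    exact hN ⟨M, N, hM, hN', hMN, by omega⟩
  have hns : ∀ M, IsTop G K M → ¬ Split G K M := fun M hM => h.not_split_of_small hG hA hB hne hM
  by_cases h1 : ∀ M, IsTop G K M → nu G (cl G K M) ≤ 1
  · refine h.colorable_of_sum hA hB hne ?_
    calc ∑ M ∈ tops G K, nuSplit G K M ≤ ∑ M ∈ tops G K, M.card := by
          refine Finset.sum_le_sum fun M hM => ?_
          rw [mem_tops] at hM
          rw [nuSplit_of_not (hns M hM)]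
          exact (h1 M hM).trans (Finset.card_pos.2 hM.nonempty)
      _ = ((tops G K).biUnion id).card := by
          rw [Finset.card_biUnion]
          · rfl
          · exact fun M hM N hN hMN => (h.apart M N (mem_tops.1 hM) (mem_tops.1 hN) hMN).1
      _ ≤ K.card := Finset.card_le_card
          (Finset.biUnion_subset.2 fun M hM => (mem_tops.1 hM).subset)
  push Not at h1
  obtain ⟨M, hM, hk⟩ := h1
  obtain ⟨Q, hQ, cQ, eQ⟩ := exists_card_eq_nu G (cl G K M)
  by_cases h2 : ∀ B C, IsTop G K B → IsTop G K C → B ≠ M → C ≠ M → B ≠ C →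
      ∀ v ∈ cl G K B, ∀ w ∈ cl G K C, G.Adj v w
  · have hs : ∀ N, IsTop G K N → N ≠ M →
        (∀ x ∈ cl G K N, ∀ q ∈ Q, G.Adj x q) ∧ PairwiseAdj G (cl G K N) := fun N hN' hNM =>
      h.complete_of_small hN'.nonempty hM.subset hN'.subset (h.apart M N hM hN' hNM.symm)
        (by
          have := hG M N hM hN' hNM.symm
          have := Finset.card_union_le M N
          omega) hQ cQ (by omega)
    refine h.colorable_of_sum hA hB hne ?_
    have := sum_card_le h.max (tops G K) (fun N => if N = M then Q else cl G K N) (by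
        intro N hN'
        split_ifs with q
        · exact cQ
        · exact (hs N (mem_tops.1 hN') q).2) (by
        intro N hN' L hL hNL
        split_ifs with q1 q2 q2
        · exact absurd (q1.trans q2.symm) hNL
        · exact fun x hx y hy => ((hs L (mem_tops.1 hL) q2).1 y hy x hx).symm
        · exact (hs N (mem_tops.1 hN') q1).1
        · exact h2 N L (mem_tops.1 hN') (mem_tops.1 hL) q1 q2 hNL)
    refine le_trans (Finset.sum_le_sum fun N hN' => ?_) this
    rw [mem_tops] at hN'
    rw [nuSplit_of_not (hns N hN')]
    split_ifs with q
    · rw [q, eQ]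
    · rw [nu_eq_card (hs N hN' q).2]
  · push Not at h2
    obtain ⟨B, C, hB, hC, hBM, hCM, hBC, v, hv, w, hw, hvw⟩ := h2
    exact h.colorable_of_not_adj hG hM hB hC hBM hCM hBC hQ cQ (by omega) eQ hv hw hvw

end ApartSetup
end ManyTops

section Recolor

variable {V : Type*} {G : SimpleGraph V}

/-- Recolouring the vertices of `s` one at a time repairs a colouring that is proper off `s`. -/
lemma exists_recoloring (D : V → Prop) (L : V → Finset V) (s : Finset V) (f₀ : V → V)
    (h0 : ∀ v, D v → f₀ v ∈ L v)
    (hp : ∀ u v, D u → D v → u ∉ s → v ∉ s → G.Adj u v → f₀ u ≠ f₀ v)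
    (hx : ∀ u ∈ s, ∀ f : V → V, (∀ v, D v → f v ∈ L v) → (∀ v ∉ s, f v = f₀ v) →
      ∃ x ∈ L u, ∀ r, D r → G.Adj u r → f r ≠ x) :
    ∃ f : V → V, (∀ v, D v → f v ∈ L v) ∧ ∀ u v, D u → D v → G.Adj u v → f u ≠ f v := by
  have key : ∀ t : Finset V, t ⊆ s → ∃ f : V → V, (∀ v, D v → f v ∈ L v) ∧
      (∀ v ∉ s, f v = f₀ v) ∧ ∀ u v, D u → D v → (u ∈ s → u ∈ t) → (v ∈ s → v ∈ t) →
        G.Adj u v → f u ≠ f v := by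
    intro t
    induction t using Finset.induction_on with
    | empty =>
      intro _
      exact ⟨f₀, h0, fun _ _ => rfl, fun u v hu hv q1 q2 => hp u v hu hv
        (fun q => absurd (q1 q) (Finset.notMem_empty u))
        (fun q => absurd (q2 q) (Finset.notMem_empty v))⟩
    | insert a t ha ih =>
      intro hs
      obtain ⟨f, h1, h2, h3⟩ := ih ((Finset.subset_insert a t).trans hs)
      have has := hs (Finset.mem_insert_self a t)
      obtain ⟨x, hxL, hx⟩ := hx a has f h1 h2
      refine ⟨Function.update f a x, ?_, ?_, ?_⟩
      · intro v hv
        rcases eq_or_ne v a with rfl | q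
        · simpa using hxL
        · simpa [q] using h1 v hv
      · intro v hv
        have : v ≠ a := fun e => hv (e ▸ has)
        simpa [this] using h2 v hv
      · intro u v hu hv q1 q2 a'
        rcases eq_or_ne u a with rfl | e1 <;> rcases eq_or_ne v u with e2 | e2
        · exact absurd e2.symm a'.ne
        · simpa [e2] using (hx v hv a').symm
        · exact absurd e2.symm a'.ne
        · rcases eq_or_ne v a with rfl | e3
          · simpa [e1] using hx u hu a'.symm
          · simp only [Function.update_of_ne e1, Function.update_of_ne e3]
            exact h3 u v hu hv (fun q => Finset.mem_of_mem_insert_of_ne (q1 q) e1)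
              (fun q => Finset.mem_of_mem_insert_of_ne (q2 q) e3) a'
  obtain ⟨f, h1, -, h3⟩ := key s subset_rfl
  exact ⟨f, h1, fun u v hu hv => h3 u v hu hv id id⟩

end Recolor

section CoveringTops

variable {V : Type*} [Fintype V] {G : SimpleGraph V} {K : Finset V}

namespace Setup

variable (h : Setup G K)
include h

omit [Fintype V] in
/-- A neighbour of `u` that does not see a vertex `x` of the trace complementing that of `u` in
`K \ {y}` has trace `{y}`. -/
lemma trace_eq_of_not_mem {u q r w x y : V} (hw : w ∉ K)
    (ew : trace G K w = K.erase y)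
    (hu0 : (trace G K u).Nonempty) (hus : trace G K u ⊂ trace G K w)
    (hr : r ∉ K) (hr0 : (trace G K r).Nonempty)
    (eq : trace G K q = trace G K w \ trace G K u) (hx : x ∈ trace G K q) (hxr : x ∉ trace G K r)
    (a : G.Adj u r) : trace G K r = {y} := by
  have below : ¬ trace G K r ⊂ trace G K w := by
    intro hrs
    have h1 := (h.eq_union_of_adj_below hw hu0 hr0 hus hrs a).1
    rw [eq, h1] at hx
    simp only [Finset.mem_sdiff, Finset.mem_union] at hx
    tauto
  have hd : Disjoint (trace G K u) (trace G K r) := by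
    rcases h.cross_free u r with c | c | c | c
    · exact c
    · rcases eq_or_ne (trace G K u) (trace G K r) with e | e
      · exact absurd (e ▸ hus) below
      · exact absurd a (h.not_adj_of_ssubset hr hu0 (c.ssubset_of_ne e))
    · exact absurd (lt_of_le_of_lt c hus) below
    · have hxK : x ∈ K := trace_subset q hx
      rw [← c.1] at hxK
      rw [eq] at hx
      simp only [Finset.mem_sdiff, Finset.mem_union] at hx hxK
      tauto
  rcases h.cross_free r q with c | c | c | c
  · rw [Finset.eq_singleton_iff_nonempty_unique_mem]
    refine ⟨hr0, fun z hz => ?_⟩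
    by_contra hzy
    have h1 : z ∈ trace G K w := by
      rw [ew]
      exact Finset.mem_erase.2 ⟨hzy, trace_subset r hz⟩
    refine Finset.disjoint_left.1 c hz ?_
    rw [eq]
    exact Finset.mem_sdiff.2 ⟨h1, Finset.disjoint_right.1 hd hz⟩
  · refine absurd ?_ below
    have h1 : trace G K r ⊂ trace G K q := c.ssubset_of_ne (fun e => hxr (e ▸ hx))
    exact lt_of_lt_of_le h1 (by rw [eq]; exact Finset.sdiff_subset)
  · exact absurd (c hx) hxr
  · obtain ⟨z, hz⟩ := hu0
    have hzK := trace_subset u hz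
    rw [← c.1, eq] at hzK
    simp only [Finset.mem_sdiff, Finset.mem_union] at hzK
    have := Finset.disjoint_left.1 hd hz
    tauto

/-- The class of `{y}` has no clique of size `|K| - 1` when some edge splits `K \ {y}`. -/
lemma nu_singleton_add_two_le {y : V} (hy : y ∈ K) (hN : IsTop G K (K.erase y))
    (hs : Split G K (K.erase y)) : nu G (cl G K {y}) + 2 ≤ K.card := by
  obtain ⟨w, hw⟩ := hN.inhabited
  obtain ⟨hw, ew⟩ := mem_cl.1 hw
  obtain ⟨Q, hQ, cQ, eQ⟩ := exists_card_eq_nu G (cl G K {y})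
  have hk := h.four
  by_contra! hlt
  have hyK : ({y} : Finset V) ⊆ K := by simpa using hy
  have main : ∀ u q, u ∉ K → q ∉ K → (trace G K u).Nonempty → (trace G K q).Nonempty →
      trace G K u ⊂ K.erase y → trace G K q ⊂ K.erase y → G.Adj u q →
      (trace G K q).card + 3 ≤ K.card → False := by
    intro u q hu hq hu0 hq0 hus hqs a hc
    have hyd : ∀ {v}, trace G K v ⊂ K.erase y → Apart K (trace G K v) {y} := by
      intro v hv
      refine ⟨Finset.disjoint_singleton_right.2 fun m => Finset.notMem_erase y K (hv.1 m), fun e => ?_⟩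
      obtain ⟨z, hz, hz'⟩ := Finset.exists_of_ssubset hv
      rw [Finset.mem_erase] at hz
      have := hz.2
      rw [← e, Finset.mem_union, Finset.mem_singleton] at this
      tauto
    have hqQ := h.complete_of_union_card_le hq hq0 hyK (hyd hqs) (by
      have := Finset.card_union_le (trace G K q) {y}
      rw [Finset.card_singleton] at this
      omega) hQ cQ (by omega)
    have hnot : ∀ {v}, trace G K v ⊂ K.erase y → ¬ G.Adj y v := fun hv q =>
      Finset.notMem_erase y K (hv.1 (mem_trace.2 ⟨hy, q.symm⟩))
    have huQ : ∀ r ∈ Q, G.Adj u r := by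
      intro r hr
      by_contra c
      obtain ⟨r', hr', hne⟩ := Finset.exists_mem_ne (show 1 < Q.card by omega) r
      have hr'u : G.Adj u r' := (h.adj_or_adj hu hu0 (mem_cl.1 (hQ hr)).2.le
        (mem_cl.1 (hQ hr')).2.le (hyd hus) hyK (cQ r hr r' hr' hne.symm)).resolve_left c
      exact h.gem r' y r q u (adj_of_mem_cl (hQ hr) (by simp)) (hqQ r hr).symm a.symm (hnot hqs)
        (hnot hus) (fun t => c t.symm) (adj_of_mem_cl (hQ hr') (by simp)).symm
        (cQ r' hr' r hr hne) (hqQ r' hr').symm hr'u.symm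
    have := h.card_add_card_le (pairwiseAdj_pair a) cQ (by
      intro x hx
      simp only [Finset.mem_insert, Finset.mem_singleton] at hx
      rcases hx with rfl | rfl
      · exact huQ
      · exact hqQ)
    rw [Finset.card_pair a.ne] at this
    omega
  obtain ⟨u, hu, q, hq, hu0, hq0, hus, hqs, a⟩ := hs
  have h1 := h.eq_union_of_adj_below hw hu0 hq0 (ew ▸ hus) (ew ▸ hqs) a
  have h2 : (trace G K u).card + (trace G K q).card + 1 = K.card := by
    rw [← Finset.card_union_of_disjoint h1.2, ← h1.1, ew, Finset.card_erase_of_mem hy]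
    omega
  have := Finset.card_pos.2 hu0
  have := Finset.card_pos.2 hq0
  by_cases c : (trace G K q).card + 3 ≤ K.card
  · exact main u q hu hq hu0 hq0 hus hqs a c
  · exact main q u hq hu hq0 hu0 hqs hus a.symm (by omega)

end Setup
end CoveringTops

section CoveringColoring

variable {V : Type*} [Fintype V] {G : SimpleGraph V} {K : Finset V}

/-- The vertex `u` is recoloured: its trace `S` lies below `M`, the clique `K` exceeds `M` by one
vertex, some neighbour of `u` has trace `M \ S`, and a tie-breaking rule selects `S`. -/
structure Recolored (G : SimpleGraph V) (K M : Finset V) (s u : V) : Prop where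
  not_mem : u ∉ K
  top : IsTop G K M
  nonempty : (trace G K u).Nonempty
  below : trace G K u ⊂ M
  card : (K \ M).card = 1
  edge : ∃ q ∉ K, G.Adj u q ∧ trace G K q = M \ trace G K u
  rule : IsTop G K (K \ M) ∧ s ∉ trace G K u ∨ ¬ IsTop G K (K \ M) ∧
    ((trace G K u).card < (M \ trace G K u).card ∨
      (trace G K u).card = (M \ trace G K u).card ∧ s ∉ trace G K u)

lemma recolored_or {M : Finset V} {s u v : V} (hM : IsTop G K M) (hs : s ∈ M)
    (hc : (K \ M).card = 1) (hu : u ∉ K) (hv : v ∉ K) (hu0 : (trace G K u).Nonempty)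
    (hv0 : (trace G K v).Nonempty) (hus : trace G K u ⊂ M) (hvs : trace G K v ⊂ M)
    (he : M = trace G K u ∪ trace G K v) (hd : Disjoint (trace G K u) (trace G K v))
    (a : G.Adj u v) : Recolored G K M s u ∨ Recolored G K M s v := by
  have e1 : M \ trace G K u = trace G K v := by
    rw [he, Finset.union_sdiff_cancel_left hd]
  have e2 : M \ trace G K v = trace G K u := by
    rw [he, Finset.union_sdiff_cancel_right hd]
  have h3 : s ∈ trace G K u ∨ s ∈ trace G K v := by
    rwa [he, Finset.mem_union] at hs
  have h4 : s ∈ trace G K u → s ∉ trace G K v := fun q => Finset.disjoint_left.1 hd q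
  by_cases hI : IsTop G K (K \ M)
  · rcases h3 with h3 | h3
    · exact Or.inr ⟨hv, hM, hv0, hvs, hc, ⟨u, hu, a.symm, e2.symm⟩, Or.inl ⟨hI, h4 h3⟩⟩
    · exact Or.inl ⟨hu, hM, hu0, hus, hc, ⟨v, hv, a, e1.symm⟩, Or.inl ⟨hI, fun q => h4 q h3⟩⟩
  · rcases lt_trichotomy (trace G K u).card (trace G K v).card with c | c | c
    · exact Or.inl ⟨hu, hM, hu0, hus, hc, ⟨v, hv, a, e1.symm⟩,
        Or.inr ⟨hI, Or.inl (e1.symm ▸ c)⟩⟩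
    · rcases h3 with h3 | h3
      · exact Or.inr ⟨hv, hM, hv0, hvs, hc, ⟨u, hu, a.symm, e2.symm⟩,
          Or.inr ⟨hI, Or.inr ⟨e2.symm ▸ c.symm, h4 h3⟩⟩⟩
      · exact Or.inl ⟨hu, hM, hu0, hus, hc, ⟨v, hv, a, e1.symm⟩,
          Or.inr ⟨hI, Or.inr ⟨e1.symm ▸ c, fun q => h4 q h3⟩⟩⟩
    · exact Or.inr ⟨hv, hM, hv0, hvs, hc, ⟨u, hu, a.symm, e2.symm⟩,
        Or.inr ⟨hI, Or.inl (e2.symm ▸ c)⟩⟩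

namespace Setup

variable (h : Setup G K)
include h

lemma exists_color_of_recolored {M : Finset V} {s u : V} (hs : s ∈ M) (hu : Recolored G K M s u)
    (f : V → V) (hf : ∀ v, v ∉ K → trace G K v ≠ ∅ → f v ∈ K \ trace G K v)
    (hfs : IsTop G K (K \ M) → ∀ r ∈ cl G K (K \ M), f r ≠ s) :
    ∃ x ∈ K \ trace G K u, ∀ r, r ∉ K → trace G K r ≠ ∅ → G.Adj u r → f r ≠ x := by
  obtain ⟨w, hw⟩ := hu.top.inhabited
  obtain ⟨hw, ew⟩ := mem_cl.1 hw
  obtain ⟨y, ey⟩ := Finset.card_eq_one.1 hu.card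
  have hy : y ∈ K ∧ y ∉ M := by
    have : y ∈ K \ M := ey ▸ Finset.mem_singleton_self y
    exact Finset.mem_sdiff.1 this
  have eM : M = K.erase y := by
    ext z
    have := Finset.ext_iff.1 ey z
    have hz : z ∈ M → z ∈ K := fun q => hu.top.subset q
    simp only [Finset.mem_sdiff, Finset.mem_singleton, Finset.mem_erase] at this ⊢
    grind
  obtain ⟨q, hq, a, eq⟩ := hu.edge
  have hK := Finset.card_erase_of_mem hy.1
  rw [← eM] at hK
  have hPS := Finset.card_sdiff_add_card_eq_card hu.below.1
  have hk := h.four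
  have conf : ∀ x ∈ M \ trace G K u, ∀ r, r ∉ K → trace G K r ≠ ∅ → G.Adj u r → f r = x →
      trace G K r = {y} := by
    intro x hx r hr hr0 a' e
    have h1 := Finset.mem_sdiff.1 (hf r hr hr0)
    rw [e] at h1
    exact h.trace_eq_of_not_mem (q := q) (x := x) hw (ew.trans eM) hu.nonempty (ew ▸ hu.below)
      hr (Finset.nonempty_iff_ne_empty.2 hr0) (ew ▸ eq) (eq ▸ hx) h1.2 a'
  have hsub : ∀ x ∈ M \ trace G K u, x ∈ K \ trace G K u := fun x hx =>
    Finset.mem_sdiff.2 ⟨hu.top.subset (Finset.mem_sdiff.1 hx).1, (Finset.mem_sdiff.1 hx).2⟩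
  by_cases hI : IsTop G K (K \ M)
  · have hsx : s ∈ M \ trace G K u := by
      rcases hu.rule with c | c
      · exact Finset.mem_sdiff.2 ⟨hs, c.2⟩
      · exact absurd hI c.1
    refine ⟨s, hsub s hsx, fun r hr hr0 a' e => ?_⟩
    refine hfs hI r (mem_cl.2 ⟨hr, ?_⟩) e
    rw [ey]
    exact conf s hsx r hr hr0 a' e
  · have hle : (trace G K u).card ≤ (M \ trace G K u).card := by
      rcases hu.rule with c | c
      · exact absurd c.1 hI
      · omega
    have h2 : 1 < (M \ trace G K u).card := by omega
    have huniq : ∀ r r', r ∉ K → r' ∉ K → trace G K r = {y} → trace G K r' = {y} → G.Adj u r →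
        G.Adj u r' → r = r' := by
      intro r r' hr hr' er er' a1 a2
      by_contra hne
      have h3 : ¬ G.Adj r r' := by
        intro a3
        obtain ⟨N, hN, hrN⟩ := exists_isTop hr (by rw [er]; exact Finset.singleton_nonempty y)
        have hNy : {y} ≠ N := fun e => hI (by rwa [ey, e])
        obtain ⟨v, hv⟩ := hN.inhabited
        obtain ⟨hv, ev⟩ := mem_cl.1 hv
        rw [er] at hrN
        have h4 := (h.eq_union_of_adj_below hv (by rw [er]; exact Finset.singleton_nonempty y)
          (by rw [er']; exact Finset.singleton_nonempty y)
          (by rw [er, ev]; exact hrN.ssubset_of_ne hNy)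
          (by rw [er', ev]; exact hrN.ssubset_of_ne hNy) a3).2
        rw [er, er'] at h4
        simp at h4
      have h5 := h.card_le_of_p3 (S := trace G K u ∪ {y})
        (Finset.union_subset (trace_subset u) (by simpa using hy.1)) a1.symm a2 h3 hne
        (er ▸ Finset.subset_union_right) Finset.subset_union_left (er' ▸ Finset.subset_union_right)
      have h6 := Finset.card_union_le (trace G K u) {y}
      rw [Finset.card_singleton] at h6
      have := Finset.card_pos.2 hu.nonempty
      omega
    by_cases hr : ∃ r, r ∉ K ∧ trace G K r = {y} ∧ G.Adj u r
    · obtain ⟨r, hr, er, a1⟩ := hr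
      obtain ⟨x, hx, hne⟩ := Finset.exists_mem_ne h2 (f r)
      refine ⟨x, hsub x hx, fun r' hr' hr0 a2 e => hne ?_⟩
      rw [← e, huniq r r' hr hr' er (conf x hx r' hr' hr0 a2 e) a1 a2]
    · obtain ⟨x, hx⟩ := Finset.card_pos.1 (show 0 < (M \ trace G K u).card by omega)
      exact ⟨x, hsub x hx, fun r' hr' hr0 a2 e => hr ⟨r', hr', conf x hx r' hr' hr0 a2 e, a2⟩⟩

/-- Colouring when any two maximal traces cover `K`. -/
lemma colorable_of_covering
    (h0 : ∀ u ∉ K, ∀ v ∉ K, trace G K u = ∅ → trace G K v = ∅ → ¬ G.Adj u v)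
    (hcov : ∀ M N, IsTop G K M → IsTop G K N → M ≠ N → M ∪ N = K) :
    G.Colorable (K.card + 1) := by
  have hs : ∀ M, ∃ s a b : V, IsTop G K M → s ∈ M ∧ a ∈ K \ M ∧ b ∈ K \ M ∧
      (1 < (K \ M).card → a ≠ b) := by
    intro M
    by_cases hM : IsTop G K M
    · obtain ⟨s, hs⟩ := hM.nonempty
      obtain ⟨w, hw⟩ := hM.inhabited
      obtain ⟨hw, ew⟩ := mem_cl.1 hw
      by_cases q : 1 < (K \ M).card
      · obtain ⟨a, ha, b, hb, hne⟩ := Finset.one_lt_card.1 q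
        exact ⟨s, a, b, fun _ => ⟨hs, ha, hb, fun _ => hne⟩⟩
      · obtain ⟨a, ha, ha'⟩ := h.exists_not_mem_trace hw
        rw [ew] at ha'
        have := Finset.mem_sdiff.2 ⟨ha, ha'⟩
        exact ⟨s, a, a, fun _ => ⟨hs, this, this, fun q' => absurd q' q⟩⟩
    · obtain ⟨s, -⟩ := Finset.card_pos.1 h.card_pos
      exact ⟨s, s, s, fun q => absurd q hM⟩
  choose s a b hab using hs
  have hC : ∀ M, ∃ C, IsTop G K M → C ⊆ K \ M ∧ nu G (cl G K M) ≤ C.card ∧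
      ∀ y, M = {y} → IsTop G K (K.erase y) → Split G K (K.erase y) → s (K.erase y) ∉ C := by
    intro M
    by_cases q : ∃ y, M = {y} ∧ IsTop G K M ∧ IsTop G K (K.erase y) ∧ Split G K (K.erase y)
    · obtain ⟨y, rfl, hM, hN, hs⟩ := q
      have hy : y ∈ K := hM.subset (Finset.mem_singleton_self y)
      refine ⟨(K \ {y}).erase (s (K.erase y)), fun _ => ⟨Finset.erase_subset _ _, ?_, ?_⟩⟩
      · have h1 := h.nu_singleton_add_two_le hy hN hs
        rw [Finset.sdiff_singleton_eq_erase, Finset.card_erase_of_mem (hab _ hN).1,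
          Finset.card_erase_of_mem hy]
        omega
      · intro z hz _ _
        rw [Finset.singleton_inj.1 hz]
        exact Finset.notMem_erase _ _
    · refine ⟨K \ M, fun hM => ⟨subset_rfl, ?_, fun y e h1 h2 => absurd ⟨y, e, hM, h1, h2⟩ q⟩⟩
      rw [Finset.card_sdiff_of_subset hM.subset]
      have := h.nu_add_card_le hM.subset
      omega
  choose C hC using hC
  have hf : ∀ M, ∃ f : V → V, IsTop G K M → (∀ v ∈ cl G K M, f v ∈ C M) ∧
      ∀ u ∈ cl G K M, ∀ v ∈ cl G K M, G.Adj u v → f u ≠ f v := by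
    intro M
    by_cases hM : IsTop G K M
    · obtain ⟨f, hf⟩ := (h.isCluster_cl M).exists_coloring (hC M hM).2.1
      exact ⟨f, fun _ => hf⟩
    · exact ⟨id, fun q => absurd q hM⟩
  choose f hf using hf
  have htop : ∀ v, ∃ M, v ∉ K → trace G K v ≠ ∅ → IsTop G K M ∧ trace G K v ⊆ M := by
    intro v
    by_cases q : v ∉ K ∧ trace G K v ≠ ∅
    · obtain ⟨M, hM⟩ := exists_isTop q.1 (Finset.nonempty_iff_ne_empty.2 q.2)
      exact ⟨M, fun _ _ => hM⟩
    · exact ⟨∅, fun q1 q2 => absurd ⟨q1, q2⟩ q⟩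
  choose top htop using htop
  let F : V → V := fun v => if trace G K v = top v then f (top v) v else
    if s (top v) ∈ trace G K v then a (top v) else b (top v)
  have hF : ∀ v, v ∉ K → trace G K v ≠ ∅ → F v ∈ K \ top v := by
    intro v hv hne
    obtain ⟨hM, hs⟩ := htop v hv hne
    simp only [F]
    split_ifs with q1 q2
    · exact (hC _ hM).1 ((hf _ hM).1 v (mem_cl.2 ⟨hv, q1⟩))
    · exact (hab _ hM).2.1
    · exact (hab _ hM).2.2.1
  suffices hrec : ∃ f' : V → V, (∀ v, (v ∉ K ∧ trace G K v ≠ ∅) → f' v ∈ K \ trace G K v) ∧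
      ∀ u v, (u ∉ K ∧ trace G K u ≠ ∅) → (v ∉ K ∧ trace G K v ≠ ∅) → G.Adj u v → f' u ≠ f' v by
    obtain ⟨f', h1, h2⟩ := hrec
    refine colorable_of_coloring (fun v => v ∉ K ∧ trace G K v = ∅) f' ?_ ?_ ?_
    · exact fun u v hu hv => h0 u hu.1 v hv.1 hu.2 hv.2
    · exact fun v hv hE => h1 v ⟨hv, fun q => hE ⟨hv, q⟩⟩
    · exact fun u v hu hv hEu hEv =>
        h2 u v ⟨hu, fun q => hEu ⟨hu, q⟩⟩ ⟨hv, fun q => hEv ⟨hv, q⟩⟩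
  refine exists_recoloring (fun v => v ∉ K ∧ trace G K v ≠ ∅) (fun v => K \ trace G K v)
    (Finset.univ.filter fun v => Recolored G K (top v) (s (top v)) v) F ?_ ?_ ?_
  · rintro v ⟨hv, hne⟩
    exact Finset.sdiff_subset_sdiff subset_rfl (htop v hv hne).2 (hF v hv hne)
  · rintro u v ⟨hu, hu0⟩ ⟨hv, hv0⟩ hus hvs adj e
    simp only [Finset.mem_filter, Finset.mem_univ, true_and] at hus hvs
    have hu1 := Finset.nonempty_iff_ne_empty.2 hu0
    have hv1 := Finset.nonempty_iff_ne_empty.2 hv0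
    obtain ⟨hM, hsM⟩ := htop u hu hu0
    obtain ⟨hN, hsN⟩ := htop v hv hv0
    have et : top u = top v := by
      by_contra c
      have c1 := Finset.mem_sdiff.1 (hF u hu hu0)
      have c2 := Finset.mem_sdiff.1 (hF v hv hv0)
      rw [← e] at c2
      have c3 := c1.1
      rw [← hcov _ _ hM hN c, Finset.mem_union] at c3
      tauto
    by_cases q1 : trace G K u = top u <;> by_cases q2 : trace G K v = top v
    · simp only [F, q1, q2, if_true] at e
      rw [← et] at e
      exact (hf _ hM).2 u (mem_cl.2 ⟨hu, q1⟩) v (mem_cl.2 ⟨hv, q2.trans et.symm⟩) adj e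
    · exact absurd adj.symm (h.not_adj_of_ssubset hu hv1
        (by rw [q1, et]; exact hsN.ssubset_of_ne q2))
    · exact absurd adj (h.not_adj_of_ssubset hv hu1
        (by rw [q2, ← et]; exact hsM.ssubset_of_ne q1))
    · have c1 := hsM.ssubset_of_ne q1
      have c2 := hsN.ssubset_of_ne q2
      rw [← et] at c2
      obtain ⟨w, hw⟩ := hM.inhabited
      rw [mem_cl] at hw
      have h1 := h.eq_union_of_adj_below hw.1 hu1 hv1 (hw.2 ▸ c1) (hw.2 ▸ c2) adj
      rw [hw.2] at h1
      have h2 := hab _ hM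
      by_cases hc : 1 < (K \ top u).card
      · have h3 := h2.2.2.2 hc
        have h4 := (Finset.ext_iff.1 h1.1 (s (top u))).1 h2.1
        rw [Finset.mem_union] at h4
        rw [← et] at q2
        simp only [F, q1, if_false, ← et, q2] at e
        have h5 := Finset.disjoint_left.1 h1.2
        rcases h4 with h4 | h4
        · rw [if_pos h4, if_neg (h5 h4)] at e
          exact h3 e
        · rw [if_pos h4, if_neg (fun q => h5 q h4)] at e
          exact h3 e.symm
      · have hc1 : (K \ top u).card = 1 := by
          have := Finset.card_pos.2 ⟨_, h2.2.1⟩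
          omega
        rcases recolored_or hM h2.1 hc1 hu hv hu1 hv1 c1 c2 h1.1 h1.2 adj with q | q
        · exact hus q
        · exact hvs (et ▸ q)
  · intro u hu g hg1 hg2
    simp only [Finset.mem_filter, Finset.mem_univ, true_and] at hu hg2
    obtain ⟨x, hx, hx'⟩ := h.exists_color_of_recolored (hab _ hu.top).1 hu g
      (fun v hv hne => hg1 v ⟨hv, hne⟩) (by
        intro hI r hr e
        obtain ⟨y, ey⟩ := Finset.card_eq_one.1 hu.card
        rw [ey] at hI hr
        obtain ⟨hr, er⟩ := mem_cl.1 hr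
        have eM : top u = K.erase y := by
          rw [← Finset.sdiff_singleton_eq_erase, ← ey, Finset.sdiff_sdiff_eq_self hu.top.subset]
        have hne : trace G K r ≠ ∅ := by rw [er]; exact Finset.singleton_ne_empty y
        have et : trace G K r = top r := by
          obtain ⟨hN, hsN⟩ := htop r hr hne
          rw [er] at hsN ⊢
          obtain ⟨v, hv⟩ := hN.inhabited
          obtain ⟨hv, ev⟩ := mem_cl.1 hv
          exact (hI.maximal v hv (ev ▸ hsN)).symm.trans ev
        rw [hg2 r (fun q => by rw [← et] at q; exact q.below.2 subset_rfl)] at e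
        have h3 : F r = f (top r) r := if_pos et
        have h4 := htop r hr hne
        have h5 := (hf _ h4.1).1 r (mem_cl.2 ⟨hr, et⟩)
        rw [← h3, e, ← et, er] at h5
        refine (hC {y} hI).2.2 y rfl (eM ▸ hu.top) ?_ (eM ▸ h5)
        obtain ⟨q, hq, a', eq⟩ := hu.edge
        rw [← eM]
        refine ⟨u, hu.not_mem, q, hq, hu.nonempty, ?_, hu.below, ?_, a'⟩
        · rw [eq]
          exact Finset.sdiff_nonempty.2 hu.below.2
        · rw [eq]
          refine Finset.sdiff_subset.ssubset_of_ne fun e' => ?_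
          obtain ⟨z, hz⟩ := hu.nonempty
          have := hu.below.1 hz
          rw [← e'] at this
          exact (Finset.mem_sdiff.1 this).2 hz)
    exact ⟨x, hx, fun r hr => hx' r hr.1 hr.2⟩

end Setup
end CoveringColoring

section Live

variable {V : Type*} {G : SimpleGraph V} {K : Finset V}

/-- A vertex outside `K` whose trace is nonempty and misses at least two vertices of `K`. -/
structure Small (G : SimpleGraph V) (K : Finset V) (u : V) : Prop where
  not_mem : u ∉ K
  nonempty : (trace G K u).Nonempty
  card : (trace G K u).card + 2 ≤ K.card

/-- A vertex with empty trace that has a neighbour with empty trace. -/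
structure Live (G : SimpleGraph V) (K : Finset V) (t : V) : Prop where
  not_mem : t ∉ K
  trace_eq : trace G K t = ∅
  edge : ∃ t' ∉ K, trace G K t' = ∅ ∧ G.Adj t t'

namespace Setup

variable (h : Setup G K)
include h

lemma exists_trace_eq_erase {v : V} (hv : v ∉ K) (hne : (trace G K v).Nonempty)
    (hs : ¬ Small G K v) : ∃ x ∈ K, trace G K v = K.erase x := by
  have h1 := h.card_trace_lt hv
  have h2 : ¬ (trace G K v).card + 2 ≤ K.card := fun q => hs ⟨hv, hne, q⟩
  have h3 : (K \ trace G K v).card = 1 := by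
    rw [Finset.card_sdiff_of_subset (trace_subset v)]
    omega
  obtain ⟨x, hx⟩ := Finset.card_eq_one.1 h3
  refine ⟨x, (Finset.mem_sdiff.1 (hx ▸ Finset.mem_singleton_self x)).1, ?_⟩
  rw [← Finset.sdiff_singleton_eq_erase, ← hx, Finset.sdiff_sdiff_eq_self (trace_subset v)]

/-- A `P3` through vertices whose traces lie in that of a small vertex is impossible. -/
lemma not_p3_of_small {u x y z : V} (hu : Small G K u) (h1 : G.Adj x y) (h2 : G.Adj y z)
    (h3 : ¬ G.Adj x z) (hne : x ≠ z) (hx : trace G K x ⊆ trace G K u)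
    (hy : trace G K y ⊆ trace G K u) (hz : trace G K z ⊆ trace G K u) : False := by
  have := h.card_le_of_p3 (trace_subset u) h1 h2 h3 hne hx hy hz
  have := hu.card
  omega

lemma adj_live {u t : V} (hu : Small G K u) (ht : Live G K t) : G.Adj u t := by
  obtain ⟨t', ht', et', a⟩ := ht.edge
  have et := ht.trace_eq
  obtain ⟨s, hs⟩ := hu.nonempty
  obtain ⟨b, hb, hb'⟩ := h.exists_not_mem_trace hu.not_mem
  by_contra c
  have c' : ¬ G.Adj u t' := fun q =>
    h.not_p3_of_small hu a q.symm (fun q' => c q'.symm) (fun e => hu.nonempty.ne_empty (e ▸ et))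
      (et ▸ Finset.empty_subset _) (et' ▸ Finset.empty_subset _) subset_rfl
  rcases h.anticomplete_edge hu.not_mem a c c' with q | q
  · rw [et, et', Finset.empty_union, Finset.subset_empty] at q
    exact hu.nonempty.ne_empty q
  · rw [et, et', Finset.empty_union, Finset.union_empty] at q
    exact hb' (q hb)

lemma live_adj_live {u t t' : V} (hu : Small G K u) (ht : Live G K t) (ht' : Live G K t')
    (hne : t ≠ t') : G.Adj t t' := by
  by_contra c
  exact h.not_p3_of_small hu (h.adj_live hu ht).symm (h.adj_live hu ht') c hne
    (ht.trace_eq ▸ Finset.empty_subset _) subset_rfl (ht'.trace_eq ▸ Finset.empty_subset _)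

lemma live_of_adj {u t i : V} (hu : Small G K u) (ht : Live G K t) (hi : i ∉ K)
    (ei : trace G K i = ∅) (a : G.Adj u i) : Live G K i := by
  by_cases e : t = i
  · exact e ▸ ht
  by_contra c
  refine h.not_p3_of_small hu (h.adj_live hu ht).symm a
    (fun q => c ⟨hi, ei, t, ht.not_mem, ht.trace_eq, q.symm⟩) e
    (ht.trace_eq ▸ Finset.empty_subset _) subset_rfl (ei ▸ Finset.empty_subset _)

lemma card_le_of_small_not_adj {u q t : V} (hu : Small G K u) (hq : Small G K q)
    (ht : Live G K t) (hne : u ≠ q) (c : ¬ G.Adj u q) :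
    K.card ≤ (trace G K u ∪ trace G K q).card + 1 :=
  h.card_le_of_p3 (Finset.union_subset (trace_subset u) (trace_subset q)) (h.adj_live hu ht)
    (h.adj_live hq ht).symm c hne Finset.subset_union_left
    (ht.trace_eq ▸ Finset.empty_subset _) Finset.subset_union_right

lemma small_adj_of_trace_eq {u q t : V} (hu : Small G K u) (hq : Small G K q)
    (ht : Live G K t) (hne : u ≠ q) (e : trace G K u = trace G K q) : G.Adj u q := by
  by_contra c
  have := h.card_le_of_small_not_adj hu hq ht hne c
  rw [← e, Finset.union_self] at this
  have := hu.card
  omega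

/-- Adjacent vertices with a common neighbour of empty trace have equal or disjoint traces. -/
lemma disjoint_of_common {u q t : V} (et : trace G K t = ∅) (a : G.Adj u q) (hu : G.Adj t u)
    (hq : G.Adj t q) (hne : trace G K u ≠ trace G K q) :
    Disjoint (trace G K u) (trace G K q) := by
  by_contra hd
  obtain ⟨c, hcu, hcq⟩ := Finset.not_disjoint_iff.1 hd
  by_cases h1 : trace G K q ⊆ trace G K u
  · obtain ⟨x, hx, hx'⟩ := Finset.exists_of_ssubset (h1.ssubset_of_ne hne.symm)
    exact h.no_common_of_cross et a.symm hcq hcu hx hx' hq hu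
  · obtain ⟨x, hx, hx'⟩ := Finset.not_subset.1 h1
    exact h.no_common_of_cross et a hcu hcq hx hx' hu hq

lemma small_disjoint {u q t : V} (hu : Small G K u) (hq : Small G K q)
    (ht : Live G K t) (hne : trace G K u ≠ trace G K q) :
    Disjoint (trace G K u) (trace G K q) := by
  by_cases a : G.Adj u q
  · exact h.disjoint_of_common ht.trace_eq a (h.adj_live hu ht).symm (h.adj_live hq ht).symm hne
  · by_contra hd
    obtain ⟨c, hcu, hcq⟩ := Finset.not_disjoint_iff.1 hd
    have h1 := h.card_le_of_small_not_adj hu hq ht (fun e => hne (e ▸ rfl)) a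
    have h2 := hu.card
    have h3 := hq.card
    rcases h.nested_of_not_adj a hcu hcq with q | q
    · rw [Finset.union_eq_right.2 q] at h1
      omega
    · rw [Finset.union_eq_left.2 q] at h1
      omega

lemma small_adj_congr {u u' q t : V} (hu : Small G K u) (hu' : Small G K u') (hq : Small G K q)
    (ht : Live G K t) (e : trace G K u = trace G K u') (hne : trace G K u ≠ trace G K q)
    (a : G.Adj u q) : G.Adj u' q := by
  rcases eq_or_ne u u' with rfl | hne'
  · exact a
  by_contra c
  obtain ⟨s, hs⟩ := hu.nonempty
  have hs' : s ∈ trace G K u' := e ▸ hs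
  have hd := Finset.disjoint_left.1 (h.small_disjoint hu hq ht hne) hs
  have hsK := (mem_trace.1 hs).1
  refine h.gem u s u' t q (mem_trace.1 hs').2.symm (h.adj_live hu' ht) (h.adj_live hq ht).symm ?_ ?_ c
    (mem_trace.1 hs).2 (h.small_adj_of_trace_eq hu hu' ht hne' e) (h.adj_live hu ht) a
  · intro a'
    have : s ∈ trace G K t := mem_trace.2 ⟨hsK, a'.symm⟩
    rw [ht.trace_eq] at this
    simp at this
  · exact fun a' => hd (mem_trace.2 ⟨hsK, a'.symm⟩)

lemma eq_of_small_not_adj {u u' q t : V} (hu : Small G K u) (hu' : Small G K u')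
    (hq : Small G K q) (ht : Live G K t) (e : trace G K u = trace G K u')
    (hne : trace G K u ≠ trace G K q) (c : ¬ G.Adj u q)
    (hU : trace G K u ∪ trace G K q ≠ K) : u = u' := by
  by_contra hne'
  have c' : ¬ G.Adj u' q := fun a =>
    c (h.small_adj_congr hu' hu hq ht e.symm (e ▸ hne) a)
  have hd := h.small_disjoint hu hq ht hne
  obtain ⟨x, hx⟩ := hq.nonempty
  rcases h.anticomplete_edge hq.not_mem (h.small_adj_of_trace_eq hu hu' ht hne' e)
    (fun a => c a.symm) (fun a => c' a.symm) with p | p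
  · rw [← e, Finset.union_self] at p
    exact Finset.disjoint_right.1 hd hx (p hx)
  · rw [← e, Finset.union_self, Finset.union_comm] at p
    exact hU (subset_antisymm (Finset.union_subset (trace_subset _) (trace_subset _)) p)

lemma adj_or_adj_of_empty {w t t' : V} (hw : w ∉ K) (hne : (trace G K w).Nonempty)
    (et : trace G K t = ∅) (et' : trace G K t' = ∅) (a : G.Adj t t') :
    G.Adj w t ∨ G.Adj w t' := by
  by_contra! c
  rcases h.anticomplete_edge hw a c.1 c.2 with q | q
  · rw [et, et', Finset.empty_union, Finset.subset_empty] at q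
    exact hne.ne_empty q
  · rw [et, et', Finset.empty_union, Finset.union_empty] at q
    exact h.trace_ne hw (subset_antisymm (trace_subset w) q)

lemma erase_nonempty (x : V) : (K.erase x).Nonempty := by
  have h1 := h.four
  have h2 := Finset.pred_card_le_card_erase (s := K) (a := x)
  exact Finset.card_pos.1 (by omega)

lemma small_trace_eq_singleton {w u t x : V} (hw : w ∉ K) (ew : trace G K w = K.erase x)
    (hu : Small G K u) (ht : Live G K t) (hx : x ∈ trace G K u) : trace G K u = {x} := by
  obtain ⟨t', ht', et', a⟩ := ht.edge
  have hl' : Live G K t' := ⟨ht', et', t, ht.not_mem, ht.trace_eq, a.symm⟩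
  by_contra hne
  obtain ⟨z, hz, hzx⟩ : ∃ z ∈ trace G K u, z ≠ x := by
    by_contra! c
    exact hne (Finset.eq_singleton_iff_unique_mem.2 ⟨hx, c⟩)
  have hzw : z ∈ trace G K w := ew ▸ Finset.mem_erase.2 ⟨hzx, trace_subset u hz⟩
  have hxw : x ∉ trace G K w := ew ▸ Finset.notMem_erase x K
  have hwne : (trace G K w).Nonempty := ⟨z, hzw⟩
  have hc := Finset.card_erase_of_mem (trace_subset u hx)
  rw [← ew] at hc
  have huc := hu.card
  have hadj : G.Adj w u := by
    by_contra c
    rcases h.nested_of_not_adj c hzw hz with q | q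
    · have := Finset.card_le_card q
      omega
    · exact hxw (q hx)
  have hnd : ∀ s, Live G K s → ¬ G.Adj w s := fun s hs a' => by
    refine Finset.not_disjoint_iff.2 ⟨z, hzw, hz⟩ (h.disjoint_of_common hs.trace_eq hadj a'.symm
      (h.adj_live hu hs).symm (fun e => hxw (e ▸ hx)))
  rcases h.adj_or_adj_of_empty hw hwne ht.trace_eq et' a with q | q
  · exact hnd t ht q
  · exact hnd t' hl' q

lemma adj_of_erase {w w' x y : V} (hx : x ∈ K) (hy : y ∈ K) (ew : trace G K w = K.erase x)
    (ew' : trace G K w' = K.erase y) (hne : x ≠ y) :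
    G.Adj w w' ∧ ¬ Disjoint (trace G K w) (trace G K w') ∧ trace G K w ≠ trace G K w' := by
  have h1 : ¬ K.erase x ⊆ K.erase y := fun q =>
    Finset.notMem_erase y K (q (Finset.mem_erase.2 ⟨hne.symm, hy⟩))
  have h2 : ¬ K.erase y ⊆ K.erase x := fun q =>
    Finset.notMem_erase x K (q (Finset.mem_erase.2 ⟨hne, hx⟩))
  have h3 : ¬ Disjoint (K.erase x) (K.erase y) := by
    have := h.four
    have c : 0 < ((K.erase x).erase y).card := by
      have := Finset.pred_card_le_card_erase (s := K) (a := x)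
      have := Finset.pred_card_le_card_erase (s := K.erase x) (a := y)
      omega
    obtain ⟨z, hz⟩ := Finset.card_pos.1 c
    simp only [Finset.mem_erase] at hz
    exact Finset.not_disjoint_iff.2 ⟨z, Finset.mem_erase.2 hz.2, Finset.mem_erase.2 ⟨hz.1, hz.2.2⟩⟩
  have h4 := h.cross_free w w'
  rw [ew, ew'] at h4 ⊢
  exact ⟨by tauto, h3, fun e => h1 e.le⟩

lemma not_common_of_erase {w w' x y t : V} (hx : x ∈ K) (hy : y ∈ K)
    (ew : trace G K w = K.erase x) (ew' : trace G K w' = K.erase y) (hne : x ≠ y)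
    (et : trace G K t = ∅) (a : G.Adj w t) (a' : G.Adj w' t) : False := by
  obtain ⟨h1, h2, h3⟩ := h.adj_of_erase hx hy ew ew' hne
  exact h2 (h.disjoint_of_common et h1 a.symm a'.symm h3)

/-- A small vertex forces all large traces to be equal. -/
lemma erase_unique {w w' u t x y : V} (hu : Small G K u) (ht : Live G K t) (hw : w ∉ K)
    (hw' : w' ∉ K) (hx : x ∈ K) (hy : y ∈ K) (ew : trace G K w = K.erase x)
    (ew' : trace G K w' = K.erase y) : x = y := by
  by_contra hne
  have main : ∀ w w' x y, w ∉ K → w' ∉ K → x ∈ K → y ∈ K → trace G K w = K.erase x →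
      trace G K w' = K.erase y → x ≠ y → y ∉ trace G K u → False := by
    intro w w' x y hw hw' hx hy ew ew' hne hyu
    obtain ⟨t', ht', et', a⟩ := ht.edge
    have hl' : Live G K t' := ⟨ht', et', t, ht.not_mem, ht.trace_eq, a.symm⟩
    have hsub : trace G K u ⊆ trace G K w' := by
      rw [ew']
      exact Finset.subset_erase.2 ⟨trace_subset u, hyu⟩
    have hss : trace G K u ⊂ trace G K w' := by
      refine hsub.ssubset_of_ne fun e => ?_
      have h1 := hu.card
      rw [e, ew', Finset.card_erase_of_mem hy] at h1
      omega
    have hna := h.not_adj_of_ssubset hw' hu.nonempty hss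
    have hadj : ∀ s, Live G K s → G.Adj w' s := by
      intro s hs
      by_contra c
      rcases h.anticomplete_edge hw' (h.adj_live hu hs) (fun q => hna q.symm) c with q | q
      · rw [hs.trace_eq, Finset.union_empty] at q
        exact hss.2 q
      · rw [hs.trace_eq, Finset.union_empty, Finset.union_eq_left.2 hsub] at q
        exact h.trace_ne hw' (subset_antisymm (trace_subset w') q)
    rcases h.adj_or_adj_of_empty hw (ew ▸ h.erase_nonempty x) ht.trace_eq et' a with q | q
    · exact h.not_common_of_erase hx hy ew ew' hne ht.trace_eq q (hadj t ht)
    · exact h.not_common_of_erase hx hy ew ew' hne et' q (hadj t' hl')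
  by_cases c : y ∈ trace G K u
  · by_cases c' : x ∈ trace G K u
    · have e := h.small_trace_eq_singleton hw ew hu ht c'
      rw [e, Finset.mem_singleton] at c
      exact hne c.symm
    · exact main w' w y x hw' hw hy hx ew' ew (fun e => hne e.symm) c'
  · exact main w w' x y hw hw' hx hy ew ew' hne c

end Setup
end Live

section LiveColoring

variable {V : Type*} [Fintype V] {G : SimpleGraph V} {K : Finset V}

omit [Fintype V] in
lemma Live.exists_adj {t : V} (ht : Live G K t) :
    ∃ t', Live G K t' ∧ G.Adj t t' := by
  obtain ⟨t', h1, h2, a⟩ := ht.edge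
  exact ⟨t', ⟨h1, h2, t, ht.not_mem, ht.trace_eq, a.symm⟩, a⟩

omit [Fintype V] in
lemma Small.congr {u v : V} (hu : Small G K u) (hv : v ∉ K)
    (e : trace G K v = trace G K u) : Small G K v :=
  ⟨hv, e ▸ hu.nonempty, e ▸ hu.card⟩

namespace Setup

variable (h : Setup G K)
include h

omit h [Fintype V] in
/-- Colouring `G` by palettes assigned to disjoint subsets of `K`. -/
lemma colorable_of_clusters (E : V → Prop) (hE : ∀ u v, E u → E v → ¬ G.Adj u v)
    (I : Finset (Finset V)) (n : Finset V → ℕ) (hI : ∀ i ∈ I, i ⊆ K)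
    (hd : ∀ i ∈ I, ∀ j ∈ I, i ≠ j → Disjoint i j) (hn : ∀ i ∈ I, n i + i.card ≤ K.card)
    (hs : ∑ i ∈ I, n i ≤ K.card) (g : V → Finset V)
    (hg : ∀ v ∉ K, ¬ E v → g v ∈ I ∧ trace G K v ⊆ g v)
    (hc : ∀ i ∈ I, ∃ s : Finset V, (∀ v ∉ K, ¬ E v → g v = i → v ∈ s) ∧ IsCluster G s ∧
      nu G s ≤ n i) : G.Colorable (K.card + 1) := by
  obtain ⟨C, hC1, hC2⟩ := exists_palettes I id n hI hd hn hs
  have hf : ∀ i, ∃ f : V → V, i ∈ I → (∀ v ∉ K, ¬ E v → g v = i → f v ∈ C i) ∧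
      ∀ u ∉ K, ¬ E u → g u = i → ∀ v ∉ K, ¬ E v → g v = i → G.Adj u v → f u ≠ f v := by
    intro i
    by_cases hi : i ∈ I
    · obtain ⟨s, hs1, hs2, hs3⟩ := hc i hi
      obtain ⟨f, hf1, hf2⟩ := hs2.exists_coloring (C := C i) (by rw [(hC1 i hi).2]; exact hs3)
      exact ⟨f, fun _ => ⟨fun v h1 h2 h3 => hf1 v (hs1 v h1 h2 h3),
        fun u h1 h2 h3 v h4 h5 h6 => hf2 u (hs1 u h1 h2 h3) v (hs1 v h4 h5 h6)⟩⟩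
    · exact ⟨id, fun q => absurd q hi⟩
  choose f hf using hf
  refine colorable_of_coloring E (fun v => f (g v) v) hE ?_ ?_
  · intro v hv hEv
    obtain ⟨h1, h2⟩ := hg v hv hEv
    have h3 := (hC1 _ h1).1 ((hf _ h1).1 v hv hEv rfl)
    rw [Finset.mem_sdiff] at h3 ⊢
    exact ⟨h3.1, fun q => h3.2 (h2 q)⟩
  · intro u v hu hv hEu hEv a e
    obtain ⟨h1, -⟩ := hg u hu hEu
    obtain ⟨h2, -⟩ := hg v hv hEv
    rcases eq_or_ne (g u) (g v) with q | q
    · refine (hf _ h1).2 u hu hEu rfl v hv hEv q.symm a ?_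
      rw [e, q]
    · exact Finset.disjoint_left.1 (hC2 _ h1 _ h2 q) ((hf _ h1).1 u hu hEu rfl)
        (by rw [e]; exact (hf _ h2).1 v hv hEv rfl)

lemma not_adj_of_trace_eq_erase {u v x : V} (hu : u ∉ K) (hv : v ∉ K) (hx : x ∈ K)
    (eu : trace G K u = K.erase x) (ev : trace G K v = K.erase x) : ¬ G.Adj u v := by
  intro a
  have h1 := h.nu_add_card_le (Finset.erase_subset x K)
  have h2 := two_le_nu (mem_cl.2 ⟨hu, eu⟩) (mem_cl.2 ⟨hv, ev⟩) a
  rw [Finset.card_erase_of_mem hx] at h1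
  have := h.four
  omega

omit h in
lemma exists_live_clique {t : V} (ht : Live G K t) :
    ∃ Q : Finset V, (∀ v ∈ Q, Live G K v) ∧ PairwiseAdj G Q ∧ Q.card = nu G (cl G K ∅) := by
  obtain ⟨Q, hQ, hc, e⟩ := exists_card_eq_nu G (cl G K ∅)
  obtain ⟨t', ht', a⟩ := ht.exists_adj
  have h2 := two_le_nu (mem_cl.2 ⟨ht.not_mem, ht.trace_eq⟩) (mem_cl.2 ⟨ht'.not_mem, ht'.trace_eq⟩) a
  refine ⟨Q, fun v hv => ?_, hc, e⟩
  obtain ⟨v', hv', hne⟩ := Finset.exists_mem_ne (show 1 < Q.card by omega) v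
  have q := mem_cl.1 (hQ hv)
  have q' := mem_cl.1 (hQ hv')
  exact ⟨q.1, q.2, v', q'.1, q'.2, hc v hv v' hv' hne.symm⟩

/-- The case where small vertices with distinct traces are adjacent. -/
lemma colorable_of_small_complete {t : V} (ht : Live G K t)
    (he : ∀ w ∉ K, ∀ w' ∉ K, ∀ x ∈ K, ∀ y ∈ K, trace G K w = K.erase x →
      trace G K w' = K.erase y → x = y)
    (ha : ∀ u q, Small G K u → Small G K q → trace G K u ≠ trace G K q → G.Adj u q) :
    G.Colorable (K.card + 1) := by
  let I : Finset (Finset V) := insert ∅ ((Finset.univ.filter (Small G K)).image (trace G K))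
  have hI : ∀ i ∈ I, i ≠ ∅ → ∃ u, Small G K u ∧ trace G K u = i := by
    intro i hi hne
    simpa [I, hne] using hi
  have hIK : ∀ i ∈ I, i ⊆ K := by
    intro i hi
    rcases eq_or_ne i ∅ with rfl | hne
    · exact Finset.empty_subset _
    · obtain ⟨u, -, rfl⟩ := hI i hi hne
      exact trace_subset u
  obtain ⟨Q0, hQ0, cQ0, eQ0⟩ := exists_live_clique ht
  choose Q hQ cQ eQ using fun i => exists_card_eq_nu G (cl G K i)
  let P : Finset V → Finset V := fun i => if i = ∅ then Q0 else Q i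
  have eP : ∀ i, (P i).card = nu G (cl G K i) := by
    intro i
    by_cases hi : i = ∅
    · simp [P, hi, eQ0]
    · simp [P, hi, eQ]
  have hP : ∀ i ∈ I, i ≠ ∅ → ∀ v ∈ P i, Small G K v ∧ trace G K v = i := by
    intro i hi hne v hv
    obtain ⟨u, hu, e⟩ := hI i hi hne
    have hv' := mem_cl.1 (hQ i (by simpa [P, hne] using hv))
    exact ⟨hu.congr hv'.1 (hv'.2.trans e.symm), hv'.2⟩
  have hP0 : ∀ v ∈ P ∅, Live G K v := by simpa [P] using hQ0
  refine colorable_of_clusters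
    (fun v => v ∉ K ∧ (trace G K v).Nonempty ∧ ¬ Small G K v) ?_ I (fun i => nu G (cl G K i))
    hIK ?_ (fun i hi => h.nu_add_card_le (hIK i hi)) ?_ (trace G K) ?_ ?_
  · rintro u v ⟨hu, hu1, hu2⟩ ⟨hv, hv1, hv2⟩
    obtain ⟨x, hx, ex⟩ := h.exists_trace_eq_erase hu hu1 hu2
    obtain ⟨y, hy, ey⟩ := h.exists_trace_eq_erase hv hv1 hv2
    obtain rfl := he u hu v hv x hx y hy ex ey
    exact h.not_adj_of_trace_eq_erase hu hv hx ex ey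
  · intro i hi j hj hne
    rcases eq_or_ne i ∅ with rfl | hi0
    · exact Finset.disjoint_empty_left _
    rcases eq_or_ne j ∅ with rfl | hj0
    · exact Finset.disjoint_empty_right _
    obtain ⟨u, hu, rfl⟩ := hI i hi hi0
    obtain ⟨v, hv, rfl⟩ := hI j hj hj0
    exact h.small_disjoint hu hv ht hne
  · simp only [← eP]
    refine sum_card_le h.max I P ?_ ?_
    · intro i _
      by_cases q : i = ∅
      · simpa [P, q] using cQ0
      · simpa [P, q] using cQ i
    · intro i hi j hj hne x hx y hy
      rcases eq_or_ne i ∅ with rfl | hi0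
      · exact (h.adj_live (hP j hj hne.symm y hy).1 (hP0 x hx)).symm
      rcases eq_or_ne j ∅ with rfl | hj0
      · exact h.adj_live (hP i hi hne x hx).1 (hP0 y hy)
      obtain ⟨h1, e1⟩ := hP i hi hi0 x hx
      obtain ⟨h2, e2⟩ := hP j hj hj0 y hy
      exact ha x y h1 h2 (by rwa [e1, e2])
  · intro v hv hE
    refine ⟨?_, subset_rfl⟩
    rcases (trace G K v).eq_empty_or_nonempty with q | q
    · simp [I, q]
    · have : Small G K v := by
        by_contra c
        exact hE ⟨hv, q, c⟩
      exact Finset.mem_insert_of_mem (Finset.mem_image_of_mem _ (by simpa using this))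
  · intro i _
    exact ⟨cl G K i, fun v hv _ e => mem_cl.2 ⟨hv, e⟩, h.isCluster_cl i, le_rfl⟩

/-- The case of two nonadjacent small vertices whose traces do not cover `K`. -/
lemma colorable_of_small_not_adj {t u q : V} (ht : Live G K t)
    (he : ∀ w ∉ K, ∀ w' ∉ K, ∀ x ∈ K, ∀ y ∈ K, trace G K w = K.erase x →
      trace G K w' = K.erase y → x = y)
    (hu : Small G K u) (hq : Small G K q) (hne : trace G K u ≠ trace G K q)
    (c : ¬ G.Adj u q) (hU : trace G K u ∪ trace G K q ≠ K) :
    G.Colorable (K.card + 1) := by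
  have h1 := h.card_le_of_small_not_adj hu hq ht (fun e => hne (e ▸ rfl)) c
  have hd := h.small_disjoint hu hq ht hne
  have hsub : trace G K u ∪ trace G K q ⊆ K :=
    Finset.union_subset (trace_subset u) (trace_subset q)
  have h2 : (K \ (trace G K u ∪ trace G K q)).card = 1 := by
    have := Finset.card_lt_card (hsub.ssubset_of_ne hU)
    rw [Finset.card_sdiff_of_subset hsub]
    omega
  obtain ⟨d, ed⟩ := Finset.card_eq_one.1 h2
  have hdm : d ∈ K \ (trace G K u ∪ trace G K q) := ed ▸ Finset.mem_singleton_self d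
  rw [Finset.mem_sdiff, Finset.mem_union, not_or] at hdm
  obtain ⟨hdK, hdu, hdq⟩ := hdm
  have hk := h.four
  have hucard : (trace G K u ∪ trace G K q).card + 1 = K.card := by
    rw [Finset.card_sdiff_of_subset hsub] at h2
    omega
  have hother : ∀ v, Small G K v → trace G K v ≠ trace G K u → trace G K v ≠ trace G K q →
      trace G K v = {d} := by
    intro v hv nu nq
    have d1 := h.small_disjoint hv hu ht nu
    have d2 := h.small_disjoint hv hq ht nq
    refine Finset.Subset.antisymm ?_ ?_
    · rw [← ed, Finset.subset_sdiff]
      exact ⟨trace_subset v, Finset.disjoint_union_right.2 ⟨d1, d2⟩⟩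
    · have : trace G K v ⊆ {d} := by
        rw [← ed, Finset.subset_sdiff]
        exact ⟨trace_subset v, Finset.disjoint_union_right.2 ⟨d1, d2⟩⟩
      rcases Finset.subset_singleton_iff.1 this with e | e
      · exact absurd e hv.nonempty.ne_empty
      · exact e.ge
  have hsd : ∀ v ∈ cl G K {d}, Small G K v := by
    intro v hv
    rw [mem_cl] at hv
    exact ⟨hv.1, hv.2 ▸ Finset.singleton_nonempty d, by rw [hv.2, Finset.card_singleton]; omega⟩
  have hneu : ∀ v ∈ cl G K {d}, trace G K v ≠ trace G K u := fun v hv e => by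
    rw [(mem_cl.1 hv).2] at e
    exact hdu (e ▸ Finset.mem_singleton_self d)
  have hneq : ∀ v ∈ cl G K {d}, trace G K v ≠ trace G K q := fun v hv e => by
    rw [(mem_cl.1 hv).2] at e
    exact hdq (e ▸ Finset.mem_singleton_self d)
  have hcomp : ∃ p, Small G K p ∧ ∀ v ∈ cl G K {d}, G.Adj p v := by
    by_contra! c'
    obtain ⟨v, hv, nv⟩ := c' u hu
    obtain ⟨v', hv', nv'⟩ := c' q hq
    have k1 := h.card_le_of_small_not_adj hu (hsd v hv) ht (fun e => hneu v hv (e ▸ rfl)) nv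
    have k2 := h.card_le_of_small_not_adj hq (hsd v' hv') ht (fun e => hneq v' hv' (e ▸ rfl)) nv'
    rw [(mem_cl.1 hv).2] at k1
    rw [(mem_cl.1 hv').2] at k2
    have l1 := Finset.card_union_le (trace G K u) {d}
    have l2 := Finset.card_union_le (trace G K q) {d}
    rw [Finset.card_singleton] at l1 l2
    rw [Finset.card_union_of_disjoint hd] at hucard
    omega
  obtain ⟨p, hp, hpd⟩ := hcomp
  obtain ⟨Q0, hQ0, cQ0, eQ0⟩ := exists_live_clique ht
  obtain ⟨Q, hQ, cQ, eQ⟩ := exists_card_eq_nu G (cl G K {d})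
  have hsum : nu G (cl G K ∅) + (1 + nu G (cl G K {d})) ≤ K.card := by
    have cpQ : PairwiseAdj G (insert p Q) := cQ.insert fun y hy => hpd y (hQ hy)
    have e : (insert p Q).card = 1 + nu G (cl G K {d}) := by
      rw [Finset.card_insert_of_notMem (fun hpQ => (hpd p (hQ hpQ)).ne rfl), eQ, add_comm]
    rw [← eQ0, ← e]
    refine h.card_add_card_le cQ0 cpQ fun x hx y hy => ?_
    rcases Finset.mem_insert.1 hy with rfl | hy
    · exact (h.adj_live hp (hQ0 x hx)).symm
    · exact (h.adj_live (hsd y (hQ hy)) (hQ0 x hx)).symm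
  have ne1 : (∅ : Finset V) ≠ trace G K u ∪ trace G K q := fun e => by
    have := hu.nonempty.mono (Finset.subset_union_left (s₂ := trace G K q))
    rw [← e] at this
    simp at this
  have ne2 : (∅ : Finset V) ≠ {d} := (Finset.singleton_ne_empty d).symm
  have ne3 : trace G K u ∪ trace G K q ≠ {d} := fun e => by
    have : d ∈ trace G K u ∪ trace G K q := e ▸ Finset.mem_singleton_self d
    rcases Finset.mem_union.1 this with r | r
    · exact hdu r
    · exact hdq r
  have dj : Disjoint (trace G K u ∪ trace G K q) {d} := by
    rw [← ed]
    exact Finset.disjoint_sdiff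
  let n : Finset V → ℕ := fun i => if i = trace G K u ∪ trace G K q then 1 else nu G (cl G K i)
  have n1 : n ∅ = nu G (cl G K ∅) := if_neg ne1
  have n2 : n (trace G K u ∪ trace G K q) = 1 := if_pos rfl
  have n3 : n {d} = nu G (cl G K {d}) := if_neg ne3.symm
  let g : V → Finset V := fun v => if trace G K v = trace G K u ∨ trace G K v = trace G K q then
    trace G K u ∪ trace G K q else trace G K v
  refine colorable_of_clusters
    (fun v => v ∉ K ∧ (trace G K v).Nonempty ∧ ¬ Small G K v) ?_
    {∅, trace G K u ∪ trace G K q, {d}} n ?_ ?_ ?_ ?_ g ?_ ?_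
  · rintro u v ⟨hu, hu1, hu2⟩ ⟨hv, hv1, hv2⟩
    obtain ⟨x, hx, ex⟩ := h.exists_trace_eq_erase hu hu1 hu2
    obtain ⟨y, hy, ey⟩ := h.exists_trace_eq_erase hv hv1 hv2
    obtain rfl := he u hu v hv x hx y hy ex ey
    exact h.not_adj_of_trace_eq_erase hu hv hx ex ey
  · simpa [hdK] using hsub
  · simp only [Finset.mem_insert, Finset.mem_singleton]
    rintro i (rfl | rfl | rfl) j (rfl | rfl | rfl) hij
    all_goals first
      | exact absurd rfl hij
      | exact Finset.disjoint_empty_left _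
      | exact Finset.disjoint_empty_right _
      | exact dj
      | exact dj.symm
  · simp only [Finset.mem_insert, Finset.mem_singleton]
    rintro i (rfl | rfl | rfl)
    · rw [n1]
      exact h.nu_add_card_le (Finset.empty_subset _)
    · rw [n2, add_comm, hucard]
    · rw [n3]
      exact h.nu_add_card_le (by simpa using hdK)
  · rw [Finset.sum_insert (by simp [ne1, ne2]), Finset.sum_insert (by simpa using ne3),
      Finset.sum_singleton, n1, n2, n3]
    exact hsum
  · intro v hv hE
    by_cases q1 : trace G K v = trace G K u ∨ trace G K v = trace G K q
    · simp only [g, q1, if_true]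
      refine ⟨by simp, ?_⟩
      rcases q1 with e | e <;> rw [e]
      · exact Finset.subset_union_left
      · exact Finset.subset_union_right
    · simp only [g, q1, if_false]
      refine ⟨?_, subset_rfl⟩
      rcases (trace G K v).eq_empty_or_nonempty with r | r
      · simp [r]
      · have hs : Small G K v := by
          by_contra c
          exact hE ⟨hv, r, c⟩
        rw [not_or] at q1
        simp [hother v hs q1.1 q1.2]
  · have hg : ∀ v ∉ K, g v ≠ trace G K u ∪ trace G K q → v ∈ cl G K (g v) := by
      intro v hv r
      by_cases q1 : trace G K v = trace G K u ∨ trace G K v = trace G K q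
      · simp [g, q1] at r
      · simp [g, q1, hv]
    simp only [Finset.mem_insert, Finset.mem_singleton]
    rintro i (rfl | rfl | rfl)
    · exact ⟨cl G K ∅, fun v hv _ e => e ▸ hg v hv (e ▸ ne1), h.isCluster_cl _, n1.ge⟩
    · have nadj : ∀ x ∈ ({u, q} : Finset V), ∀ y ∈ ({u, q} : Finset V), ¬ G.Adj x y := by
        simp [c, G.adj_comm q u]
      refine ⟨{u, q}, fun v hv hE e => ?_, fun x hx y hy z hz a => absurd a (nadj x hx y hy),
        (nu_le_one nadj).trans n2.ge⟩
      by_cases q1 : trace G K v = trace G K u ∨ trace G K v = trace G K q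
      · rcases q1 with e' | e'
        · have := h.eq_of_small_not_adj hu (hu.congr hv e') hq ht e'.symm hne c hU
          simp [this]
        · have := h.eq_of_small_not_adj hq (hq.congr hv e') hu ht e'.symm hne.symm
            (fun a => c a.symm) (by rwa [Finset.union_comm])
          simp [this]
      · simp only [g, q1, if_false] at e
        rw [not_or] at q1
        rcases (trace G K v).eq_empty_or_nonempty with r | r
        · exact absurd (r.symm.trans e) ne1
        · have hs : Small G K v := by
            by_contra c
            exact hE ⟨hv, r, c⟩
          exact absurd (e.symm.trans (hother v hs q1.1 q1.2)) ne3
    · exact ⟨cl G K {d}, fun v hv _ e => e ▸ hg v hv (e ▸ ne3.symm), h.isCluster_cl _, n3.ge⟩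

/-- The case of two different traces missing a single vertex of `K`. -/
lemma colorable_of_erase {w w' x y : V} (hw : w ∉ K) (hw' : w' ∉ K) (hx : x ∈ K) (hy : y ∈ K)
    (ew : trace G K w = K.erase x) (ew' : trace G K w' = K.erase y) (hne : x ≠ y)
    (hs : ∀ u, ¬ Small G K u) : G.Colorable (K.card + 1) := by
  have hnu : nu G (cl G K ∅) ≤ 2 := by
    obtain ⟨Q, hQ, cQ, e⟩ := exists_card_eq_nu G (cl G K ∅)
    rw [← e]
    by_contra! c
    obtain ⟨a, b, d, ha, hb, hd, hab, had, hbd⟩ := Finset.two_lt_card_iff.1 c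
    have ea := (mem_cl.1 (hQ ha)).2
    have eb := (mem_cl.1 (hQ hb)).2
    have ed := (mem_cl.1 (hQ hd)).2
    have aab := cQ a ha b hb hab
    have aad := cQ a ha d hd had
    have abd := cQ b hb d hd hbd
    have nw : (trace G K w).Nonempty := ew ▸ h.erase_nonempty x
    have nw' : (trace G K w').Nonempty := ew' ▸ h.erase_nonempty y
    have k1 := h.adj_or_adj_of_empty hw nw ea eb aab
    have k2 := h.adj_or_adj_of_empty hw nw ea ed aad
    have k3 := h.adj_or_adj_of_empty hw nw eb ed abd
    have l1 := h.adj_or_adj_of_empty hw' nw' ea eb aab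
    have l2 := h.adj_or_adj_of_empty hw' nw' ea ed aad
    have l3 := h.adj_or_adj_of_empty hw' nw' eb ed abd
    have m := fun t et => h.not_common_of_erase (t := t) hx hy ew ew' hne et
    rcases k1 with k1 | k1 <;> rcases k2 with k2 | k2 <;> rcases k3 with k3 | k3 <;>
      rcases l1 with l1 | l1 <;> rcases l2 with l2 | l2 <;> rcases l3 with l3 | l3 <;>
      first
      | exact m a ea ‹_› ‹_›
      | exact m b eb ‹_› ‹_›
      | exact m d ed ‹_› ‹_›
  obtain ⟨g, hg1, hg2⟩ := (h.isCluster_cl ∅).exists_coloring (C := {x, y})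
    (by rw [Finset.card_pair hne]; exact hnu)
  have her : ∀ v, ∃ z, v ∉ K → trace G K v ≠ ∅ → z ∈ K ∧ trace G K v = K.erase z := by
    intro v
    by_cases q : v ∉ K ∧ trace G K v ≠ ∅
    · obtain ⟨z, hz⟩ := h.exists_trace_eq_erase q.1 (Finset.nonempty_iff_ne_empty.2 q.2) (hs v)
      exact ⟨z, fun _ _ => hz⟩
    · exact ⟨x, fun q1 q2 => absurd ⟨q1, q2⟩ q⟩
  choose z hz using her
  let f : V → V := fun v => if trace G K v = ∅ then
    (if ∃ w₁ ∈ cl G K (K.erase x), G.Adj v w₁ then y else x) else z v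
  have key : ∀ u v, u ∉ K → v ∉ K → trace G K u = ∅ → trace G K v ≠ ∅ → G.Adj u v →
      f u ≠ f v := by
    intro u v hu hv eu ev a e
    obtain ⟨hzK, hzv⟩ := hz v hv ev
    by_cases q : ∃ w₁ ∈ cl G K (K.erase x), G.Adj u w₁
    · simp only [f, eu, ev, q, if_true, if_false] at e
      obtain ⟨w₁, hw₁, a₁⟩ := q
      rw [mem_cl] at hw₁
      exact h.not_common_of_erase hx hy hw₁.2 (e ▸ hzv) hne eu a₁.symm a.symm
    · simp only [f, eu, ev, q, if_true, if_false] at e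
      exact q ⟨v, mem_cl.2 ⟨hv, e ▸ hzv⟩, a⟩
  refine colorable_of_coloring (fun v => v ∈ cl G K ∅ ∧ g v = x) f ?_ ?_ ?_
  · rintro u v ⟨hu, gu⟩ ⟨hv, gv⟩ a
    exact hg2 u hu v hv a (gu.trans gv.symm)
  · intro v hv _
    by_cases e : trace G K v = ∅
    · simp only [f, e, if_true, Finset.sdiff_empty]
      split_ifs <;> assumption
    · obtain ⟨hzK, hzv⟩ := hz v hv e
      simp only [f, e, if_false]
      rw [Finset.mem_sdiff]
      refine ⟨hzK, fun q => ?_⟩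
      rw [hzv] at q
      exact Finset.notMem_erase _ _ q
  · intro u v hu hv hEu hEv a
    by_cases eu : trace G K u = ∅ <;> by_cases ev : trace G K v = ∅
    · have mu := mem_cl.2 ⟨hu, eu⟩
      have mv := mem_cl.2 ⟨hv, ev⟩
      have g1 := hg1 u mu
      have g2 := hg1 v mv
      have g3 := hg2 u mu v mv a
      simp only [Finset.mem_insert, Finset.mem_singleton] at g1 g2
      have g4 : g u ≠ x := fun q => hEu ⟨mu, q⟩
      have g5 : g v ≠ x := fun q => hEv ⟨mv, q⟩
      exact absurd ((g1.resolve_left g4).trans (g2.resolve_left g5).symm) g3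
    · exact key u v hu hv eu ev a
    · exact (key v u hv hu ev eu a.symm).symm
    · obtain ⟨k1, e1⟩ := hz u hu eu
      obtain ⟨k2, e2⟩ := hz v hv ev
      simp only [f, eu, ev, if_false]
      intro e
      exact h.not_adj_of_trace_eq_erase hu hv k1 e1 (e ▸ e2) a

end Setup
end LiveColoring

section ClassC

variable {V : Type*} [Fintype V] {G : SimpleGraph V} {K : Finset V}

lemma inClassC_of_map (φ : V → Option (Fin 5))
    (hadj : ∀ u v, u ≠ v → (G.Adj u v ↔ ∃ i j, φ u = some i ∧ φ v = some j ∧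
      (i = j ∨ j = i + 1 ∨ i = j + 1)))
    (hne : ∀ i, ∃ v, φ v = some i) : InClassC G := by
  let e : ∀ i : Fin 5, Fin (Fintype.card {v // φ v = some i}) ≃ {v // φ v = some i} :=
    fun i => (Fintype.equivFin _).symm
  let e₀ : Fin (Fintype.card {v // φ v = none}) ≃ {v // φ v = none} := (Fintype.equivFin _).symm
  refine ⟨fun i => Fintype.card {v // φ v = some i}, Fintype.card {v // φ v = none}, fun i => ?_, ?_⟩
  · obtain ⟨v, hv⟩ := hne i
    exact Fintype.card_pos_iff.2 ⟨⟨v, hv⟩⟩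
  · let F : (Σ i : Fin 5, Fin (Fintype.card {v // φ v = some i})) ⊕
        Fin (Fintype.card {v // φ v = none}) → V :=
      Sum.elim (fun p => (e p.1 p.2).1) (fun q => (e₀ q).1)
    have hF1 : ∀ p, φ (F (Sum.inl p)) = some p.1 := fun p => (e p.1 p.2).2
    have hF2 : ∀ q, φ (F (Sum.inr q)) = none := fun q => (e₀ q).2
    have inj : Function.Injective F := by
      rintro (⟨i, p⟩ | p) (⟨j, q⟩ | q) hpq
      · have h1 := hF1 ⟨i, p⟩
        rw [hpq, hF1] at h1
        obtain rfl : j = i := Option.some.inj h1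
        have : p = q := (e j).injective (Subtype.ext hpq)
        rw [this]
      · have h1 := hF1 ⟨i, p⟩
        rw [hpq, hF2] at h1
        exact absurd h1 (by simp)
      · have h1 := hF2 p
        rw [hpq, hF1] at h1
        exact absurd h1 (by simp)
      · have : p = q := e₀.injective (Subtype.ext hpq)
        rw [this]
    have surj : Function.Surjective F := by
      intro v
      rcases hv : φ v with _ | i
      · exact ⟨Sum.inr (e₀.symm ⟨v, hv⟩), by simp [F]⟩
      · exact ⟨Sum.inl ⟨i, (e i).symm ⟨v, hv⟩⟩, by simp [F]⟩
    have iso : ∀ x y, G.Adj (F x) (F y) ↔ (blowupC5 (fun i => Fintype.card {v // φ v = some i})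
        (Fintype.card {v // φ v = none})).Adj x y := by
      intro x y
      by_cases hxy : x = y
      · simp [hxy]
      rw [hadj _ _ (fun q => hxy (inj q)), blowupC5, SimpleGraph.fromRel_adj]
      rcases x with p | p <;> rcases y with q | q <;> simp [hF1, hF2]
      grind
    exact ⟨(⟨Equiv.ofBijective F ⟨inj, surj⟩, iso _ _⟩ : blowupC5 _ _ ≃g G).symm⟩

namespace Setup

variable (h : Setup G K)
include h

lemma inClassC_of_small_not_adj {t u q : V} (ht : Live G K t) (hu : Small G K u)
    (hq : Small G K q) (hne : trace G K u ≠ trace G K q) (c : ¬ G.Adj u q)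
    (hU : trace G K u ∪ trace G K q = K) : InClassC G := by
  have hd := h.small_disjoint hu hq ht hne
  have hk := h.four
  have hcard : (trace G K u).card + (trace G K q).card = K.card := by
    rw [← Finset.card_union_of_disjoint hd, hU]
  have hu2 := hu.card
  have hq2 := hq.card
  have hsm : ∀ v ∉ K, trace G K v ≠ ∅ → Small G K v := by
    intro v hv hvne
    by_contra hs
    obtain ⟨x, hx, e⟩ := h.exists_trace_eq_erase hv (Finset.nonempty_iff_ne_empty.2 hvne) hs
    rw [← hU, Finset.mem_union] at hx
    rcases hx with hx | hx
    · have := h.small_trace_eq_singleton hv e hu ht hx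
      rw [this, Finset.card_singleton] at hcard
      omega
    · have := h.small_trace_eq_singleton hv e hq ht hx
      rw [this, Finset.card_singleton] at hcard
      omega
  have htr : ∀ v ∉ K, trace G K v = ∅ ∨ trace G K v = trace G K u ∨
      trace G K v = trace G K q := by
    intro v hv
    by_contra! c'
    obtain ⟨c1, c2, c3⟩ := c'
    have hs := hsm v hv c1.ne_empty
    have d1 := h.small_disjoint hs hu ht c2
    have d2 := h.small_disjoint hs hq ht c3
    obtain ⟨x, hx⟩ := hs.nonempty
    have hxK := trace_subset v hx
    rw [← hU, Finset.mem_union] at hxK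
    rcases hxK with r | r
    · exact Finset.disjoint_left.1 d1 hx r
    · exact Finset.disjoint_left.1 d2 hx r
  have huq : ∀ v ∉ K, ∀ w ∉ K, trace G K v = trace G K u → trace G K w = trace G K q →
      ¬ G.Adj v w := by
    intro v hv w hw ev ew a
    have sv := hu.congr hv ev
    have sw := hq.congr hw ew
    have a1 := h.small_adj_congr sv hu sw ht ev (by rwa [ev, ew]) a
    exact c (h.small_adj_congr sw hq hu ht ew (by rw [ew]; exact hne.symm) a1.symm).symm
  have hune := hu.nonempty.ne_empty
  have hqne := hq.nonempty.ne_empty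
  have hmem : ∀ x ∈ K, ∀ v, G.Adj x v ↔ x ∈ trace G K v := fun x hx v => by
    rw [mem_trace, G.adj_comm]
    simp [hx]
  have hKq : ∀ x ∈ K, x ∉ trace G K u ↔ x ∈ trace G K q := by
    intro x hx
    refine ⟨fun r => ?_, fun r r' => Finset.disjoint_left.1 hd r' r⟩
    rw [← hU, Finset.mem_union] at hx
    exact hx.resolve_left r
  have nlive : ∀ v ∉ K, trace G K v = ∅ → ¬ Live G K v → ∀ w, ¬ G.Adj v w := by
    intro v hv ev hl w a
    by_cases hw : w ∈ K
    · have := (hmem w hw v).1 a.symm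
      rw [ev] at this
      simp at this
    by_cases ew : trace G K w = ∅
    · exact hl ⟨hv, ev, w, hw, ew, a⟩
    · exact hl (h.live_of_adj (hsm w hw ew) ht hv ev a.symm)
  let φ : V → Option (Fin 5) := fun v =>
    if v ∈ K then (if v ∈ trace G K u then some 0 else some 1)
    else if trace G K v = trace G K q then some 2
    else if trace G K v = trace G K u then some 4
    else if Live G K v then some 3 else none
  have φ0 : ∀ v ∈ K, v ∈ trace G K u → φ v = some 0 := fun v h1 h2 => by simp only [φ, h1, h2, if_true]
  have φ1 : ∀ v ∈ K, v ∉ trace G K u → φ v = some 1 := fun v h1 h2 => by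
    simp only [φ, h1, h2, if_true, if_false]
  have φ2 : ∀ v ∉ K, trace G K v = trace G K q → φ v = some 2 := fun v h1 h2 => by
    simp only [φ, h1, h2, if_true, if_false]
  have φ4 : ∀ v ∉ K, trace G K v = trace G K u → φ v = some 4 := fun v h1 h2 => by
    simp only [φ, h1, h2, if_true, if_false, hne]
  have φ3 : ∀ v ∉ K, Live G K v → φ v = some 3 := fun v h1 h2 => by
    simp only [φ, h1, h2, h2.trace_eq, hune.symm, hqne.symm, if_true, if_false]
  have φn : ∀ v ∉ K, trace G K v = ∅ → ¬ Live G K v → φ v = none := fun v h1 h2 h3 => by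
    simp only [φ, h1, h2, h3, hune.symm, hqne.symm, if_false]
  have cases : ∀ v, (v ∈ K ∧ v ∈ trace G K u ∧ φ v = some 0) ∨
      (v ∈ K ∧ v ∉ trace G K u ∧ φ v = some 1) ∨
      (v ∉ K ∧ trace G K v = trace G K q ∧ φ v = some 2) ∨
      (v ∉ K ∧ Live G K v ∧ φ v = some 3) ∨
      (v ∉ K ∧ trace G K v = trace G K u ∧ φ v = some 4) ∨
      (v ∉ K ∧ (trace G K v = ∅ ∧ ¬ Live G K v) ∧ φ v = none) := by
    intro v
    by_cases hv : v ∈ K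
    · by_cases hv' : v ∈ trace G K u
      · exact .inl ⟨hv, hv', φ0 v hv hv'⟩
      · exact .inr (.inl ⟨hv, hv', φ1 v hv hv'⟩)
    · rcases htr v hv with e | e | e
      · by_cases hl : Live G K v
        · exact .inr (.inr (.inr (.inl ⟨hv, hl, φ3 v hv hl⟩)))
        · exact .inr (.inr (.inr (.inr (.inr ⟨hv, ⟨e, hl⟩, φn v hv e hl⟩))))
      · exact .inr (.inr (.inr (.inr (.inl ⟨hv, e, φ4 v hv e⟩))))
      · exact .inr (.inr (.inl ⟨hv, e, φ2 v hv e⟩))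
  refine inClassC_of_map φ ?_ ?_
  · have half : ∀ v w, v ≠ w → ∀ i j, φ v = some i → φ w = some j → i ≤ j →
        (G.Adj v w ↔ (i = j ∨ j = i + 1 ∨ i = j + 1)) := by
      intro v w hvw i j hi hj hij
      rcases cases v with ⟨hv, cv, e⟩ | ⟨hv, cv, e⟩ | ⟨hv, cv, e⟩ | ⟨hv, cv, e⟩ | ⟨hv, cv, e⟩ |
        ⟨hv, cv, e⟩ <;> rw [hi] at e <;> cases e <;>
      rcases cases w with ⟨hw, cw, e⟩ | ⟨hw, cw, e⟩ | ⟨hw, cw, e⟩ | ⟨hw, cw, e⟩ | ⟨hw, cw, e⟩ |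
        ⟨hw, cw, e⟩ <;> rw [hj] at e <;> cases e <;> first
          | exact absurd hij (by decide)
          | refine iff_of_true ?_ (by decide)
          | refine iff_of_false ?_ (by decide)
      · exact h.clique v hv w hw hvw
      · exact h.clique v hv w hw hvw
      · rw [hmem v hv, cw]
        exact fun r => Finset.disjoint_left.1 hd cv r
      · rw [hmem v hv, cw.trace_eq]
        simp
      · rwa [hmem v hv, cw]
      · exact h.clique v hv w hw hvw
      · rw [hmem v hv, cw]
        exact (hKq v hv).1 cv
      · rw [hmem v hv, cw.trace_eq]
        simp
      · rwa [hmem v hv, cw]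
      · exact h.small_adj_of_trace_eq (hq.congr hv cv) (hq.congr hw cw) ht hvw (cv.trans cw.symm)
      · exact h.adj_live (hq.congr hv cv) cw
      · exact fun a => huq w hw v hv cw cv a.symm
      · exact h.live_adj_live hu cv cw hvw
      · exact (h.adj_live (hu.congr hw cw) cv).symm
      · exact h.small_adj_of_trace_eq (hu.congr hv cv) (hu.congr hw cw) ht hvw (cv.trans cw.symm)
    have hnone : ∀ v w, φ v = none → ¬ G.Adj v w := by
      intro v w hv
      rcases cases v with ⟨_, _, e⟩ | ⟨_, _, e⟩ | ⟨_, _, e⟩ | ⟨_, _, e⟩ | ⟨_, _, e⟩ | ⟨h1, h2, _⟩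
      on_goal 6 => exact nlive v h1 h2.1 h2.2 w
      all_goals
        rw [hv] at e
        cases e
    intro v w hvw
    rcases hv : φ v with _ | i
    · exact iff_of_false (hnone v w hv) (by simp)
    rcases hw : φ w with _ | j
    · exact iff_of_false (fun a => hnone w v hw a.symm) (by simp)
    have : G.Adj v w ↔ (i = j ∨ j = i + 1 ∨ i = j + 1) := by
      rcases le_total i j with q | q
      · exact half v w hvw i j hv hw q
      · rw [G.adj_comm, half w v hvw.symm j i hw hv q]
        grind
    simpa using this
  · obtain ⟨x, hx⟩ := hu.nonempty
    obtain ⟨y, hy⟩ := hq.nonempty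
    have hyK := trace_subset q hy
    intro i
    fin_cases i
    · exact ⟨x, φ0 x (trace_subset u hx) hx⟩
    · exact ⟨y, φ1 y hyK ((hKq y hyK).2 hy)⟩
    · exact ⟨q, φ2 q hq.not_mem rfl⟩
    · exact ⟨t, φ3 t ht.not_mem ht⟩
    · exact ⟨u, φ4 u hu.not_mem rfl⟩

lemma inClassC_or_colorable_of_live {t : V} (ht : Live G K t) :
    InClassC G ∨ G.Colorable (K.card + 1) := by
  by_cases he : ∀ w ∉ K, ∀ w' ∉ K, ∀ x ∈ K, ∀ y ∈ K, trace G K w = K.erase x →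
      trace G K w' = K.erase y → x = y
  · by_cases ha : ∀ u q, Small G K u → Small G K q → trace G K u ≠ trace G K q → G.Adj u q
    · exact Or.inr (h.colorable_of_small_complete ht he ha)
    · push Not at ha
      obtain ⟨u, q, hu, hq, hne, c⟩ := ha
      by_cases hU : trace G K u ∪ trace G K q = K
      · exact Or.inl (h.inClassC_of_small_not_adj ht hu hq hne c hU)
      · exact Or.inr (h.colorable_of_small_not_adj ht he hu hq hne c hU)
  · push Not at he
    obtain ⟨w, hw, w', hw', x, hx, y, hy, ew, ew', hne⟩ := he
    exact Or.inr (h.colorable_of_erase hw hw' hx hy ew ew' hne fun u hu =>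
      hne (h.erase_unique hu ht hw hw' hx hy ew ew'))

lemma disjoint_or_union_of_isTop {M N : Finset V} (hM : IsTop G K M) (hN : IsTop G K N)
    (hne : M ≠ N) : Disjoint M N ∨ M ∪ N = K := by
  obtain ⟨u, hu⟩ := hM.inhabited
  obtain ⟨w, hw⟩ := hN.inhabited
  obtain ⟨hu', rfl⟩ := mem_cl.1 hu
  obtain ⟨hw', rfl⟩ := mem_cl.1 hw
  rcases h.cross_free u w with q | q | q | q
  · exact Or.inl q
  · exact absurd (hM.maximal w hw' q).symm hne
  · exact absurd (hN.maximal u hu' q) hne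
  · exact Or.inr q.1

lemma union_ne_of_isTop {M N P : Finset V} (hM : IsTop G K M) (hN : IsTop G K N)
    (hP : IsTop G K P) (hne : M ≠ N) (hU : M ∪ N ≠ K) (hPM : P ≠ M) : P ∪ M ≠ K := by
  intro e
  have hd := (h.disjoint_or_union_of_isTop hM hN hne).resolve_right hU
  have hNP : N ⊆ P := by
    intro x hx
    have := hN.subset hx
    rw [← e, Finset.mem_union] at this
    exact this.resolve_right fun q => Finset.disjoint_left.1 hd q hx
  obtain ⟨w, hw⟩ := hP.inhabited
  obtain ⟨hw', rfl⟩ := mem_cl.1 hw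
  have := hN.maximal w hw' hNP
  rw [this, Finset.union_comm] at e
  exact hU e

/-- If two maximal traces do not cover `K`, then any two are apart. -/
lemma apart_of_isTop {M N P Q : Finset V} (hM : IsTop G K M) (hN : IsTop G K N) (hne : M ≠ N)
    (hU : M ∪ N ≠ K) (hP : IsTop G K P) (hQ : IsTop G K Q) (hPQ : P ≠ Q) : Apart K P Q := by
  have hU' : P ∪ Q ≠ K := by
    rcases eq_or_ne P M with rfl | hPM
    · rw [Finset.union_comm]
      exact h.union_ne_of_isTop hM hN hQ hne hU hPQ.symm
    · have := h.union_ne_of_isTop hM hN hP hne hU hPM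
      rw [Finset.union_comm]
      exact h.union_ne_of_isTop hP hM hQ hPM this hPQ.symm
  exact ⟨(h.disjoint_or_union_of_isTop hP hQ hPQ).resolve_right hU', hU'⟩

omit [Fintype V] in
lemma card_eq {K' : Finset V} (h' : Setup G K') : K'.card = K.card :=
  le_antisymm (h.max K' h'.clique) (h'.max K h.clique)

theorem inClassC_or_colorable : InClassC G ∨ G.Colorable (K.card + 1) := by
  by_cases c1 : ∃ K' t, Setup G K' ∧ Live G K' t
  · obtain ⟨K', t, h', ht⟩ := c1
    rw [← h.card_eq h']
    exact h'.inClassC_or_colorable_of_live ht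
  have stable : ∀ K', Setup G K' → ∀ u ∉ K', ∀ v ∉ K', trace G K' u = ∅ → trace G K' v = ∅ →
      ¬ G.Adj u v := fun K' h' u hu v hv eu ev a => c1 ⟨K', u, h', hu, eu, v, hv, ev, a⟩
  by_cases c2 : ∃ K', Setup G K' ∧ ∀ M N, IsTop G K' M → IsTop G K' N → M ≠ N → M ∪ N = K'
  · obtain ⟨K', h', hcov⟩ := c2
    rw [← h.card_eq h']
    exact Or.inr (h'.colorable_of_covering (stable K' h') hcov)
  push Not at c2
  have apart : ∀ K', Setup G K' → ∀ M N, IsTop G K' M → IsTop G K' N → M ≠ N → Apart K' M N := by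
    intro K' h' P Q hP hQ hne
    obtain ⟨M, N, hM, hN, hMN, hU⟩ := c2 K' h'
    exact h'.apart_of_isTop hM hN hMN hU hP hQ hne
  obtain ⟨M, N, hM, hN, hMN, -⟩ := c2 K h
  refine Or.inr (ApartSetup.colorable ⟨h, stable K h, apart K h, ?_⟩ hM hN hMN)
  rintro K' h' x hx y hy ⟨z, hz, xz⟩ ⟨z', hz', yz'⟩ hxy
  obtain ⟨P, hP, hxP⟩ := exists_isTop hx ⟨z, mem_trace.2 ⟨hz, xz⟩⟩
  obtain ⟨Q, hQ, hyQ⟩ := exists_isTop hy ⟨z', mem_trace.2 ⟨hz', yz'⟩⟩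
  have hU : P ∪ Q = K' := by
    refine Finset.Subset.antisymm (Finset.union_subset hP.subset hQ.subset) fun w hw => ?_
    by_cases a : G.Adj y w
    · exact Finset.mem_union_right _ (hyQ (mem_trace.2 ⟨hw, a⟩))
    · exact Finset.mem_union_left _ (hxP (mem_trace.2 ⟨hw, (hxy w hw).2 a⟩))
  rcases eq_or_ne P Q with rfl | hne
  · rw [Finset.union_self] at hU
    obtain ⟨w, hw⟩ := hP.inhabited
    obtain ⟨hw, e⟩ := mem_cl.1 hw
    exact h'.trace_ne hw (e.trans hU)
  · exact (apart K' h' P Q hP hQ hne).2 hU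

end Setup

omit [Fintype V] in
lemma not_p2p3 (hG : IsFreeOf G graphP2P3) (a b c d e : V) (ab : G.Adj a b) (cd : G.Adj c d)
    (de : G.Adj d e) (hce : c ≠ e) (ce : ¬ G.Adj c e) (ac : ¬ G.Adj a c) (ad : ¬ G.Adj a d)
    (ae : ¬ G.Adj a e) (bc : ¬ G.Adj b c) (bd : ¬ G.Adj b d) (be : ¬ G.Adj b e) : False := by
  have n1 : a ≠ c := by rintro rfl; exact bc ab.symm
  have n2 : a ≠ d := by rintro rfl; exact bd ab.symm
  have n3 : a ≠ e := by rintro rfl; exact be ab.symm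
  have n4 : b ≠ c := by rintro rfl; exact ac ab
  have n5 : b ≠ d := by rintro rfl; exact ad ab
  have n6 : b ≠ e := by rintro rfl; exact ae ab
  refine hG.false ⟨⟨![a, b, c, d, e], fun i j hij => ?_⟩, fun {i j} => ?_⟩
  · fin_cases i <;> fin_cases j <;>
      simp_all [ab.ne, cd.ne, de.ne, ab.ne', cd.ne', de.ne']
  · change G.Adj (![a, b, c, d, e] i) (![a, b, c, d, e] j) ↔ _
    fin_cases i <;> fin_cases j <;>
      simp [graphP2P3, ab, cd, de, ce, ac, ad, ae, bc, bd, be, ab.symm, cd.symm, de.symm,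
        G.adj_comm c a, G.adj_comm d a, G.adj_comm e a, G.adj_comm c b, G.adj_comm d b,
        G.adj_comm e b, G.adj_comm e c]

omit [Fintype V] in
lemma not_gem (hG : IsFreeOf G graphGem) (z a b c d : V) (ab : G.Adj a b) (bc : G.Adj b c)
    (cd : G.Adj c d) (ac : ¬ G.Adj a c) (ad : ¬ G.Adj a d) (bd : ¬ G.Adj b d) (za : G.Adj z a)
    (zb : G.Adj z b) (zc : G.Adj z c) (zd : G.Adj z d) : False := by
  have n1 : a ≠ c := by rintro rfl; exact ad cd
  have n2 : a ≠ d := by rintro rfl; exact ac cd.symm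
  have n3 : b ≠ d := by rintro rfl; exact ad ab
  refine hG.false ⟨⟨![a, b, c, d, z], fun i j hij => ?_⟩, fun {i j} => ?_⟩
  · fin_cases i <;> fin_cases j <;>
      simp_all [ab.ne, bc.ne, cd.ne, za.ne, zb.ne, zc.ne, zd.ne, ab.ne', bc.ne', cd.ne', za.ne',
        zb.ne', zc.ne', zd.ne']
  · change G.Adj (![a, b, c, d, z] i) (![a, b, c, d, z] j) ↔ _
    fin_cases i <;> fin_cases j <;>
      simp [graphGem, ab, bc, cd, za, zb, zc, zd, ac, ad, bd, ab.symm, bc.symm, cd.symm, za.symm,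
        zb.symm, zc.symm, zd.symm, G.adj_comm c a, G.adj_comm d a, G.adj_comm d b]

/-- A maximum clique of a `(P2 + P3, gem)`-free graph with clique number at least four. -/
lemma exists_setup (h1 : IsFreeOf G graphP2P3) (h2 : IsFreeOf G graphGem)
    (hw : 4 ≤ G.cliqueNum) : ∃ K, Setup G K ∧ K.card = G.cliqueNum := by
  obtain ⟨K, hK⟩ := G.exists_isNClique_cliqueNum
  rw [SimpleGraph.isNClique_iff] at hK
  obtain ⟨hc, hcard⟩ := hK
  refine ⟨K, ⟨not_p2p3 h1, not_gem h2, fun x hx y hy => hc hx hy, fun Q hQ => ?_, hcard ▸ hw⟩, hcard⟩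
  rw [hcard]
  exact SimpleGraph.IsClique.card_le_cliqueNum (t := Q) (tc := fun x hx y hy => hQ x hx y hy)

end ClassC

end GemFree

/-- A (P2+P3, gem)-free graph `G` with `ω(G) ≥ 4` is in the class `𝒞`
or satisfies `χ(G) ≤ ω(G) + 1`. -/
theorem inClassC_or_chi_le_omega_add_one {V : Type*} [Fintype V] (G : SimpleGraph V)
    (h1 : IsFreeOf G graphP2P3) (h2 : IsFreeOf G graphGem)
    (hw : 4 ≤ G.cliqueNum) :
    InClassC G ∨ G.chromaticNumber ≤ (G.cliqueNum : ℕ∞) + 1 := by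
  obtain ⟨K, h, e⟩ := GemFree.exists_setup h1 h2 hw
  rcases h.inClassC_or_colorable with q | q
  · exact Or.inl q
  · right
    rw [e] at q
    exact_mod_cast q.chromaticNumber_le
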